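/- There exists a constant C > 0 such that the following holds. Let G be a connected finite simple graph on n ≥ 1 vertices that admits a planar straight-line drawing in ℝ² (i.e., G is planar). Then G admits a monotone grid drawing g : V → ℤ² in which every vertex is placed at a grid point (x, y) with 0 ≤ x ≤ C·n and 0 ≤ y ≤ C·n². -/

import Mathlib

open SimpleGraph

/-- Dot product on `ℝ × ℝ`. -/
def dot (p q : ℝ × ℝ) : ℝ := p.1 * q.1 + p.2 * q.2

/-- The real point corresponding to a grid point. -/
def gridMap {V : Type} (g : V → ℤ × ℤ) : V → ℝ × ℝ :=
  fun v => (((g v).1 : ℝ), ((g v).2 : ℝ))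

/-- `f` is a planar (crossing-free) straight-line drawing of `G`. -/
def IsPlanarDrawing {V : Type} (G : SimpleGraph V) (f : V → ℝ × ℝ) : Prop :=
  Function.Injective f ∧
  (∀ a b c d : V, G.Adj a b → G.Adj c d → s(a, b) ≠ s(c, d) →
    ∀ p : ℝ × ℝ, p ∈ segment ℝ (f a) (f b) → p ∈ segment ℝ (f c) (f d) →
      ∃ x : V, (x = a ∨ x = b) ∧ (x = c ∨ x = d) ∧ p = f x) ∧
  (∀ a b c : V, G.Adj a b → c ≠ a → c ≠ b → f c ∉ openSegment ℝ (f a) (f b))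

/-- The walk `w` is monotone with respect to some direction in the drawing `f`. -/
def MonotoneWalk {V : Type} {G : SimpleGraph V} (f : V → ℝ × ℝ) {a b : V}
    (w : G.Walk a b) : Prop :=
  ∃ d : ℝ × ℝ, d ≠ 0 ∧ w.support.Chain' (fun x y => 0 < dot (f y - f x) d)

/-- `f` is a monotone (planar straight-line) drawing of `G`. -/
def IsMonotoneDrawing {V : Type} (G : SimpleGraph V) (f : V → ℝ × ℝ) : Prop :=
  IsPlanarDrawing G f ∧
  ∀ a b : V, a ≠ b → ∃ w : G.Walk a b, w.IsPath ∧ MonotoneWalk f w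

/-- A rooted ordered spanning tree of `G`, recorded by the times `o v < z v` at which a walk around
the tree opens and closes each vertex. -/
structure RootedContour {V : Type} (G : SimpleGraph V) (r : V) (par : V → V) (o z : V → ℝ) :
    Prop where
  lt : ∀ v, o v < z v
  adj : ∀ v, v ≠ r → G.Adj (par v) v
  par_o : ∀ v, v ≠ r → o (par v) < o v
  par_z : ∀ v, v ≠ r → z v < z (par v)
  laminar : ∀ v w, v ≠ w →
    z v < o w ∨ z w < o v ∨ (o v < o w ∧ z w < z v) ∨ (o w < o v ∧ z v < z w)
  least : ∀ v w, v ≠ r → o w < o v → z v < z w →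
    w = par v ∨ (o w < o (par v) ∧ z (par v) < z w)
  edge : ∀ v w, G.Adj v w →
    (v ≠ r ∧ w = par v) ∨ (w ≠ r ∧ v = par w) ∨ z v < o w ∨ z w < o v
  nc : ∀ i j i' j', G.Adj i j → G.Adj i' j' → z i < z i' → z i' < o j → o j < o j' → False
  root : ∀ v, v ≠ r → o r < o v ∧ z v < z r

/-- `k` has to be placed before `v`. -/
def Precedes {V : Type} (G : SimpleGraph V) (r : V) (par : V → V) (o z : V → ℝ) (k v : V) : Prop :=
  (v ≠ r ∧ k = par v) ∨ (∃ j, G.Adj v j ∧ z v < o k ∧ z k < o j) ∨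
    (∃ i, G.Adj i v ∧ z i < z k ∧ z k < o v)

namespace RootedContour

variable {V : Type} {G : SimpleGraph V} {r : V} {par : V → V} {o z : V → ℝ}

theorem exists_not_precedes (h : RootedContour G r par o z) (U : Finset V) (hU : U.Nonempty) :
    ∃ l ∈ U, ∀ v ∈ U, ¬ Precedes G r par o z l v := by
  classical
  let I := U.filter (fun j => ∀ u ∈ U, ∀ m, G.Adj u m → z u < o j → ¬ o j < o m)
  have hI : I.Nonempty := by
    obtain ⟨j, hj, hmin⟩ := U.exists_min_image o hU
    refine ⟨j, Finset.mem_filter.2 ⟨hj, fun u hu m _ h1 _ => ?_⟩⟩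
    linarith [hmin u hu, h.lt u]
  obtain ⟨j, hjI, hmax⟩ := I.exists_max_image o hI
  obtain ⟨hjU, hj⟩ := Finset.mem_filter.1 hjI
  let W := U.filter (fun l => o j ≤ o l ∧ z l ≤ z j)
  have hW : W.Nonempty := ⟨j, Finset.mem_filter.2 ⟨hjU, le_rfl, le_rfl⟩⟩
  obtain ⟨l, hlW, hmin⟩ := W.exists_min_image z hW
  obtain ⟨hlU, hl1, hl2⟩ := Finset.mem_filter.1 hlW
  have hll := h.lt l
  have key : ∀ u ∈ U, z u < z l → z u < o j ∨ o u < o j ∧ o j < z u := by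
    intro u hu hul
    have hne : u ≠ j := by rintro rfl; linarith
    have := h.lt u
    rcases h.laminar u j hne with h1 | h1 | h1 | h1
    · exact Or.inl h1
    · linarith
    · linarith
    · have := hmin u (Finset.mem_filter.2 ⟨hu, h1.1.le, h1.2.le⟩)
      linarith
  have key' : ∀ u ∈ U, z u < z l → z u < o j := by
    intro u hu hul
    have hne : u ≠ j := by rintro rfl; linarith
    have := h.lt u
    rcases h.laminar u j hne with h1 | h1 | h1 | h1
    · exact h1
    · linarith
    · linarith
    · have := hmin u (Finset.mem_filter.2 ⟨hu, h1.1.le, h1.2.le⟩)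
      linarith
  refine ⟨l, hlU, fun v hv hR => ?_⟩
  rcases hR with ⟨hvr, rfl⟩ | ⟨m, hm, h1, h2⟩ | ⟨i, hi, h1, h2⟩
  · have h1 := h.par_o v hvr
    have h2 := h.par_z v hvr
    have := hmin v (Finset.mem_filter.2 ⟨hv, by linarith, by linarith⟩)
    linarith
  · exact hj v hv m hm (key' v hv (by linarith)) (by linarith)
  · have hvI : v ∈ I := by
      refine Finset.mem_filter.2 ⟨hv, fun u hu m hm h3 h4 => ?_⟩
      have h5 : z u ≤ z i := by
        by_contra! h5
        exact h.nc i v u m hi hm h5 h3 h4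
      exact hj u hu m hm (key' u hu (by linarith)) (by linarith)
    linarith [hmax v hvI]

end RootedContour

theorem exists_rank_of_exists_maximal {V : Type} [DecidableEq V] (R : V → V → Prop)
    (hR : ∀ U : Finset V, U.Nonempty → ∃ l ∈ U, ∀ v ∈ U, ¬ R l v) (U : Finset V) :
    ∃ x : V → ℕ, Set.InjOn x U ∧ (∀ v ∈ U, x v < U.card) ∧
      ∀ k ∈ U, ∀ v ∈ U, R k v → x k < x v := by
  induction U using Finset.strongInduction with
  | H U ih =>
    rcases U.eq_empty_or_nonempty with rfl | hU
    · exact ⟨fun _ => 0, by simp, by simp, by simp⟩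
    · obtain ⟨l, hl, hmax⟩ := hR U hU
      obtain ⟨x, hinj, hlt, hmono⟩ := ih (U.erase l) (Finset.erase_ssubset hl)
      have hcard := Finset.card_erase_add_one hl
      have hlt' : ∀ v ∈ U, v ≠ l → x v < U.card - 1 := by
        intro v hv hvl
        have := hlt v (Finset.mem_erase.2 ⟨hvl, hv⟩)
        omega
      refine ⟨Function.update x l (U.card - 1), ?_, ?_, ?_⟩
      · intro v hv w hw hvw
        by_cases h1 : v = l <;> by_cases h2 : w = l
        · rw [h1, h2]
        · subst h1
          have := hlt' w hw h2
          simp [Function.update_of_ne h2] at hvw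
          omega
        · subst h2
          have := hlt' v hv h1
          simp [Function.update_of_ne h1] at hvw
          omega
        · rw [Function.update_of_ne h1, Function.update_of_ne h2] at hvw
          exact hinj (by simp [h1]; exact hv) (by simp [h2]; exact hw) hvw
      · intro v hv
        by_cases h1 : v = l
        · subst h1; simp; omega
        · rw [Function.update_of_ne h1]
          have := hlt' v hv h1
          omega
      · intro k hk v hv hkv
        have h1 : k ≠ l := by rintro rfl; exact hmax v hv hkv
        rw [Function.update_of_ne h1]
        by_cases h2 : v = l
        · subst h2; simpa using hlt' k hk h1
        · rw [Function.update_of_ne h2]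
          exact hmono k (by simp [h1, hk]) v (by simp [h2, hv]) hkv

/-- Coordinates assigned to a contour: `x` respects `Precedes`, the numbers `s` decrease in closing
order, and the tree edge above `v` has slope `s v`. -/
structure ContourCoords {V : Type} (G : SimpleGraph V) (r : V) (par : V → V) (o z : V → ℝ)
    (x s Y : V → ℝ) : Prop extends RootedContour G r par o z where
  x_inj : Function.Injective x
  x_lt : ∀ k v, Precedes G r par o z k v → x k < x v
  s_lt : ∀ v w, z v < z w → s w < s v
  Y_eq : ∀ v, v ≠ r → Y v = Y (par v) + s v * (x v - x (par v))

/-- `q` is a proper ancestor of `u`. -/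
def Anc {V : Type} (o z : V → ℝ) (q u : V) : Prop := o q < o u ∧ z u < z q

/-- `a` lies on the tree path from `u` up to its ancestor `q`, with `q` excluded. -/
def OnPath {V : Type} (o z : V → ℝ) (q u a : V) : Prop := (a = u ∨ Anc o z a u) ∧ Anc o z q a

namespace ContourCoords

variable {V : Type} [Finite V] {G : SimpleGraph V} {r : V} {par : V → V} {o z x s Y : V → ℝ}

theorem s_le (h : ContourCoords G r par o z x s Y) {v w : V} (hvw : z v ≤ z w) : s w ≤ s v := by
  rcases hvw.lt_or_eq with h1 | h1
  · exact (h.s_lt v w h1).le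
  · have : v = w := by
      by_contra hne
      have := h.lt v
      have := h.lt w
      rcases h.laminar v w hne with h2 | h2 | h2 | h2 <;> linarith
    rw [this]

theorem s_lt_of (h : ContourCoords G r par o z x s Y) {v w : V} (hvw : z v < z w) : s w < s v :=
  h.s_lt v w hvw

theorem ne_root (h : ContourCoords G r par o z x s Y) {q u : V} (hq : Anc o z q u) : u ≠ r := by
  rintro rfl
  by_cases hqr : q = u
  · subst hqr; exact lt_irrefl _ hq.1
  · have := (h.root q hqr).1
    exact absurd hq.1 (by linarith)

theorem path_induction (h : ContourCoords G r par o z x s Y) {q : V} {P : V → Prop} (hq : P q)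
    (hstep : ∀ u, Anc o z q u → P (par u) → P u) : ∀ u, Anc o z q u → P u := by
  intro u
  have wf : WellFounded (fun a b => o a < o b) :=
    @Finite.wellFounded_of_trans_of_irrefl V _ (fun a b => o a < o b)
      ⟨fun _ _ _ => lt_trans⟩ ⟨fun _ => lt_irrefl _⟩
  induction u using wf.induction with
  | _ u ih =>
    intro hu
    have hr := h.ne_root hu
    refine hstep u hu ?_
    rcases h.least u q hr hu.1 hu.2 with h1 | h1
    · rw [← h1]; exact hq
    · exact ih _ (h.par_o u hr) h1

theorem onPath_par (h : ContourCoords G r par o z x s Y) {q u a : V} (hu : Anc o z q u)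
    (ha : OnPath o z q (par u) a) : OnPath o z q u a := by
  have hr := h.ne_root hu
  have h1 := h.par_o u hr
  have h2 := h.par_z u hr
  refine ⟨Or.inr ?_, ha.2⟩
  rcases ha.1 with rfl | h3
  · exact ⟨h1, h2⟩
  · exact ⟨h3.1.trans h1, h2.trans h3.2⟩

theorem x_par (h : ContourCoords G r par o z x s Y) {u : V} (hu : u ≠ r) : x (par u) < x u :=
  h.x_lt _ _ (Or.inl ⟨hu, rfl⟩)

theorem x_anc (h : ContourCoords G r par o z x s Y) {q u : V} (hu : Anc o z q u) : x q < x u := by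
  suffices x q ≤ x (par u) from this.trans_lt (h.x_par (h.ne_root hu))
  have : ∀ u, Anc o z q u → x q ≤ x u := h.path_induction le_rfl
    (fun u hu h1 => h1.trans (h.x_par (h.ne_root hu)).le)
  rcases h.least u q (h.ne_root hu) hu.1 hu.2 with h1 | h1
  · rw [← h1]
  · exact this _ h1

theorem path_le (h : ContourCoords G r par o z x s Y) {q : V} (m : ℝ) : ∀ u, Anc o z q u →
    (∀ a, OnPath o z q u a → m ≤ s a) → Y q - m * x q ≤ Y u - m * x u := by
  refine h.path_induction (P := fun u => (∀ a, OnPath o z q u a → m ≤ s a) →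
    Y q - m * x q ≤ Y u - m * x u) (fun _ => le_rfl) (fun u hu ih hm => ?_)
  have h1 := ih (fun a ha => hm a (h.onPath_par hu ha))
  have h2 := hm u ⟨Or.inl rfl, hu⟩
  have h3 := h.x_par (h.ne_root hu)
  rw [h.Y_eq u (h.ne_root hu)]
  nlinarith [mul_nonneg (sub_nonneg.2 h2) (sub_nonneg.2 h3.le)]

theorem path_lt (h : ContourCoords G r par o z x s Y) {q : V} (m : ℝ) : ∀ u, Anc o z q u →
    (∀ a, OnPath o z q u a → m < s a) → Y q - m * x q < Y u - m * x u := by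
  intro u hu hm
  have h1 : Y q - m * x q ≤ Y (par u) - m * x (par u) := by
    rcases h.least u q (h.ne_root hu) hu.1 hu.2 with h1 | h1
    · rw [← h1]
    · exact h.path_le m _ h1 (fun a ha => (hm a (h.onPath_par hu ha)).le)
  have h2 := hm u ⟨Or.inl rfl, hu⟩
  have h3 := h.x_par (h.ne_root hu)
  rw [h.Y_eq u (h.ne_root hu)]
  nlinarith [mul_pos (sub_pos.2 h2) (sub_pos.2 h3)]

theorem path_ge (h : ContourCoords G r par o z x s Y) {q : V} (m : ℝ) : ∀ u, Anc o z q u →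
    (∀ a, OnPath o z q u a → s a ≤ m) → Y u - m * x u ≤ Y q - m * x q := by
  refine h.path_induction (P := fun u => (∀ a, OnPath o z q u a → s a ≤ m) →
    Y u - m * x u ≤ Y q - m * x q) (fun _ => le_rfl) (fun u hu ih hm => ?_)
  have h1 := ih (fun a ha => hm a (h.onPath_par hu ha))
  have h2 := hm u ⟨Or.inl rfl, hu⟩
  have h3 := h.x_par (h.ne_root hu)
  rw [h.Y_eq u (h.ne_root hu)]
  nlinarith [mul_nonneg (sub_nonneg.2 h2) (sub_nonneg.2 h3.le)]

theorem path_gt (h : ContourCoords G r par o z x s Y) {q : V} (m : ℝ) : ∀ u, Anc o z q u →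
    (∀ a, OnPath o z q u a → s a < m) → Y u - m * x u < Y q - m * x q := by
  intro u hu hm
  have h1 : Y (par u) - m * x (par u) ≤ Y q - m * x q := by
    rcases h.least u q (h.ne_root hu) hu.1 hu.2 with h1 | h1
    · rw [← h1]
    · exact h.path_ge m _ h1 (fun a ha => (hm a (h.onPath_par hu ha)).le)
  have h2 := hm u ⟨Or.inl rfl, hu⟩
  have h3 := h.x_par (h.ne_root hu)
  rw [h.Y_eq u (h.ne_root hu)]
  nlinarith [mul_pos (sub_pos.2 h2) (sub_pos.2 h3)]

theorem OnPath.z_le {q u a : V} (ha : OnPath o z q u a) : z u ≤ z a := by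
  rcases ha.1 with rfl | h1
  · exact le_rfl
  · exact h1.2.le

theorem OnPath.o_le {q u a : V} (ha : OnPath o z q u a) : o a ≤ o u := by
  rcases ha.1 with rfl | h1
  · exact le_rfl
  · exact h1.1.le

theorem exists_top (h : ContourCoords G r par o z x s Y) {q u : V} (hu : Anc o z q u) :
    ∃ a₀, OnPath o z q u a₀ ∧ ∀ a, OnPath o z q u a → s a₀ ≤ s a := by
  have := Set.exists_min_image {a | OnPath o z q u a} s (Set.toFinite _) ⟨u, Or.inl rfl, hu⟩
  simpa using this

theorem exists_lca (h : ContourCoords G r par o z x s Y) {v t : V} (hvt : z v < o t) :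
    ∃ q, Anc o z q v ∧ Anc o z q t ∧ (∀ a, OnPath o z q v a → z a < o t) ∧
      ∀ a, OnPath o z q t a → z v < o a := by
  have hv := h.lt v
  have ht := h.lt t
  have hr : Anc o z r v ∧ Anc o z r t := by
    have h1 : v ≠ r := by
      rintro rfl
      have : t ≠ v := by rintro rfl; linarith
      linarith [(h.root t this).2]
    have h2 : t ≠ r := by
      rintro rfl
      have : v ≠ t := by rintro rfl; linarith
      linarith [(h.root v this).1]
    exact ⟨h.root v h1, h.root t h2⟩
  obtain ⟨q, ⟨hq1, hq2⟩, hmax⟩ := Set.exists_max_image {q | Anc o z q v ∧ Anc o z q t} o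
    (Set.toFinite _) ⟨r, hr⟩
  refine ⟨q, hq1, hq2, fun a ha => ?_, fun a ha => ?_⟩
  · have h1 := OnPath.o_le ha
    have hne : a ≠ t := by rintro rfl; linarith
    rcases h.laminar a t hne with h2 | h2 | h2 | h2
    · exact h2
    · linarith
    · rcases ha.1 with rfl | h3
      · linarith
      · exact absurd (hmax a ⟨h3, h2⟩) (not_le.2 ha.2.1)
    · linarith
  · have h1 := OnPath.z_le ha
    have hne : v ≠ a := by rintro rfl; linarith
    have := h.lt a
    rcases h.laminar v a hne with h2 | h2 | h2 | h2
    · exact h2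
    · linarith
    · linarith
    · rcases ha.1 with rfl | h3
      · linarith
      · exact absurd (hmax a ⟨h2, h3⟩) (not_le.2 ha.2.1)

theorem left_above (h : ContourCoords G r par o z x s Y) {v t : V} (hvt : z v < o t) :
    Y t - s t * x t < Y v - s t * x v := by
  obtain ⟨q, hv, ht, h1, -⟩ := h.exists_lca hvt
  exact (h.path_ge (s t) t ht (fun a ha => h.s_le (OnPath.z_le ha))).trans_lt
    (h.path_lt (s t) v hv (fun a ha => h.s_lt_of ((h1 a ha).trans (h.lt t))))

theorem right_below_aux (h : ContourCoords G r par o z x s Y) {v t : V} (hvt : z t < o v) :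
    ∃ q a, Anc o z q v ∧ Anc o z q t ∧ OnPath o z q t a ∧ (∀ b, OnPath o z q t b → s a ≤ s b) ∧
      z a < o v ∧ Y v - s a * x v < Y q - s a * x q := by
  obtain ⟨q, ht, hv, h1, -⟩ := h.exists_lca hvt
  obtain ⟨a, ha, hmin⟩ := h.exists_top ht
  refine ⟨q, a, hv, ht, ha, hmin, h1 a ha, h.path_gt _ v hv (fun b hb => h.s_lt_of ?_)⟩
  linarith [h1 a ha, h.lt v, OnPath.z_le hb]

theorem right_below (h : ContourCoords G r par o z x s Y) {v t : V} (hvt : z t < o v)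
    (hx : x t < x v) {m : ℝ} (hm : s t ≤ m) : Y v - m * x v < Y t - m * x t := by
  obtain ⟨q, a, hv, ht, ha, hmin, -, h2⟩ := h.right_below_aux hvt
  have h3 := h.path_le (s a) t ht hmin
  have h4 := hmin t ⟨Or.inl rfl, ht⟩
  nlinarith [mul_nonneg (sub_nonneg.2 (h4.trans hm)) (sub_nonneg.2 hx.le)]

end ContourCoords

/-- `v` lies above the points `a` and `b` with respect to some slope, strictly so for one. -/
def AboveBoth {V : Type} (x Y : V → ℝ) (v a b : V) : Prop :=
  ∃ m : ℝ, Y a - m * x a ≤ Y v - m * x v ∧ Y b - m * x b ≤ Y v - m * x v ∧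
    (Y a - m * x a < Y v - m * x v ∨ Y b - m * x b < Y v - m * x v)

/-- `p` lies strictly between `a` and `b`. -/
def StrictBetween (p a b : ℝ) : Prop := (a < p ∧ p < b) ∨ (b < p ∧ p < a)

theorem AboveBoth.lt {V : Type} {x Y : V → ℝ} {v a b : V} (h : AboveBoth x Y v a b)
    (hx : StrictBetween (x v) (x a) (x b)) {α β : ℝ} (ha : Y a = α * x a + β)
    (hb : Y b = α * x b + β) : α * x v + β < Y v := by
  obtain ⟨m, h1, h2, h3⟩ := h
  rw [ha] at h1 h3
  rw [hb] at h2 h3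
  have : 0 ≤ m - α ∨ 0 ≤ α - m := by
    rcases le_total m α with h | h
    · right; linarith
    · left; linarith
  rcases hx with ⟨h4, h5⟩ | ⟨h4, h5⟩
  all_goals
    rcases h3 with h3 | h3 <;> by_contra! h6
    · obtain ⟨t, ht, ht1, hx⟩ : ∃ t : ℝ, 0 < t ∧ t < 1 ∧ x v = t * x a + (1 - t) * x b := by
        refine ⟨(x v - x b) / (x a - x b), ?_, ?_, ?_⟩
        · first
            | exact div_pos (by linarith) (by linarith)
            | exact div_pos_of_neg_of_neg (by linarith) (by linarith)
        · first
            | rw [div_lt_one (by linarith)]; linarith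
            | rw [div_lt_one_of_neg (by linarith)]; linarith
        · have : x a - x b ≠ 0 := by intro h; linarith
          field_simp
          ring
      nlinarith [mul_lt_mul_of_pos_left h3 ht,
        mul_le_mul_of_nonneg_left h2 (sub_nonneg.2 ht1.le)]
    · obtain ⟨t, ht, ht1, hx⟩ : ∃ t : ℝ, 0 < t ∧ t < 1 ∧ x v = t * x a + (1 - t) * x b := by
        refine ⟨(x v - x b) / (x a - x b), ?_, ?_, ?_⟩
        · first
            | exact div_pos (by linarith) (by linarith)
            | exact div_pos_of_neg_of_neg (by linarith) (by linarith)
        · first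
            | rw [div_lt_one (by linarith)]; linarith
            | rw [div_lt_one_of_neg (by linarith)]; linarith
        · have : x a - x b ≠ 0 := by intro h; linarith
          field_simp
          ring
      nlinarith [mul_le_mul_of_nonneg_left h1 ht.le,
        mul_lt_mul_of_pos_left h3 (sub_pos.2 ht1)]

theorem StrictBetween.not_lt_lt {p a b : ℝ} (h : StrictBetween p a b) (h1 : p < a) (h2 : p < b) :
    False := by
  rcases h with h | h <;> linarith [h.1, h.2]

theorem StrictBetween.not_gt_gt {p a b : ℝ} (h : StrictBetween p a b) (h1 : a < p) (h2 : b < p) :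
    False := by
  rcases h with h | h <;> linarith [h.1, h.2]

/-- `v` lies below the points `a` and `b` with respect to some slope, strictly so for one. -/
def BelowBoth {V : Type} (x Y : V → ℝ) (v a b : V) : Prop :=
  ∃ m : ℝ, Y v - m * x v ≤ Y a - m * x a ∧ Y v - m * x v ≤ Y b - m * x b ∧
    (Y v - m * x v < Y a - m * x a ∨ Y v - m * x v < Y b - m * x b)

theorem BelowBoth.lt {V : Type} {x Y : V → ℝ} {v a b : V} (h : BelowBoth x Y v a b)
    (hx : StrictBetween (x v) (x a) (x b)) {α β : ℝ} (ha : Y a = α * x a + β)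
    (hb : Y b = α * x b + β) : Y v < α * x v + β := by
  obtain ⟨m, h1, h2, h3⟩ := h
  have : AboveBoth x (fun u => - Y u) v a b :=
    ⟨-m, by linarith, by linarith, by rcases h3 with h3 | h3; left; linarith; right; linarith⟩
  have := this.lt hx (α := -α) (β := -β) (by linarith) (by linarith)
  linarith

namespace ContourCoords

variable {V : Type} [Finite V] {G : SimpleGraph V} {r : V} {par : V → V} {o z x s Y : V → ℝ}

theorem above_tree (h : ContourCoords G r par o z x s Y) {v k : V} (hk : k ≠ r)
    (hvk : z v < z k) (hx : StrictBetween (x v) (x (par k)) (x k)) :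
    AboveBoth x Y v k (par k) := by
  have hne : v ≠ k := by rintro rfl; linarith
  have := h.x_par hk
  rcases h.laminar v k hne with h1 | h1 | h1 | h1
  · have h2 := h.left_above h1
    have h3 := h.Y_eq k hk
    refine ⟨s k, h2.le, ?_, Or.inl h2⟩
    have : Y (par k) - s k * x (par k) = Y k - s k * x k := by rw [h3]; ring
    rw [this]; exact h2.le
  · linarith [h.lt v]
  · linarith
  · exact (hx.not_gt_gt ((h.x_par hk).trans (h.x_anc h1)) (h.x_anc h1)).elim

theorem below_tree (h : ContourCoords G r par o z x s Y) {v k : V} (hk : k ≠ r)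
    (hvk : z k < z v) (hvp : v ≠ par k) (hx : StrictBetween (x v) (x (par k)) (x k)) :
    BelowBoth x Y v k (par k) := by
  have hne : v ≠ k := by rintro rfl; linarith
  have hxp := h.x_par hk
  rcases h.laminar v k hne with h1 | h1 | h1 | h1
  · linarith [h.lt k]
  · obtain ⟨q, a, hv, ht, ha, hmin, -, h2⟩ := h.right_below_aux h1
    have h3 := h.path_le (s a) k ht hmin
    refine ⟨s a, (h2.trans_le h3).le, ?_, Or.inl (h2.trans_le h3)⟩
    rcases h.least k q hk ht.1 ht.2 with h4 | h4
    · rw [← h4]; exact h2.le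
    · exact (h2.trans_le (h.path_le (s a) _ h4 (fun b hb => hmin b (h.onPath_par ht hb)))).le
  · have h2 : x v < x (par k) := by
      rcases h.least k v hk h1.1 h1.2 with h4 | h4
      · exact absurd h4 hvp
      · exact h.x_anc h4
    exact (hx.not_lt_lt h2 (h2.trans hxp)).elim
  · linarith

theorem above_chord (h : ContourCoords G r par o z x s Y) {v i j : V} (hij : G.Adj i j)
    (h_ij : z i < o j) (hvi : z v < z i) (hx : StrictBetween (x v) (x i) (x j)) :
    AboveBoth x Y v i j := by
  have hne : v ≠ i := by rintro rfl; linarith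
  have hlj := h.lt j
  have hli := h.lt i
  rcases h.laminar v i hne with h1 | h1 | h1 | h1
  · obtain ⟨q, hv, hi, h2, -⟩ := h.exists_lca h1
    obtain ⟨a, ha, hmin⟩ := h.exists_top hv
    have h3 := h.path_le (s a) v hv hmin
    have h4 := h2 a ha
    have h5 := h.path_gt (s a) i hi (fun b hb => h.s_lt_of (by linarith [OnPath.z_le hb]))
    refine ⟨s a, h5.le.trans h3, ?_, Or.inl (h5.trans_le h3)⟩
    have hqj : q ≠ j := by rintro rfl; linarith [hi.1]
    rcases h.laminar q j hqj with h6 | h6 | h6 | h6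
    · have h7 := h.x_lt q j (Or.inr (Or.inr ⟨i, hij, hi.2, h6⟩))
      have h8 := h.right_below h6 h7 (h.s_lt_of ha.2.2).le
      exact h8.le.trans h3
    · linarith [hi.1]
    · exact ((h.path_gt (s a) j h6
        (fun b hb => h.s_lt_of (by linarith [OnPath.z_le hb]))).trans_le h3).le
    · linarith [hi.1, hi.2]
  · linarith [h.lt v]
  · linarith
  · obtain ⟨a, ha, hmin⟩ := h.exists_top h1
    have h3 := h.path_le (s a) v h1 hmin
    have h4 := h.x_anc h1
    have h5 : x i < x j := by
      by_contra! h5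
      exact hx.not_gt_gt h4 (h5.trans_lt h4)
    have h6 := h.right_below h_ij h5 (h.s_lt_of ha.2.2).le
    exact ⟨s a, h3, (h6.trans_le h3).le, Or.inr (h6.trans_le h3)⟩

theorem below_chord (h : ContourCoords G r par o z x s Y) {v i j : V} (hij : G.Adj i j)
    (h_ij : z i < o j) (hvi : z i < z v) (hvj : v ≠ j) (hx : StrictBetween (x v) (x i) (x j)) :
    BelowBoth x Y v i j := by
  have hne : v ≠ i := by rintro rfl; linarith
  have hlj := h.lt j
  have hli := h.lt i
  have hlv := h.lt v
  rcases h.laminar v i hne with h1 | h1 | h1 | h1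
  · linarith
  · have h2 := h.left_above h1
    rcases h.laminar v j hvj with h3 | h3 | h3 | h3
    · exact (hx.not_lt_lt (h.x_lt v i (Or.inr (Or.inl ⟨j, hij, h1, h3⟩)))
        (h.x_lt v j (Or.inr (Or.inr ⟨i, hij, hvi, h3⟩)))).elim
    · exact ⟨s v, h2.le, (h.left_above h3).le, Or.inl h2⟩
    · exact ⟨s v, h2.le, (h.path_lt (s v) j h3 (fun b hb => h.s_lt_of hb.2.2)).le, Or.inl h2⟩
    · exact ⟨s v, h2.le, h.path_ge (s v) v h3 (fun b hb => h.s_le (OnPath.z_le hb)), Or.inl h2⟩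
  · have h2 := h.x_anc h1
    rcases h.laminar v j hvj with h3 | h3 | h3 | h3
    · exact (hx.not_lt_lt h2 (h.x_lt v j (Or.inr (Or.inr ⟨i, hij, hvi, h3⟩)))).elim
    · linarith
    · exact (hx.not_lt_lt h2 (h.x_anc h3)).elim
    · linarith
  · linarith

theorem above (h : ContourCoords G r par o z x s Y) {v a b : V} (hab : G.Adj a b)
    (hz : z a < z b) (hva : z v < z a) (hx : StrictBetween (x v) (x a) (x b)) :
    AboveBoth x Y v a b := by
  rcases h.edge a b hab with ⟨h1, rfl⟩ | ⟨h1, rfl⟩ | h1 | h1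
  · exact h.above_tree h1 hva hx.symm
  · linarith [h.par_z b h1]
  · exact h.above_chord hab h1 hva hx
  · linarith [h.lt a]

theorem below (h : ContourCoords G r par o z x s Y) {v a b : V} (hab : G.Adj a b)
    (hz : z a < z b) (hva : z a < z v) (hvb : v ≠ b) (hx : StrictBetween (x v) (x a) (x b)) :
    BelowBoth x Y v a b := by
  rcases h.edge a b hab with ⟨h1, rfl⟩ | ⟨h1, rfl⟩ | h1 | h1
  · exact h.below_tree h1 hva hvb hx.symm
  · linarith [h.par_z b h1]
  · exact h.below_chord hab h1 hva hvb hx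
  · linarith [h.lt a]

theorem not_between (h : ContourCoords G r par o z x s Y) {a b a' b' : V} (hab : G.Adj a b)
    (hab' : G.Adj a' b') (hz : z a < z b) (hz' : z a' < z b') (h1 : z a < z a') (h2 : z a' < z b)
    (hb : b ≠ b') (hx : StrictBetween (x b) (x a') (x b')) : False := by
  have hla := h.lt a
  have hlb := h.lt b
  have hla' := h.lt a'
  have hlb' := h.lt b'
  have hne : a' ≠ b := by rintro rfl; linarith
  -- the relative position of `b'` once `b` is known to be an ancestor of `a'`
  have key : Anc o z b a' → False := by
    intro hba
    refine hx.not_lt_lt (h.x_anc hba) ?_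
    rcases h.edge a' b' hab' with ⟨h3, rfl⟩ | ⟨h3, rfl⟩ | h3 | h3
    · rcases h.least a' b h3 hba.1 hba.2 with h4 | h4
      · exact absurd h4 hb
      · exact h.x_anc h4
    · linarith [h.par_z b' h3]
    · rcases h.laminar b b' hb with h4 | h4 | h4 | h4
      · exact h.x_lt b b' (Or.inr (Or.inr ⟨a', hab', hba.2, h4⟩))
      · linarith [hba.1]
      · exact h.x_anc h4
      · linarith [hba.1]
    · linarith
  rcases h.edge a b hab with ⟨h3, rfl⟩ | ⟨h3, rfl⟩ | h3 | h3
  · have hp := h.par_o a h3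
    have hne' : a ≠ a' := by rintro rfl; linarith
    apply key
    rcases h.laminar a a' hne' with h4 | h4 | h4 | h4
    · exact ⟨by linarith, h2⟩
    · linarith
    · linarith
    · rcases h.least a a' h3 h4.1 h4.2 with h5 | h5
      · exact absurd h5 hne
      · linarith [h5.2]
  · linarith [h.par_z b h3]
  · rcases h.laminar a' b hne with h4 | h4 | h4 | h4
    · have h5 := h.x_lt a' b (Or.inr (Or.inr ⟨a, hab, h1, h4⟩))
      refine hx.not_gt_gt h5 ?_
      rcases h.edge a' b' hab' with ⟨h6, rfl⟩ | ⟨h6, rfl⟩ | h6 | h6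
      · exact (h.x_par h6).trans h5
      · linarith [h.par_z b' h6]
      · rcases h.laminar b b' hb with h7 | h7 | h7 | h7
        · exact (h.nc a b a' b' hab hab' h1 h4 (by linarith)).elim
        · exact h.x_lt b' b (Or.inr (Or.inr ⟨a, hab, by linarith, h7⟩))
        · exact (h.nc a b a' b' hab hab' h1 h4 h7.1).elim
        · exact h.x_anc h7
      · linarith
    · linarith
    · linarith [h4.2]
    · exact key h4
  · linarith

end ContourCoords

theorem exists_line {x₁ y₁ x₂ y₂ : ℝ} (h : x₁ ≠ x₂) :
    ∃ α β : ℝ, y₁ = α * x₁ + β ∧ y₂ = α * x₂ + β := by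
  have : x₂ - x₁ ≠ 0 := sub_ne_zero.2 h.symm
  refine ⟨(y₂ - y₁) / (x₂ - x₁), y₁ - (y₂ - y₁) / (x₂ - x₁) * x₁, by ring, ?_⟩
  field_simp
  ring

theorem mem_segment_line {p q₁ q₂ : ℝ × ℝ} (hp : p ∈ segment ℝ q₁ q₂) {α β : ℝ}
    (h₁ : q₁.2 = α * q₁.1 + β) (h₂ : q₂.2 = α * q₂.1 + β) :
    p.2 = α * p.1 + β ∧ ((q₁.1 ≤ p.1 ∧ p.1 ≤ q₂.1) ∨ (q₂.1 ≤ p.1 ∧ p.1 ≤ q₁.1)) := by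
  obtain ⟨s, t, hs, ht, hst, rfl⟩ := hp
  have hs' : s = 1 - t := by linarith
  subst hs'
  simp only [Prod.snd_add, Prod.smul_snd, smul_eq_mul, Prod.fst_add, Prod.smul_fst]
  refine ⟨by rw [h₁, h₂]; ring, ?_⟩
  rcases le_total q₁.1 q₂.1 with h | h
  · left; constructor <;> nlinarith
  · right; constructor <;> nlinarith

theorem mem_openSegment_line {p q₁ q₂ : ℝ × ℝ} (hp : p ∈ openSegment ℝ q₁ q₂)
    (hne : q₁.1 ≠ q₂.1) : StrictBetween p.1 q₁.1 q₂.1 := by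
  obtain ⟨s, t, hs, ht, hst, rfl⟩ := hp
  have hs' : s = 1 - t := by linarith
  subst hs'
  simp only [Prod.smul_fst, smul_eq_mul, Prod.fst_add]
  rcases hne.lt_or_gt with h | h
  · left; constructor <;> nlinarith
  · right; constructor <;> nlinarith

theorem line_lt_line {α β γ δ x₀ x₁ w₀ w₁ X : ℝ} (h₀ : x₀ ≤ X) (h₁ : X ≤ x₁) (k₀ : w₀ ≤ X)
    (k₁ : X ≤ w₁) (hne₀ : x₀ ≠ w₀) (hne₁ : x₁ ≠ w₁)
    (a₀ : x₀ < w₀ → γ * w₀ + δ < α * w₀ + β) (b₀ : w₀ < x₀ → γ * x₀ + δ < α * x₀ + β)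
    (a₁ : w₁ < x₁ → γ * w₁ + δ < α * w₁ + β) (b₁ : x₁ < w₁ → γ * x₁ + δ < α * x₁ + β) :
    γ * X + δ < α * X + β := by
  have key : ∀ l u : ℝ, l ≤ X → X ≤ u → γ * l + δ < α * l + β → γ * u + δ < α * u + β →
      γ * X + δ < α * X + β := by
    intro l u hl hu h1 h2
    rcases le_total γ α with h | h <;> nlinarith
  rcases hne₀.lt_or_gt with h | h <;> rcases hne₁.lt_or_gt with k | k
  · exact key _ _ k₀ h₁ (a₀ h) (b₁ k)
  · exact key _ _ k₀ k₁ (a₀ h) (a₁ k)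
  · exact key _ _ h₀ h₁ (b₀ h) (b₁ k)
  · exact key _ _ h₀ k₁ (b₀ h) (a₁ k)

namespace ContourCoords

variable {V : Type} [Finite V] {G : SimpleGraph V} {r : V} {par : V → V} {o z x s Y : V → ℝ}

theorem z_inj (h : ContourCoords G r par o z x s Y) {v w : V} (hne : v ≠ w) : z v ≠ z w := by
  have := h.lt v
  have := h.lt w
  rcases h.laminar v w hne with h2 | h2 | h2 | h2 <;> intro <;> linarith

theorem not_on_edge (h : ContourCoords G r par o z x s Y) {v a b : V} (hab : G.Adj a b)
    (hva : v ≠ a) (hvb : v ≠ b) (hx : StrictBetween (x v) (x a) (x b)) {α β : ℝ}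
    (ha : Y a = α * x a + β) (hb : Y b = α * x b + β) : Y v ≠ α * x v + β := by
  have key : ∀ a b, G.Adj a b → v ≠ a → v ≠ b → StrictBetween (x v) (x a) (x b) →
      Y a = α * x a + β → Y b = α * x b + β → z a < z b → Y v ≠ α * x v + β := by
    intro a b hab hva hvb hx ha hb hz
    rcases (h.z_inj hva).lt_or_gt with h1 | h1
    · exact ((h.above hab hz h1 hx).lt hx ha hb).ne'
    · exact ((h.below hab hz h1 hvb hx).lt hx ha hb).ne
  rcases (h.z_inj hab.ne).lt_or_gt with h1 | h1
  · exact key a b hab hva hvb hx ha hb h1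
  · exact key b a hab.symm hvb hva hx.symm hb ha h1

theorem disjoint_edges (h : ContourCoords G r par o z x s Y) {a b a' b' : V} (hab : G.Adj a b)
    (hab' : G.Adj a' b') (haa : a ≠ a') (hab_ : a ≠ b') (hba : b ≠ a') (hbb : b ≠ b')
    (hz : z a < z b) (hz' : z a' < z b') (h1 : z a < z a') {p : ℝ × ℝ}
    (hp : p ∈ segment ℝ (x a, Y a) (x b, Y b)) (hp' : p ∈ segment ℝ (x a', Y a') (x b', Y b')) :
    False := by
  obtain ⟨α, β, ha, hb⟩ := exists_line (y₁ := Y a) (y₂ := Y b) (h.x_inj.ne hab.ne)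
  obtain ⟨γ, δ, ha', hb'⟩ := exists_line (y₁ := Y a') (y₂ := Y b') (h.x_inj.ne hab'.ne)
  obtain ⟨hp1, hp2⟩ := mem_segment_line hp ha hb
  obtain ⟨hp1', hp2'⟩ := mem_segment_line hp' ha' hb'
  simp only at hp1 hp2 hp1' hp2'
  have ea' : StrictBetween (x a') (x a) (x b) → γ * x a' + δ < α * x a' + β := fun hx => by
    have := (h.below hab hz h1 hba.symm hx).lt hx ha hb
    linarith
  have eb' : StrictBetween (x b') (x a) (x b) → γ * x b' + δ < α * x b' + β := fun hx => by
    have := (h.below hab hz (h1.trans hz') hbb.symm hx).lt hx ha hb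
    linarith
  have ea : StrictBetween (x a) (x a') (x b') → γ * x a + δ < α * x a + β := fun hx => by
    have := (h.above hab' hz' h1 hx).lt hx ha' hb'
    linarith
  have eb : StrictBetween (x b) (x a') (x b') → γ * x b + δ < α * x b + β := fun hx => by
    rcases (h.z_inj hba).lt_or_gt with h2 | h2
    · have := (h.above hab' hz' h2 hx).lt hx ha' hb'
      linarith
    · exact (h.not_between hab hab' hz hz' h1 h2 hbb hx).elim
  have n1 := h.x_inj.ne haa
  have n2 := h.x_inj.ne hab_
  have n3 := h.x_inj.ne hba
  have n4 := h.x_inj.ne hbb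
  have fin : γ * p.1 + δ < α * p.1 + β → False := fun hlt => by linarith
  rcases hp2 with ⟨l1, l2⟩ | ⟨l1, l2⟩ <;> rcases hp2' with ⟨l3, l4⟩ | ⟨l3, l4⟩
  · refine fin (line_lt_line l1 l2 l3 l4 n1 n4 ?_ ?_ ?_ ?_) <;> intro hlt
    · exact ea' (Or.inl ⟨hlt, lt_of_le_of_ne (l3.trans l2) n3.symm⟩)
    · exact ea (Or.inl ⟨hlt, lt_of_le_of_ne (l1.trans l4) n2⟩)
    · exact eb' (Or.inl ⟨lt_of_le_of_ne (l1.trans l4) n2, hlt⟩)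
    · exact eb (Or.inl ⟨lt_of_le_of_ne (l3.trans l2) n3.symm, hlt⟩)
  · refine fin (line_lt_line l1 l2 l3 l4 n2 n3 ?_ ?_ ?_ ?_) <;> intro hlt
    · exact eb' (Or.inl ⟨hlt, lt_of_le_of_ne (l3.trans l2) n4.symm⟩)
    · exact ea (Or.inr ⟨hlt, lt_of_le_of_ne (l1.trans l4) n1⟩)
    · exact ea' (Or.inl ⟨lt_of_le_of_ne (l1.trans l4) n1, hlt⟩)
    · exact eb (Or.inr ⟨lt_of_le_of_ne (l3.trans l2) n4.symm, hlt⟩)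
  · refine fin (line_lt_line l1 l2 l3 l4 n3 n2 ?_ ?_ ?_ ?_) <;> intro hlt
    · exact ea' (Or.inr ⟨hlt, lt_of_le_of_ne (l3.trans l2) n1.symm⟩)
    · exact eb (Or.inl ⟨hlt, lt_of_le_of_ne (l1.trans l4) n4⟩)
    · exact eb' (Or.inr ⟨lt_of_le_of_ne (l1.trans l4) n4, hlt⟩)
    · exact ea (Or.inl ⟨lt_of_le_of_ne (l3.trans l2) n1.symm, hlt⟩)
  · refine fin (line_lt_line l1 l2 l3 l4 n4 n1 ?_ ?_ ?_ ?_) <;> intro hlt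
    · exact eb' (Or.inr ⟨hlt, lt_of_le_of_ne (l3.trans l2) n2.symm⟩)
    · exact eb (Or.inr ⟨hlt, lt_of_le_of_ne (l1.trans l4) n3⟩)
    · exact ea' (Or.inr ⟨lt_of_le_of_ne (l1.trans l4) n3, hlt⟩)
    · exact ea (Or.inr ⟨lt_of_le_of_ne (l3.trans l2) n2.symm, hlt⟩)

theorem edges_sharing (h : ContourCoords G r par o z x s Y) {a b d : V} (hab : G.Adj a b)
    (had : G.Adj a d) (hbd : b ≠ d) {p : ℝ × ℝ}
    (hp : p ∈ segment ℝ (x a, Y a) (x b, Y b)) (hp' : p ∈ segment ℝ (x a, Y a) (x d, Y d)) :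
    p = (x a, Y a) := by
  obtain ⟨α, β, ha, hb⟩ := exists_line (y₁ := Y a) (y₂ := Y b) (h.x_inj.ne hab.ne)
  obtain ⟨γ, δ, ha', hd'⟩ := exists_line (y₁ := Y a) (y₂ := Y d) (h.x_inj.ne had.ne)
  obtain ⟨hp1, hp2⟩ := mem_segment_line hp ha hb
  obtain ⟨hp1', hp2'⟩ := mem_segment_line hp' ha' hd'
  simp only at hp1 hp2 hp1' hp2'
  by_cases hpa : p.1 = x a
  · ext
    · exact hpa
    · simp [hp1, hpa, ha]
  exfalso
  have h1 : (α - γ) * (p.1 - x a) = 0 := by linarith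
  have h2 : α = γ := by
    rcases mul_eq_zero.1 h1 with h | h
    · linarith
    · exact absurd (by linarith) hpa
  subst h2
  have h3 : δ = β := by linarith
  subst h3
  have n1 := h.x_inj.ne hbd
  have n2 := h.x_inj.ne hab.ne
  have n3 := h.x_inj.ne had.ne
  rcases n1.lt_or_gt with h4 | h4
  · rcases n2.lt_or_gt with h5 | h5
    · exact h.not_on_edge had hab.ne' hbd (Or.inl ⟨h5, h4⟩) ha hd' hb
    · refine h.not_on_edge hab had.ne' hbd.symm (Or.inr ⟨h4, ?_⟩) ha hb hd'
      rcases hp2 with h6 | h6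
      · linarith [h6.1, h6.2]
      · rcases hp2' with h7 | h7
        · exact absurd (le_antisymm h6.2 h7.1) hpa
        · exact lt_of_le_of_ne (h7.1.trans h7.2) n3.symm
  · rcases n2.lt_or_gt with h5 | h5
    · refine h.not_on_edge hab had.ne' hbd.symm (Or.inl ⟨?_, h4⟩) ha hb hd'
      rcases hp2 with h6 | h6
      · rcases hp2' with h7 | h7
        · exact lt_of_le_of_ne (h7.1.trans h7.2) n3
        · exact absurd (le_antisymm h7.2 h6.1) hpa
      · linarith [h6.1, h6.2]
    · exact h.not_on_edge had hab.ne' hbd (Or.inr ⟨h4, h5⟩) ha hd' hb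

theorem isPlanarDrawing (h : ContourCoords G r par o z x s Y) :
    IsPlanarDrawing G (fun v => (x v, Y v)) := by
  refine ⟨fun v w hvw => h.x_inj (Prod.mk.inj hvw).1, ?_, ?_⟩
  · intro a b c d hab hcd hne p hp hp'
    by_cases hac : a = c
    · subst hac
      have : b ≠ d := by rintro rfl; exact hne rfl
      exact ⟨a, Or.inl rfl, Or.inl rfl, h.edges_sharing hab hcd this hp hp'⟩
    by_cases had : a = d
    · subst had
      have : b ≠ c := by rintro rfl; exact hne Sym2.eq_swap
      rw [segment_symm] at hp'
      exact ⟨a, Or.inl rfl, Or.inr rfl, h.edges_sharing hab hcd.symm this hp hp'⟩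
    by_cases hbc : b = c
    · subst hbc
      have : a ≠ d := by rintro rfl; exact hne Sym2.eq_swap
      rw [segment_symm] at hp
      exact ⟨b, Or.inr rfl, Or.inl rfl, h.edges_sharing hab.symm hcd this hp hp'⟩
    by_cases hbd : b = d
    · subst hbd
      have : a ≠ c := hac
      rw [segment_symm] at hp hp'
      exact ⟨b, Or.inr rfl, Or.inr rfl, h.edges_sharing hab.symm hcd.symm this hp hp'⟩
    exfalso
    have key : ∀ a b c d, G.Adj a b → G.Adj c d → a ≠ c → a ≠ d → b ≠ c → b ≠ d → z a < z b →
        z c < z d → p ∈ segment ℝ (x a, Y a) (x b, Y b) → p ∈ segment ℝ (x c, Y c) (x d, Y d) →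
        False := by
      intro a b c d hab hcd hac had hbc hbd hz hz' hp hp'
      rcases (h.z_inj hac).lt_or_gt with h1 | h1
      · exact h.disjoint_edges hab hcd hac had hbc hbd hz hz' h1 hp hp'
      · exact h.disjoint_edges hcd hab hac.symm hbc.symm had.symm hbd.symm hz' hz h1 hp' hp
    have hps := hp
    have hps' := hp'
    rw [segment_symm] at hps hps'
    rcases (h.z_inj hab.ne).lt_or_gt with h1 | h1 <;>
      rcases (h.z_inj hcd.ne).lt_or_gt with h2 | h2
    · exact key a b c d hab hcd hac had hbc hbd h1 h2 hp hp'
    · exact key a b d c hab hcd.symm had hac hbd hbc h1 h2 hp hps'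
    · exact key b a c d hab.symm hcd hbc hbd hac had h1 h2 hps hp'
    · exact key b a d c hab.symm hcd.symm hbd hbc had hac h1 h2 hps hps'
  · intro a b c hab hca hcb hc
    obtain ⟨α, β, ha, hb⟩ := exists_line (y₁ := Y a) (y₂ := Y b) (h.x_inj.ne hab.ne)
    exact h.not_on_edge hab hca hcb (mem_openSegment_line hc (h.x_inj.ne hab.ne)) ha hb
      (mem_segment_line (openSegment_subset_segment _ _ _ hc) ha hb).1

end ContourCoords

/-- `y` is a neighbour of `x` further in direction `d`. -/
def StepUp {V : Type} (G : SimpleGraph V) (f : V → ℝ × ℝ) (d : ℝ × ℝ) (x y : V) : Prop :=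
  G.Adj x y ∧ 0 < dot (f y - f x) d

theorem exists_monotone_walk {V : Type} {G : SimpleGraph V} {f : V → ℝ × ℝ} {d : ℝ × ℝ}
    (hd : d ≠ 0) {a b : V} (h : Relation.ReflTransGen (StepUp G f d) a b) :
    ∃ w : G.Walk a b, w.IsPath ∧ MonotoneWalk f w := by
  have : ∃ w : G.Walk a b, w.support.IsChain (fun x y => 0 < dot (f y - f x) d) := by
    induction h using Relation.ReflTransGen.head_induction_on with
    | refl => exact ⟨.nil, by simp⟩
    | head h1 _ ih =>
      obtain ⟨w, hw⟩ := ih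
      refine ⟨.cons h1.1 w, ?_⟩
      rw [SimpleGraph.Walk.support_cons, ← SimpleGraph.Walk.cons_tail_support, List.isChain_cons_cons]
      rw [← SimpleGraph.Walk.cons_tail_support] at hw
      exact ⟨h1.2, hw⟩
  obtain ⟨w, hw⟩ := this
  refine ⟨w, ?_, d, hd, hw⟩
  have hp : w.support.Pairwise (fun x y => 0 < dot (f y - f x) d) := by
    have : IsTrans V (fun x y => 0 < dot (f y - f x) d) := ⟨fun u v w h1 h2 => by
      simp only [dot, Prod.fst_sub, Prod.snd_sub] at *
      linarith⟩
    exact List.isChain_iff_pairwise.1 hw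
  rw [SimpleGraph.Walk.isPath_def]
  refine hp.imp (fun {u v} huv => ?_)
  rintro rfl
  simp [dot] at huv

namespace ContourCoords

variable {V : Type} [Finite V] {G : SimpleGraph V} {r : V} {par : V → V} {o z x s Y : V → ℝ}

theorem walk_up (h : ContourCoords G r par o z x s Y) {q : V} {d : ℝ × ℝ} : ∀ u, Anc o z q u →
    (∀ a, OnPath o z q u a → d.1 + d.2 * s a < 0) →
    Relation.ReflTransGen (StepUp G (fun v => (x v, Y v)) d) u q := by
  refine h.path_induction (P := fun u => (∀ a, OnPath o z q u a → d.1 + d.2 * s a < 0) → _)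
    (fun _ => Relation.ReflTransGen.refl) (fun u hu ih hm => ?_)
  refine Relation.ReflTransGen.head ?_ (ih (fun a ha => hm a (h.onPath_par hu ha)))
  have h2 := hm u ⟨Or.inl rfl, hu⟩
  have h3 := h.x_par (h.ne_root hu)
  refine ⟨(h.adj u (h.ne_root hu)).symm, ?_⟩
  simp only [dot, Prod.fst_sub, Prod.snd_sub]
  rw [h.Y_eq u (h.ne_root hu)]
  nlinarith

theorem walk_down (h : ContourCoords G r par o z x s Y) {q : V} {d : ℝ × ℝ} : ∀ u, Anc o z q u →
    (∀ a, OnPath o z q u a → 0 < d.1 + d.2 * s a) →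
    Relation.ReflTransGen (StepUp G (fun v => (x v, Y v)) d) q u := by
  refine h.path_induction (P := fun u => (∀ a, OnPath o z q u a → 0 < d.1 + d.2 * s a) → _)
    (fun _ => Relation.ReflTransGen.refl) (fun u hu ih hm => ?_)
  refine Relation.ReflTransGen.tail (ih (fun a ha => hm a (h.onPath_par hu ha))) ?_
  have h2 := hm u ⟨Or.inl rfl, hu⟩
  have h3 := h.x_par (h.ne_root hu)
  refine ⟨h.adj u (h.ne_root hu), ?_⟩
  simp only [dot, Prod.fst_sub, Prod.snd_sub]
  rw [h.Y_eq u (h.ne_root hu)]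
  nlinarith

theorem isMonotoneDrawing (h : ContourCoords G r par o z x s Y) :
    IsMonotoneDrawing G (fun v => (x v, Y v)) := by
  refine ⟨h.isPlanarDrawing, fun a b hne => ?_⟩
  have key : ∀ a b, z a < o b → ∃ m : ℝ, ∃ q, Anc o z q a ∧ Anc o z q b ∧
      (∀ c, OnPath o z q a c → m < s c) ∧ ∀ c, OnPath o z q b c → s c < m := by
    intro a b hab
    obtain ⟨q, ha, hb, h1, h2⟩ := h.exists_lca hab
    obtain ⟨c, hc, hmin⟩ := h.exists_top ha
    have h3 := h.s_lt_of ((h1 c hc).trans (h.lt b))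
    refine ⟨(s c + s b) / 2, q, ha, hb, fun e he => ?_, fun e he => ?_⟩
    · linarith [hmin e he]
    · linarith [h.s_le (OnPath.z_le he)]
  rcases h.laminar a b hne with h1 | h1 | h1 | h1
  · obtain ⟨m, q, ha, hb, h2, h3⟩ := key a b h1
    refine exists_monotone_walk (d := (m, -1)) (by simp) ((h.walk_up a ha ?_).trans
      (h.walk_down b hb ?_)) <;> intro c hc
    · have := h2 c hc; simp only; linarith
    · have := h3 c hc; simp only; linarith
  · obtain ⟨m, q, hb, ha, h2, h3⟩ := key b a h1
    refine exists_monotone_walk (d := (-m, 1)) (by simp) ((h.walk_up a ha ?_).trans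
      (h.walk_down b hb ?_)) <;> intro c hc
    · have := h3 c hc; simp only; linarith
    · have := h2 c hc; simp only; linarith
  · exact exists_monotone_walk (d := (1, 0)) (by simp) (h.walk_down b h1 (by simp))
  · exact exists_monotone_walk (d := (-1, 0)) (by simp) (h.walk_up a h1 (by simp))

end ContourCoords

theorem RootedContour.exists_monotone_grid_drawing {V : Type} [Fintype V] {G : SimpleGraph V}
    {r : V} {par : V → V} {o z : V → ℝ} (h : RootedContour G r par o z) :
    ∃ g : V → ℤ × ℤ, IsMonotoneDrawing G (gridMap g) ∧ ∀ v,
      0 ≤ (g v).1 ∧ ((g v).1 : ℝ) ≤ Fintype.card V ∧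
      0 ≤ (g v).2 ∧ ((g v).2 : ℝ) ≤ (Fintype.card V : ℝ) ^ 2 := by
  classical
  obtain ⟨X, hinj, hlt, hR⟩ := exists_rank_of_exists_maximal (Precedes G r par o z)
    (fun U hU => h.exists_not_precedes U hU) Finset.univ
  let S : V → ℕ := fun v => (Finset.univ.filter (fun u => z v < z u)).card
  have hSle : ∀ v, S v ≤ Fintype.card V := fun v => Finset.card_le_univ _
  let A : V → Finset V := fun v => Finset.univ.filter (fun a => a ≠ r ∧ o a ≤ o v ∧ z v ≤ z a)
  let Y : V → ℤ := fun v => ∑ a ∈ A v, (S a : ℤ) * ((X a : ℤ) - X (par a))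
  let T : V → ℤ := fun v => ∑ a ∈ A v, ((X a : ℤ) - X (par a))
  have hA : ∀ v, v ≠ r → A v = insert v (A (par v)) := by
    intro v hv
    have h1 := h.par_o v hv
    have h2 := h.par_z v hv
    ext a
    simp only [A, Finset.mem_filter, Finset.mem_univ, true_and, Finset.mem_insert]
    constructor
    · rintro ⟨ha, h3, h4⟩
      by_cases hav : a = v
      · exact Or.inl hav
      · have hlv := h.lt v
        have hla := h.lt a
        rcases h.laminar a v hav with h5 | h5 | h5 | h5
        · linarith
        · linarith
        · rcases h.least v a hv h5.1 h5.2 with h6 | h6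
          · exact Or.inr ⟨ha, by rw [h6], by rw [h6]⟩
          · exact Or.inr ⟨ha, h6.1.le, h6.2.le⟩
        · linarith
    · rintro (rfl | ⟨ha, h3, h4⟩)
      · exact ⟨hv, le_rfl, le_rfl⟩
      · exact ⟨ha, by linarith, by linarith⟩
  have hnA : ∀ v, v ≠ r → v ∉ A (par v) := by
    intro v hv hmem
    have h1 := h.par_o v hv
    simp only [A, Finset.mem_filter] at hmem
    linarith [hmem.2.2.1]
  have hAr : A r = ∅ := by
    refine Finset.filter_eq_empty_iff.2 (fun a _ ha => ?_)
    linarith [(h.root a ha.1).1, ha.2.1]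
  have hY : ∀ v, v ≠ r → Y v = Y (par v) + S v * ((X v : ℤ) - X (par v)) := by
    intro v hv
    simp only [Y]
    rw [hA v hv, Finset.sum_insert (hnA v hv)]
    ring
  have hT : ∀ v, v ≠ r → T v = T (par v) + ((X v : ℤ) - X (par v)) := by
    intro v hv
    simp only [T]
    rw [hA v hv, Finset.sum_insert (hnA v hv)]
    ring
  have hXp : ∀ v, v ≠ r → (0 : ℤ) ≤ (X v : ℤ) - X (par v) := by
    intro v hv
    have := hR (par v) (Finset.mem_univ _) v (Finset.mem_univ _) (Or.inl ⟨hv, rfl⟩)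
    omega
  have hC : ContourCoords G r par o z (fun v => (X v : ℝ)) (fun v => (S v : ℝ))
      (fun v => (Y v : ℝ)) := by
    refine { h with x_inj := ?_, x_lt := ?_, s_lt := ?_, Y_eq := ?_ }
    · intro v w hvw
      exact hinj (by simp) (by simp) (by simpa using hvw)
    · intro k v hkv
      simpa using hR k (Finset.mem_univ _) v (Finset.mem_univ _) hkv
    · intro v w hvw
      simp only [Nat.cast_lt]
      refine Finset.card_lt_card ⟨fun u hu => ?_, fun hsub => ?_⟩
      · simp only [Finset.mem_filter, Finset.mem_univ, true_and] at hu ⊢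
        linarith
      · have := hsub (Finset.mem_filter.2 ⟨Finset.mem_univ w, hvw⟩)
        simp at this
    · intro v hv
      simp only [hY v hv]
      push_cast
      ring
  have hTX : ∀ v, T v ≤ X v := by
    have wf : WellFounded (fun a b => o a < o b) :=
      @Finite.wellFounded_of_trans_of_irrefl V _ (fun a b => o a < o b)
        ⟨fun _ _ _ => lt_trans⟩ ⟨fun _ => lt_irrefl _⟩
    intro v
    induction v using wf.induction with
    | _ v ih =>
      by_cases hv : v = r
      · simp [T, hv, hAr]
      · rw [hT v hv]
        linarith [ih _ (h.par_o v hv)]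
  refine ⟨fun v => (X v, Y v), ?_, fun v => ⟨?_, ?_, ?_, ?_⟩⟩
  · convert hC.isMonotoneDrawing using 2
    simp [gridMap]
  · simp
  · have := hlt v (Finset.mem_univ _)
    simp only [Int.cast_natCast, Nat.cast_le]
    exact this.le
  · refine Finset.sum_nonneg (fun a ha => mul_nonneg (by positivity) (hXp a ?_))
    simp only [A, Finset.mem_filter] at ha
    exact ha.2.1
  · have h1 : Y v ≤ Fintype.card V * T v := by
      simp only [Y, T, Finset.mul_sum]
      refine Finset.sum_le_sum (fun a ha => mul_le_mul_of_nonneg_right (by exact_mod_cast hSle a)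
        (hXp a ?_))
      simp only [A, Finset.mem_filter] at ha
      exact ha.2.1
    have h2 : (T v : ℤ) ≤ Fintype.card V := (hTX v).trans
      (by exact_mod_cast (hlt v (Finset.mem_univ _)).le)
    have h3 : Y v ≤ (Fintype.card V : ℤ) ^ 2 := by nlinarith
    exact_mod_cast h3

open Classical in
/-- An abstract form of planarity for the edges `E` drawn in a disc whose boundary passes through the
vertices of `O` in the order of `o`, where `K v` orders the neighbours of `v`: every mod 2 chain `P`
without boundary in `D` two-colours the corners, and `b v` is the colour before the first neighbour
of `v`. -/
structure PlanarOrder {V : Type} [Fintype V] (D O : Set V) (E : V → V → Prop) (o : V → ℝ)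
    (K : V → V → ℝ) : Prop where
  inj : ∀ v x y, E v x → E v y → K v x = K v y → x = y
  color : ∀ P : V → V → ZMod 2, (∀ v w, P v w = P w v) → (∀ v w, P v w ≠ 0 → E v w) →
    (∀ v ∈ D, ∑ y, P v y = 0) → ∃ b : V → ZMod 2,
      (∀ u ∈ O, b u = ∑ u', if u' ∈ O ∧ o u' < o u then ∑ y, P u' y else 0) ∧
      ∀ v x, E v x → b v + (∑ y, if K v y ≤ K v x then P v y else 0) =
        b x + ∑ y, if K x y < K x v then P x y else 0

/-- `a` is joined to `b` by a path of `E` inside `W`. -/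
def ReachIn {V : Type} (E : V → V → Prop) (W : Set V) (a b : V) : Prop :=
  Relation.ReflTransGen (fun x y => E x y ∧ x ∈ W ∧ y ∈ W) a b

theorem ReachIn.mono {V : Type} {E E' : V → V → Prop} {W W' : Set V} {a b : V}
    (h : ReachIn E W a b) (hE : ∀ x y, E x y → x ∈ W → y ∈ W → E' x y) (hW : W ⊆ W') :
    ReachIn E' W' a b := by
  induction h with
  | refl => exact Relation.ReflTransGen.refl
  | tail _ hxy ih => exact ih.tail ⟨hE _ _ hxy.1 hxy.2.1 hxy.2.2, hW hxy.2.1, hW hxy.2.2⟩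

theorem ReachIn.symm {V : Type} {E : V → V → Prop} (hE : ∀ x y, E x y → E y x) {W : Set V} {a b : V}
    (h : ReachIn E W a b) : ReachIn E W b a := by
  induction h with
  | refl => exact Relation.ReflTransGen.refl
  | tail _ hxy ih =>
    exact Relation.ReflTransGen.head ⟨hE _ _ hxy.1, hxy.2.2, hxy.2.1⟩ ih

section Chains

variable {V : Type} [Fintype V]

open Classical in
theorem ReachIn.exists_chain {E : V → V → Prop} (hE : ∀ x y, E x y → E y x)
    (hirr : ∀ x, ¬ E x x) {W : Set V}
    {a b : V} (h : ReachIn E W a b) : ∃ P : V → V → ZMod 2, (∀ v w, P v w = P w v) ∧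
      (∀ v w, P v w ≠ 0 → E v w ∧ v ∈ W ∧ w ∈ W) ∧
      ∀ v, ∑ y, P v y = (if v = a then 1 else 0) + if v = b then 1 else 0 := by
  induction h with
  | refl =>
    refine ⟨fun _ _ => 0, fun _ _ => rfl, by simp, fun v => ?_⟩
    simp [CharTwo.add_self_eq_zero]
  | @tail c d _ hcd ih =>
    obtain ⟨P, h1, h2, h3⟩ := ih
    have hne : c ≠ d := by rintro rfl; exact hirr _ hcd.1
    refine ⟨fun v w => P v w + ((if v = c ∧ w = d then 1 else 0) + if v = d ∧ w = c then 1 else 0),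
      fun v w => ?_, fun v w hvw => ?_, fun v => ?_⟩
    · beta_reduce
      simp only [h1 v w, and_comm (a := v = c), and_comm (a := v = d)]
      ring
    · by_cases h4 : v = c ∧ w = d
      · rw [h4.1, h4.2]; exact hcd
      · by_cases h5 : v = d ∧ w = c
        · rw [h5.1, h5.2]; exact ⟨hE _ _ hcd.1, hcd.2.2, hcd.2.1⟩
        · simp only [h4, h5, if_false, add_zero] at hvw
          exact h2 v w hvw
    · rw [Finset.sum_add_distrib, h3, Finset.sum_add_distrib]
      have e1 : (∑ w, if v = c ∧ w = d then (1 : ZMod 2) else 0) = if v = c then 1 else 0 := by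
        by_cases hv : v = c <;> simp [hv]
      have e2 : (∑ w, if v = d ∧ w = c then (1 : ZMod 2) else 0) = if v = d then 1 else 0 := by
        by_cases hv : v = d <;> simp [hv]
      rw [e1, e2]
      linear_combination CharTwo.add_self_eq_zero (if v = c then (1 : ZMod 2) else 0)

namespace PlanarOrder

variable {D O : Set V} {E : V → V → Prop} {o : V → ℝ} {K : V → V → ℝ}

theorem restrict (h : PlanarOrder D O E o K) {D' O' : Set V} {E' : V → V → Prop} {o' : V → ℝ}
    (hE : ∀ v w, E' v w → E v w ∧ v ∈ D' ∪ O') (hDO : Disjoint D O)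
    (hO : O' ⊆ O)
    (ho : ∀ u ∈ O', ∀ w ∈ O', o' u < o' w ↔ o u < o w) : PlanarOrder D' O' E' o' K := by
  refine ⟨fun v x y h1 h2 h3 => h.inj v x y (hE _ _ h1).1 (hE _ _ h2).1 h3,
    fun P h1 h2 h3 => ?_⟩
  have h0 : ∀ v, v ∉ D' ∪ O' → ∑ y, P v y = 0 := by
    intro v hv
    refine Finset.sum_eq_zero (fun y _ => ?_)
    by_contra h4
    exact hv (hE _ _ (h2 _ _ h4)).2
  obtain ⟨b, hb1, hb2⟩ := h.color P h1 (fun v w hvw => (hE _ _ (h2 v w hvw)).1) (fun v hv => by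
    by_cases hv' : v ∈ D'
    · exact h3 v hv'
    · exact h0 v (fun h4 => h4.elim hv' (fun h5 => Set.disjoint_left.1 hDO hv (hO h5))))
  refine ⟨b, fun u hu => ?_, fun v x hvx => hb2 v x (hE _ _ hvx).1⟩
  rw [hb1 u (hO hu)]
  refine Finset.sum_congr rfl (fun w _ => ?_)
  by_cases hw : w ∈ O'
  · simp [hw, hO hw, ho w hw u hu]
  · by_cases hw' : w ∈ D'
    · simp [h3 w hw']
    · simp [h0 w (by simp [hw, hw'])]

open Classical in
theorem exists_color (h : PlanarOrder D O E o K) (hDO : Disjoint D O) {W : Set V} {a b : V}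
    (ha : a ∈ O) (hb : b ∈ O) {P : V → V → ZMod 2}
    (h1 : ∀ v w, P v w = P w v) (h2 : ∀ v w, P v w ≠ 0 → E v w ∧ v ∈ W ∧ w ∈ W)
    (h3 : ∀ v, ∑ y, P v y = (if v = a then 1 else 0) + if v = b then 1 else 0) :
    ∃ β : V → ZMod 2, (∀ u ∈ O, β u = (if o a < o u then 1 else 0) + if o b < o u then 1 else 0) ∧
      (∀ v x, E v x → β v + (∑ y, if K v y ≤ K v x then P v y else 0) =
        β x + ∑ y, if K x y < K x v then P x y else 0) ∧
      ∀ v x, E v x → v ∉ W → x ∉ W → β v = β x := by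
  obtain ⟨β, hb1, hb2⟩ := h.color P h1 (fun v w hvw => (h2 v w hvw).1) (fun v hv => by
    have hva : v ≠ a := by rintro rfl; exact Set.disjoint_left.1 hDO hv ha
    have hvb : v ≠ b := by rintro rfl; exact Set.disjoint_left.1 hDO hv hb
    simp [h3, hva, hvb])
  refine ⟨β, fun u hu => ?_, hb2, fun v x hvx hv hx => ?_⟩
  · rw [hb1 u hu]
    have : ∀ u' : V, (if u' ∈ O ∧ o u' < o u then ∑ y, P u' y else 0) =
        (if u' = a then (if o a < o u then 1 else 0) else 0) +
          if u' = b then (if o b < o u then 1 else 0) else 0 := by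
      intro u'
      rw [h3]
      by_cases e1 : u' = a
      · subst e1
        by_cases e2 : u' = b
        · subst e2
          simp only [ha, true_and, if_true]
          split_ifs <;> simp
        · simp [ha, e2]
      · by_cases e2 : u' = b
        · subst e2; simp [hb, e1]
        · simp [e1, e2]
    rw [Finset.sum_congr rfl (fun u' _ => this u'), Finset.sum_add_distrib]
    simp
  · have hz : ∀ v, v ∉ W → ∀ y, P v y = 0 := by
      intro v hv y
      by_contra h4
      exact hv (h2 v y h4).2.1
    have := hb2 v x hvx
    simpa [hz v hv, hz x hx] using this

theorem no_cross (h : PlanarOrder D O E o K) (hE : ∀ x y, E x y → E y x) (hDO : Disjoint D O)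
    (hirr : ∀ x, ¬ E x x) {W W' : Set V} (hW : Disjoint W W') {a a' b b' : V}
    (ha : a ∈ O) (ha' : a' ∈ O) (hb : b ∈ O) (hb' : b' ∈ O) (h1 : o a < o a') (h2 : o a' < o b)
    (h3 : o b < o b') (hab : ReachIn E W a b) (hab' : ReachIn E W' a' b') : False := by
  obtain ⟨P, p1, p2, p3⟩ := hab.exists_chain hE hirr
  obtain ⟨β, q1, -, q3⟩ := h.exists_color hDO ha hb p1 p2 p3
  have : β a' = β b' := by
    clear h3 hb'
    induction hab' with
    | refl => rfl
    | @tail c d _ hcd ih =>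
      rw [ih]
      exact q3 c d hcd.1 (Set.disjoint_right.1 hW hcd.2.1) (Set.disjoint_right.1 hW hcd.2.2)
  rw [q1 a' ha', q1 b' hb'] at this
  simp [h1, h2.le.not_gt, h1.trans (h2.trans h3), h3, CharTwo.add_self_eq_zero] at this

theorem no_double_tripod (h : PlanarOrder D O E o K) (hE : ∀ x y, E x y → E y x)
    (hDO : Disjoint D O) (hirr : ∀ x, ¬ E x x) {A B : Set V} (hA : A ⊆ D) (hB : B ⊆ D)
    (hAB : Disjoint A B) (hAc : ∀ x ∈ A, ∀ y ∈ A, ReachIn E A x y)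
    (hBc : ∀ x ∈ B, ∀ y ∈ B, ReachIn E B x y) {a b c : V} (ha : a ∈ O) (hb : b ∈ O) (hc : c ∈ O)
    (h1 : o a < o b) (h2 : o b < o c) {pa pb pc qa qb qc : V} (hpa : pa ∈ A) (hpb : pb ∈ A)
    (hpc : pc ∈ A) (hqa : qa ∈ B) (hqb : qb ∈ B) (hqc : qc ∈ B) (epa : E a pa) (epb : E b pb)
    (epc : E c pc) (eqa : E a qa) (eqb : E b qb) (eqc : E c qc) : False := by
  classical
  have hOA : ∀ u ∈ O, u ∉ A := fun u hu hu' => Set.disjoint_left.1 hDO (hA hu') hu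
  have hOB : ∀ u ∈ O, u ∉ B := fun u hu hu' => Set.disjoint_left.1 hDO (hB hu') hu
  have key : ∀ e ∈ O, e ≠ b → ∀ pe ∈ A, E e pe → ∃ β : V → ZMod 2,
      (∀ u ∈ O, β u = (if o e < o u then 1 else 0) + if o b < o u then 1 else 0) ∧
      (∀ v x, E v x → v ∉ A ∪ {e, b} → x ∉ A ∪ {e, b} → β v = β x) ∧
      β qb = β b + if K b pb ≤ K b qb then 1 else 0 := by
    intro e he heb pe hpe epe
    have hr : ReachIn E (A ∪ {e}) e pb :=
      Relation.ReflTransGen.head ⟨epe, by simp, Or.inl hpe⟩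
        ((hAc pe hpe pb hpb).mono (fun _ _ h _ _ => h) Set.subset_union_left)
    obtain ⟨P, p1, p2, p3⟩ := hr.exists_chain hE hirr
    have hbP : ∀ y, P b y = 0 := fun y => by
      by_contra h4
      rcases (p2 b y h4).2.1 with h5 | h5
      · exact hOA b hb h5
      · exact heb h5.symm
    have hbpb : b ≠ pb := by rintro rfl; exact hOA _ hb hpb
    let P' : V → V → ZMod 2 := fun v w =>
      P v w + ((if v = pb ∧ w = b then 1 else 0) + if v = b ∧ w = pb then 1 else 0)
    have hqP : ∀ y, P' qb y = 0 := fun y => by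
      have n1 : qb ≠ pb := by rintro rfl; exact Set.disjoint_left.1 hAB hpb hqb
      have n2 : qb ≠ b := by rintro rfl; exact hOB _ hb hqb
      simp only [P', n1, n2, false_and, if_false, add_zero]
      by_contra h4
      rcases (p2 qb y h4).2.1 with h5 | h5
      · exact Set.disjoint_left.1 hAB h5 hqb
      · rw [h5] at hqb
        exact hOB _ he hqb
    obtain ⟨β, r1, r2, r3⟩ := h.exists_color hDO he hb (P := P') (W := A ∪ {e, b})
      (fun v w => by
        simp only [P']
        simp only [p1 v w, and_comm (a := v = pb), and_comm (a := v = b)]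
        ring)
      (fun v w hvw => by
        by_cases h4 : v = pb ∧ w = b
        · rw [h4.1, h4.2]; exact ⟨hE _ _ epb, Or.inl hpb, by simp⟩
        · by_cases h5 : v = b ∧ w = pb
          · rw [h5.1, h5.2]; exact ⟨epb, by simp, Or.inl hpb⟩
          · simp only [P', h4, h5, if_false, add_zero] at hvw
            obtain ⟨s1, s2, s3⟩ := p2 v w hvw
            refine ⟨s1, ?_, ?_⟩
            · rcases s2 with s2 | s2
              · exact Or.inl s2
              · exact Or.inr (Or.inl s2)
            · rcases s3 with s3 | s3
              · exact Or.inl s3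
              · exact Or.inr (Or.inl s3))
      (fun v => by
        simp only [P']
        rw [Finset.sum_add_distrib, p3, Finset.sum_add_distrib]
        have e1 : (∑ w, if v = pb ∧ w = b then (1 : ZMod 2) else 0) = if v = pb then 1 else 0 := by
          by_cases hv : v = pb <;> simp [hv]
        have e2 : (∑ w, if v = b ∧ w = pb then (1 : ZMod 2) else 0) = if v = b then 1 else 0 := by
          by_cases hv : v = b <;> simp [hv]
        rw [e1, e2]
        linear_combination CharTwo.add_self_eq_zero (if v = pb then (1 : ZMod 2) else 0))
    refine ⟨β, r1, r3, ?_⟩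
    have := r2 b qb eqb
    simp only [hqP, ite_self, Finset.sum_const_zero, add_zero] at this
    rw [← this]
    congr 1
    rw [Finset.sum_eq_single pb]
    · simp [P', hbP, hbpb]
    · intro y _ hy
      simp [P', hbP, hbpb, hy]
    · simp
  have hneq : a ≠ b ∧ c ≠ b ∧ a ≠ c := by
    refine ⟨?_, ?_, ?_⟩ <;> rintro rfl <;> linarith
  obtain ⟨β₂, s1, s2, s3⟩ := key a ha hneq.1 pa hpa epa
  obtain ⟨β₃, t1, t2, t3⟩ := key c hc hneq.2.1 pc hpc epc
  have const : ∀ (β : V → ZMod 2) (e : V), e ∈ O →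
      (∀ v x, E v x → v ∉ A ∪ {e, b} → x ∉ A ∪ {e, b} → β v = β x) → ∀ x ∈ B, β x = β qb := by
    intro β e he hβ x hx
    have hBW : ∀ y ∈ B, y ∉ A ∪ {e, b} := by
      rintro y hy (h4 | h4 | h4)
      · exact Set.disjoint_left.1 hAB h4 hy
      · exact hOB y (h4 ▸ he) hy
      · rw [Set.mem_singleton_iff] at h4
        exact hOB y (h4 ▸ hb) hy
    have hr := hBc x hx qb hqb
    induction hr using Relation.ReflTransGen.head_induction_on with
    | refl => rfl
    | head h4 _ ih =>
      rw [← ih h4.2.2]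
      exact hβ _ _ h4.1 (hBW _ h4.2.1) (hBW _ h4.2.2)
  have u1 : β₃ a = β₃ qb := by
    rw [← const β₃ c hc t2 qa hqa]
    refine t2 a qa eqa ?_ ?_
    · rintro (h4 | h4 | h4)
      · exact hOA a ha h4
      · exact hneq.2.2 h4
      · exact hneq.1 h4
    · rintro (h4 | h4 | h4)
      · exact Set.disjoint_left.1 hAB h4 hqa
      · exact hOB qa (h4 ▸ hc) hqa
      · rw [Set.mem_singleton_iff] at h4
        exact hOB qa (h4 ▸ hb) hqa
  have u2 : β₂ c = β₂ qb := by
    rw [← const β₂ a ha s2 qc hqc]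
    refine s2 c qc eqc ?_ ?_
    · rintro (h4 | h4 | h4)
      · exact hOA c hc h4
      · exact hneq.2.2 h4.symm
      · exact hneq.2.1 h4
    · rintro (h4 | h4 | h4)
      · exact Set.disjoint_left.1 hAB h4 hqc
      · exact hOB qc (h4 ▸ ha) hqc
      · rw [Set.mem_singleton_iff] at h4
        exact hOB qc (h4 ▸ hb) hqc
  have v1 : β₃ a = 0 := by
    rw [t1 a ha]
    simp [(h1.trans h2).le.not_gt, h1.le.not_gt]
  have v2 : β₂ c = 0 := by
    rw [s1 c hc]
    simp [h1.trans h2, h2, CharTwo.add_self_eq_zero]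
  have v3 : β₂ b = 1 := by
    rw [s1 b hb]
    simp [h1]
  have v4 : β₃ b = 0 := by
    rw [t1 b hb]
    simp [h2.le.not_gt]
  rw [v3, ← u2, v2] at s3
  rw [v4, ← u1, v1] at t3
  have : (0 : ZMod 2) = 1 := by linear_combination s3 - t3
  exact absurd this (by decide)

end PlanarOrder

end Chains

/-- The order-embedding-like reparametrisation that moves the numbers above `κ` below the others. -/
noncomputable def rotateAt (κ t : ℝ) : ℝ := if κ < t then -Real.exp (-t) else Real.exp t

theorem rotateAt_lt_iff (κ s t : ℝ) : rotateAt κ s < rotateAt κ t ↔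
    (κ < s ∧ t ≤ κ) ∨ (κ < s ∧ κ < t ∧ s < t) ∨ (s ≤ κ ∧ t ≤ κ ∧ s < t) := by
  have h1 := Real.exp_pos s
  have h2 := Real.exp_pos t
  have h3 := Real.exp_pos (-s)
  have h4 := Real.exp_pos (-t)
  unfold rotateAt
  split_ifs with hs ht ht
  · simp only [neg_lt_neg_iff, Real.exp_lt_exp, hs, ht, ht.not_ge, hs.not_ge, true_and, and_false,
      false_and, or_false, false_or]
  · simp only [hs, not_lt.1 ht, true_and, true_or, iff_true]
    linarith
  · simp only [hs, not_lt.1 hs, ht, ht.not_ge, false_and, and_false, or_false, iff_false]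
    linarith
  · simp [hs, not_lt.1 hs, not_lt.1 ht]

theorem rotateAt_injective (κ : ℝ) : Function.Injective (rotateAt κ) := by
  intro s t h
  rcases lt_trichotomy s t with h1 | h1 | h1
  · rcases le_or_gt s κ with h2 | h2
    · rcases le_or_gt t κ with h3 | h3
      · exact absurd h ((rotateAt_lt_iff κ s t).2 (Or.inr (Or.inr ⟨h2, h3, h1⟩))).ne
      · exact absurd h ((rotateAt_lt_iff κ t s).2 (Or.inl ⟨h3, h2⟩)).ne'
    · exact absurd h ((rotateAt_lt_iff κ s t).2 (Or.inr (Or.inl ⟨h2, h2.trans h1, h1⟩))).ne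
  · exact h1
  · rcases le_or_gt s κ with h2 | h2
    · exact absurd h ((rotateAt_lt_iff κ t s).2 (Or.inr (Or.inr ⟨h1.le.trans h2, h2, h1⟩))).ne'
    · rcases le_or_gt t κ with h3 | h3
      · exact absurd h ((rotateAt_lt_iff κ s t).2 (Or.inl ⟨h2, h3⟩)).ne
      · exact absurd h ((rotateAt_lt_iff κ t s).2 (Or.inr (Or.inl ⟨h3, h2, h1⟩))).ne'

theorem rotateAt_le_iff (κ s t : ℝ) : rotateAt κ s ≤ rotateAt κ t ↔
    (κ < s ∧ t ≤ κ) ∨ (κ < s ∧ κ < t ∧ s ≤ t) ∨ (s ≤ κ ∧ t ≤ κ ∧ s ≤ t) := by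
  rw [le_iff_lt_or_eq, rotateAt_lt_iff, (rotateAt_injective κ).eq_iff]
  constructor
  · rintro ((h | h | h) | rfl)
    · exact Or.inl h
    · exact Or.inr (Or.inl ⟨h.1, h.2.1, h.2.2.le⟩)
    · exact Or.inr (Or.inr ⟨h.1, h.2.1, h.2.2.le⟩)
    · rcases le_or_gt s κ with h | h
      · exact Or.inr (Or.inr ⟨h, h, le_rfl⟩)
      · exact Or.inr (Or.inl ⟨h, h, le_rfl⟩)
  · rintro (h | ⟨h1, h2, h3⟩ | ⟨h1, h2, h3⟩)
    · exact Or.inl (Or.inl h)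
    · rcases h3.lt_or_eq with h3 | h3
      · exact Or.inl (Or.inr (Or.inl ⟨h1, h2, h3⟩))
      · exact Or.inr h3
    · rcases h3.lt_or_eq with h3 | h3
      · exact Or.inl (Or.inr (Or.inr ⟨h1, h2, h3⟩))
      · exact Or.inr h3

open Classical in
/-- Rotating the order at a vertex with zero boundary so that it starts after the neighbour `c`. -/
theorem sum_rotateAt {V : Type} [Fintype V] (κ : V → ℝ) (c : V) (P P' : V → ZMod 2)
    (hc : P' c = 0) (hne : ∀ y, y ≠ c → P' y = P y) (hinj : ∀ y, y ≠ c → P y ≠ 0 → κ y ≠ κ c)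
    (hsum : ∑ y, P y = 0) (x : V) (hx : κ x ≠ κ c) :
    (∑ y, if κ y ≤ κ c then P y else 0) +
        (∑ y, if rotateAt (κ c) (κ y) ≤ rotateAt (κ c) (κ x) then P' y else 0) =
      (∑ y, if κ y ≤ κ x then P y else 0) ∧
    (∑ y, if κ y ≤ κ c then P y else 0) +
        (∑ y, if rotateAt (κ c) (κ y) < rotateAt (κ c) (κ x) then P' y else 0) =
      (∑ y, if κ y < κ x then P y else 0) := by
  have h2 : ∀ t : ZMod 2, t + t = 0 := CharTwo.add_self_eq_zero
  have hy : ∀ y, y = c ∨ (y ≠ c ∧ P y = 0) ∨ (y ≠ c ∧ κ y < κ c) ∨ (y ≠ c ∧ κ c < κ y) := by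
    intro y
    by_cases h3 : y = c
    · exact Or.inl h3
    · by_cases h4 : P y = 0
      · exact Or.inr (Or.inl ⟨h3, h4⟩)
      · rcases lt_or_gt_of_ne (hinj y h3 h4) with h5 | h5
        · exact Or.inr (Or.inr (Or.inl ⟨h3, h5⟩))
        · exact Or.inr (Or.inr (Or.inr ⟨h3, h5⟩))
  simp only [rotateAt_le_iff, rotateAt_lt_iff]
  rcases lt_or_gt_of_ne hx with hx | hx
  · constructor
    all_goals
      rw [← sub_eq_zero, ← Finset.sum_add_distrib, ← Finset.sum_sub_distrib]
      refine Eq.trans ?_ hsum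
      refine Finset.sum_congr rfl fun y _ => ?_
      rcases hy y with rfl | ⟨h3, h4⟩ | ⟨h3, h4⟩ | ⟨h3, h4⟩
      · simp [hx.not_ge, hx.not_gt]
      · simp [hne y h3, h4]
      · simp [hne y h3, h4.le, h4.not_gt, hx.not_gt, hx.le]
      · simp [hne y h3, h4.not_ge, h4, (hx.trans h4).not_ge, (hx.trans h4).not_gt, hx.le]
  · constructor
    all_goals
      rw [← Finset.sum_add_distrib]
      refine Finset.sum_congr rfl fun y _ => ?_
      rcases hy y with rfl | ⟨h3, h4⟩ | ⟨h3, h4⟩ | ⟨h3, h4⟩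
      · simp [hc, hx, hx.le]
      · simp [hne y h3, h4]
      · simp [h4.le, h4.not_gt, hx.not_ge, (h4.trans hx).le, h4.trans hx]
      · simp [hne y h3, h4.not_ge, h4, hx.not_ge, hx]

namespace PlanarOrder

variable {V : Type} [Fintype V] {D O : Set V} {E : V → V → Prop} {o : V → ℝ} {K : V → V → ℝ}

open Classical in
/-- Cutting off the corner at `c`: its neighbours take its place on the boundary. -/
theorem step (hP : PlanarOrder D O E o K) (hE : ∀ x y, E x y → E y x)
    (hDO : Disjoint D O) (hirr : ∀ x, ¬ E x x) {c : V} (hc : c ∈ O) (hcD : ∀ y, E c y → y ∈ D)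
    {o₁ : V → ℝ}
    (ho : ∀ u ∈ O, u ≠ c → ∀ w ∈ O, w ≠ c → (o₁ u < o₁ w ↔ o u < o w))
    (hoc : ∀ u ∈ O, u ≠ c → ∀ h, E c h → (o₁ u < o₁ h ↔ o u < o c))
    (hco : ∀ u ∈ O, u ≠ c → ∀ h, E c h → (o₁ h < o₁ u ↔ o c < o u))
    (hcc : ∀ h h', E c h → E c h' → (o₁ h < o₁ h' ↔ K c h < K c h')) :
    ∃ K', PlanarOrder {v | v ∈ D ∧ ¬ E c v} ({u | u ∈ O ∧ u ≠ c} ∪ {h | E c h})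
      (fun v w => E v w ∧ v ≠ c ∧ w ≠ c) o₁ K' := by
  have h2 : ∀ t : ZMod 2, t + t = 0 := CharTwo.add_self_eq_zero
  have hOE : ∀ u ∈ O, ¬ E c u := fun u hu h => Set.disjoint_left.1 hDO (hcD u h) hu
  refine ⟨fun v y => if E c v then rotateAt (K v c) (K v y) else K v y, ?_, ?_⟩
  · intro v x y h3 h4 h5
    by_cases hv : E c v
    · simp only [hv, if_true] at h5
      exact hP.inj v x y h3.1 h4.1 (rotateAt_injective _ h5)
    · simp only [hv, if_false] at h5
      exact hP.inj v x y h3.1 h4.1 h5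
  intro P' p1 p2 p3
  obtain ⟨Q, hQ⟩ : ∃ Q : V → ZMod 2, ∀ v, Q v = ∑ y, P' v y := ⟨_, fun _ => rfl⟩
  obtain ⟨P, hPd⟩ : ∃ P : V → V → ZMod 2, ∀ v w, P v w = P' v w +
    ((if v = c ∧ E c w then Q w else 0) + if w = c ∧ E c v then Q v else 0) := ⟨_, fun _ _ => rfl⟩
  have hP'c : ∀ y, P' c y = 0 := fun y => by
    by_contra h4
    exact (p2 _ _ h4).2.1 rfl
  have hP'c' : ∀ y, P' y c = 0 := fun y => by rw [p1, hP'c]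
  have hPc : ∀ y, P c y = if E c y then Q y else 0 := fun y => by
    rw [hPd, hP'c]
    by_cases hy : y = c
    · subst hy; simp [hirr]
    · simp [hy]
  have hPne : ∀ v y, v ≠ c → y ≠ c → P v y = P' v y := fun v y hv hy => by
    rw [hPd]; simp [hv, hy]
  have hPs : ∀ v w, P v w = P w v := fun v w => by
    rw [hPd, hPd, p1]; ring
  have hPE : ∀ v w, P v w ≠ 0 → E v w := by
    intro v w hvw
    by_cases hv : v = c
    · subst hv
      rw [hPc] at hvw
      by_contra h4
      simp [h4] at hvw
    by_cases hw : w = c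
    · subst hw
      rw [hPs, hPc] at hvw
      by_contra h4
      have : ¬ E w v := fun h5 => h4 (hE _ _ h5)
      simp [this] at hvw
    rw [hPne v w hv hw] at hvw
    exact (p2 v w hvw).1
  have hdP : ∀ v, v ≠ c → ∑ y, P v y = Q v + if E c v then Q v else 0 := by
    intro v hv
    simp only [hPd, Finset.sum_add_distrib, ← hQ]
    simp [hv, ite_and]
  have hdPc : ∑ y, P c y = ∑ y, if E c y then Q y else 0 := Finset.sum_congr rfl fun y _ => hPc y
  have hdD : ∀ v ∈ D, ∑ y, P v y = 0 := by
    intro v hv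
    have hvc : v ≠ c := by rintro rfl; exact Set.disjoint_left.1 hDO hv hc
    rw [hdP v hvc]
    by_cases hEv : E c v
    · simp [hEv, h2]
    · rw [hQ, p3 v ⟨hv, hEv⟩]; simp
  obtain ⟨b, hb1, hb2⟩ := hP.color P hPs hPE hdD
  obtain ⟨b', hb'⟩ : ∃ b' : V → ZMod 2, ∀ v, b' v = if E c v then
    b v + ∑ y, (if K v y ≤ K v c then P v y else 0) else b v := ⟨_, fun _ => rfl⟩
  have hcE : ∀ h, E c h → h ≠ c := by rintro h hh rfl; exact hirr _ hh
  have hb'h : ∀ h, E c h → b' h = b c + ∑ y, if K c y < K c h then P c y else 0 := by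
    intro h hh
    have h3 := hb2 c h hh
    have e1 : (∑ y, if K h y ≤ K h c then P h y else 0) =
        (∑ y, if K h y < K h c then P h y else 0) + P h c := by
      rw [← Fintype.sum_ite_eq c (fun y => P h y), ← Finset.sum_add_distrib]
      refine Finset.sum_congr rfl fun y _ => ?_
      by_cases hy : c = y
      · subst hy; simp
      · by_cases h0 : P h y = 0
        · simp [h0]
        · have : K h y ≠ K h c := fun h4 => hy (hP.inj _ _ _ (hPE _ _ h0) (hE _ _ hh) h4).symm
          simp [hy, le_iff_lt_or_eq, this]
    have e2 : (∑ y, if K c y ≤ K c h then P c y else 0) =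
        (∑ y, if K c y < K c h then P c y else 0) + P c h := by
      rw [← Fintype.sum_ite_eq h (fun y => P c y), ← Finset.sum_add_distrib]
      refine Finset.sum_congr rfl fun y _ => ?_
      by_cases hy : h = y
      · subst hy; simp
      · by_cases h0 : P c y = 0
        · simp [h0]
        · have : K c y ≠ K c h := fun h4 => hy (hP.inj _ _ _ (hPE _ _ h0) hh h4).symm
          simp [hy, le_iff_lt_or_eq, this]
    rw [hb', if_pos hh, e1]
    rw [e2] at h3
    rw [hPs h c]
    linear_combination -h3 + h2 (P c h)
  have hQc : Q c = 0 := by rw [hQ]; simp [hP'c]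
  refine ⟨b', ?_, ?_⟩
  · rintro u (⟨hu, huc⟩ | hu)
    · rw [hb', if_neg (hOE u hu), hb1 u hu]
      have : ∀ u', (if u' ∈ O ∧ o u' < o u then ∑ y, P u' y else 0) =
          (if u' ∈ O ∧ u' ≠ c ∧ o u' < o u then Q u' else 0) +
            if u' = c then (if o c < o u then ∑ y, P c y else 0) else 0 := by
        intro u'
        by_cases h5 : u' = c
        · subst h5; simp [hc]
        · by_cases h6 : u' ∈ O
          · rw [hdP u' h5]
            simp [h5, h6, hOE u' h6]
          · simp [h5, h6]
      rw [Finset.sum_congr rfl fun u' _ => this u', Finset.sum_add_distrib]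
      simp only [Finset.sum_ite_eq', Finset.mem_univ, if_true, ← hQ]
      rw [hdPc]
      have : (if o c < o u then ∑ y, (if E c y then Q y else 0) else 0) =
          ∑ y, if E c y ∧ o c < o u then Q y else 0 := by
        by_cases h5 : o c < o u <;> simp [h5]
      rw [this, ← Finset.sum_add_distrib]
      refine Finset.sum_congr rfl fun u' _ => ?_
      by_cases h5 : E c u'
      · have h6 : u' ∉ O := fun h7 => hOE _ h7 h5
        simp [h5, h6, hco u hu huc u' h5]
      · by_cases h6 : u' ∈ O
        · by_cases h7 : u' = c
          · simp [h7, hirr]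
          · simp [h5, h6, h7, ho u' h6 h7 u hu huc]
        · simp [h5, h6]
    · have hu' : E c u := hu
      rw [hb'h u hu, hb1 c hc, ← Finset.sum_add_distrib]
      refine Finset.sum_congr rfl fun u' _ => ?_
      rw [hPc]
      by_cases h5 : E c u'
      · have h6 : u' ∉ O := fun h7 => hOE _ h7 h5
        simp [h5, h6, hcc u' u h5 hu', hQ]
      · by_cases h6 : u' ∈ O
        · by_cases h7 : u' = c
          · simp [h7, hirr]
          · rw [hdP u' h7]
            simp [h5, h6, h7, hoc u' h6 h7 u hu', hQ]
        · simp [h5, h6]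
  · have key : ∀ v x, E v x → v ≠ c → x ≠ c →
        (b' v + (∑ y, if (if E c v then rotateAt (K v c) (K v y) else K v y) ≤
          (if E c v then rotateAt (K v c) (K v x) else K v x) then P' v y else 0) =
          b v + ∑ y, if K v y ≤ K v x then P v y else 0) ∧
        (b' v + (∑ y, if (if E c v then rotateAt (K v c) (K v y) else K v y) <
          (if E c v then rotateAt (K v c) (K v x) else K v x) then P' v y else 0) =
          b v + ∑ y, if K v y < K v x then P v y else 0) := by
      intro v x hvx hv hx
      by_cases hEv : E c v
      · have hvc := hE _ _ hEv
        have := sum_rotateAt (K v) c (P v) (P' v) (hP'c' v) (fun y hy => (hPne v y hv hy).symm)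
          (fun y hy h0 h4 => hy (hP.inj _ _ _ (hPE _ _ h0) hvc h4)) (hdD v (hcD v hEv)) x
          (fun h4 => hx (hP.inj _ _ _ hvx hvc h4))
        simp only [hEv, if_true, hb']
        rw [add_assoc, add_assoc, this.1, this.2]
        exact ⟨rfl, rfl⟩
      · have : ∀ y, P v y = P' v y := fun y => by
          by_cases hy : y = c
          · subst hy
            rw [hP'c', hPs, hPc, if_neg hEv]
          · exact hPne v y hv hy
        simp [hEv, hb', this]
    rintro v x ⟨hvx, hv, hx⟩
    have := hb2 v x hvx
    rw [← (key v x hvx hv hx).1, ← (key x v (hE _ _ hvx) hx hv).2] at this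
    exact this

end PlanarOrder

/-- A contour of a forest on `S` growing from the owners in `O`, which respects the chords `E`. -/
structure ForestContour {V : Type} (G : SimpleGraph V) (S O : Set V) (E : V → V → Prop)
    (par : V → V) (o z : V → ℝ) : Prop where
  lt : ∀ v ∈ S ∪ O, o v < z v
  par_mem : ∀ v ∈ S, par v ∈ S ∪ O
  adj : ∀ v ∈ S, G.Adj (par v) v
  par_o : ∀ v ∈ S, o (par v) < o v
  par_z : ∀ v ∈ S, z v < z (par v)
  root : ∀ v ∈ S, ∃ u ∈ O, o u < o v ∧ z v < z u
  disj : ∀ u ∈ O, ∀ w ∈ O, u ≠ w → z u < o w ∨ z w < o u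
  laminar : ∀ v ∈ S, ∀ w ∈ S, v ≠ w →
    z v < o w ∨ z w < o v ∨ (o v < o w ∧ z w < z v) ∨ (o w < o v ∧ z v < z w)
  least : ∀ v ∈ S, ∀ w ∈ S ∪ O, o w < o v → z v < z w →
    w = par v ∨ (o w < o (par v) ∧ z (par v) < z w)
  mem : ∀ v w, E v w → v ∈ S ∪ O
  symm : ∀ v w, E v w → E w v
  edge : ∀ v w, E v w →
    (v ∈ S ∧ w = par v) ∨ (w ∈ S ∧ v = par w) ∨ z v < o w ∨ z w < o v
  nc : ∀ i j i' j', E i j → E i' j' → z i < z i' → z i' < o j → o j < o j' → False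

namespace ForestContour

variable {V : Type} {G : SimpleGraph V} {S O : Set V} {E : V → V → Prop} {par : V → V}
  {o z : V → ℝ}

theorem mono (h : ForestContour G S O E par o z) {E' : V → V → Prop}
    (hE : ∀ v w, E' v w → E v w) (hs : ∀ v w, E' v w → E' w v) :
    ForestContour G S O E' par o z :=
  { h with
    mem := fun v w hvw => h.mem v w (hE _ _ hvw)
    symm := hs
    edge := fun v w hvw => h.edge v w (hE _ _ hvw)
    nc := fun i j i' j' h1 h2 => h.nc i j i' j' (hE _ _ h1) (hE _ _ h2) }

/-- The position of a vertex relative to an owner. -/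
theorem owner_cases (h : ForestContour G S O E par o z) {a w : V} (ha : a ∈ O) (hw : w ∈ S ∪ O) :
    w = a ∨ z w < o a ∨ z a < o w ∨ (w ∈ S ∧ o a < o w ∧ z w < z a) := by
  rcases hw with hw | hw
  · obtain ⟨u, hu, h1, h2⟩ := h.root w hw
    by_cases hua : u = a
    · subst hua
      exact Or.inr (Or.inr (Or.inr ⟨hw, h1, h2⟩))
    · rcases h.disj u hu a ha hua with h3 | h3
      · exact Or.inr (Or.inl (h2.trans h3))
      · exact Or.inr (Or.inr (Or.inl (h3.trans h1)))
  · by_cases hwa : w = a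
    · exact Or.inl hwa
    · rcases h.disj w hw a ha hwa with h3 | h3
      · exact Or.inr (Or.inl h3)
      · exact Or.inr (Or.inr (Or.inl h3))

/-- Reading a contour backwards. -/
theorem reflect (h : ForestContour G S O E par o z) :
    ForestContour G S O E par (fun v => -z v) (fun v => -o v) where
  lt v hv := neg_lt_neg (h.lt v hv)
  par_mem := h.par_mem
  adj := h.adj
  par_o v hv := neg_lt_neg (h.par_z v hv)
  par_z v hv := neg_lt_neg (h.par_o v hv)
  root v hv := by
    obtain ⟨u, hu, h1, h2⟩ := h.root v hv
    exact ⟨u, hu, neg_lt_neg h2, neg_lt_neg h1⟩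
  disj u hu w hw huw := by
    rcases h.disj u hu w hw huw with h1 | h1
    · exact Or.inr (neg_lt_neg h1)
    · exact Or.inl (neg_lt_neg h1)
  laminar v hv w hw hvw := by
    simp only [neg_lt_neg_iff]
    have := h.laminar v hv w hw hvw
    tauto
  least v hv w hw h1 h2 := by
    simp only [neg_lt_neg_iff] at *
    have := h.least v hv w hw h2 h1
    tauto
  mem := h.mem
  symm := h.symm
  edge v w hvw := by
    simp only [neg_lt_neg_iff]
    have := h.edge v w hvw
    tauto
  nc i j i' j' h1 h2 h3 h4 h5 := by
    simp only [neg_lt_neg_iff] at *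
    exact h.nc j' i' j i (h.symm _ _ h2) (h.symm _ _ h1) h5 h4 h3

open Classical in
/-- Inserting a contour on `A` at the right end of the owner `a`, with a possible second owner `b`
to the right of `a`. -/
theorem insert_last (h : ForestContour G S O E par o z) {A B : Set V} {E' : V → V → Prop}
    {par' : V → V} {o' z' : V → ℝ} (h' : ForestContour G A B E' par' o' z') {a b : V}
    (hAS : ∀ v ∈ A, v ∉ S ∪ O) (ha : a ∈ O) (haB : a ∈ B) (hB : ∀ u ∈ B, u = a ∨ u = b)
    (hE' : ∀ v w, E' v w → v ∈ A ∨ w ∈ A) (hz : z' a = z a) (ho : o a < o' a)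
    (hM : ∀ v ∈ S, o a < o v → z v < z a → z v < o' a)
    (hA : ∀ v ∈ A, o' a < o' v ∧ z' v < z' a)
    (hb : b ∈ B → b ≠ a → b ∈ O ∧ z a < o b ∧ E a b ∧ o' b = o b ∧ z' b = z b ∧
      ∀ j, E a j → ¬ o b < o j) :
    ForestContour G (S ∪ A) O (fun v w => E v w ∨ E' v w)
      (fun v => if v ∈ A then par' v else par v) (fun v => if v ∈ A then o' v else o v)
      (fun v => if v ∈ A then z' v else z v) := by
  have hSA : ∀ v ∈ S ∪ O, v ∉ A := fun v hv hvA => hAS v hvA hv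
  have haA : a ∉ A := hSA a (Or.inr ha)
  have hltA : ∀ v ∈ A, o' v < z' v := fun v hv => h'.lt v (Or.inl hv)
  have hzaM : o' a < z a := hz ▸ h'.lt a (Or.inr haB)
  have hpar : ∀ v ∈ A, par' v ∈ A ∨ par' v = a := by
    intro v hv
    rcases h'.par_mem v hv with h1 | h1
    · exact Or.inl h1
    · rcases hB _ h1 with h2 | h2
      · exact Or.inr h2
      · by_cases hba : b = a
        · exact Or.inr (h2.trans hba)
        · rw [h2] at h1
          obtain ⟨-, h3, -, h4, -⟩ := hb h1 hba
          have := h'.par_o v hv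
          rw [h2, h4] at this
          have := hA v hv
          have := hltA v hv
          linarith
  have hloc : ∀ w ∈ S ∪ O, w = a ∨ z w < o' a ∨ z a < o w := by
    intro w hw
    rcases h.owner_cases ha hw with h1 | h1 | h1 | h1
    · exact Or.inl h1
    · exact Or.inr (Or.inl (h1.trans ho))
    · exact Or.inr (Or.inr h1)
    · exact Or.inr (Or.inl (hM w h1.1 h1.2.1 h1.2.2))
  have hend : ∀ v w, E' v w → v ∈ A ∨ v = a ∨ (v = b ∧ b ∈ B ∧ b ≠ a) := by
    intro v w hvw
    rcases h'.mem v w hvw with h1 | h1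
    · exact Or.inl h1
    · rcases hB v h1 with h2 | h2
      · exact Or.inr (Or.inl h2)
      · by_cases h3 : b = a
        · exact Or.inr (Or.inl (h2.trans h3))
        · exact Or.inr (Or.inr ⟨h2, h2 ▸ h1, h3⟩)
  generalize hp2 : (fun v => if v ∈ A then par' v else par v) = p2
  generalize ho2 : (fun v => if v ∈ A then o' v else o v) = o2
  generalize hz2 : (fun v => if v ∈ A then z' v else z v) = z2
  have pA : ∀ v ∈ A, p2 v = par' v := fun v hv => hp2 ▸ if_pos hv
  have pN : ∀ v, v ∉ A → p2 v = par v := fun v hv => hp2 ▸ if_neg hv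
  have oA : ∀ v ∈ A, o2 v = o' v := fun v hv => ho2 ▸ if_pos hv
  have oN : ∀ v, v ∉ A → o2 v = o v := fun v hv => ho2 ▸ if_neg hv
  have zA : ∀ v ∈ A, z2 v = z' v := fun v hv => hz2 ▸ if_pos hv
  have zN : ∀ v, v ∉ A → z2 v = z v := fun v hv => hz2 ▸ if_neg hv
  clear hp2 ho2 hz2
  have hbA : b ∈ B → b ≠ a → b ∉ A := fun h1 h2 => hSA b (Or.inr (hb h1 h2).1)
  have hrel : ∀ v ∈ A, ∀ w ∈ S ∪ O, z' v < o w ∨ z w < o' v ∨ (o w < o' v ∧ z' v < z w) := by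
    intro v hv w hw
    have := hA v hv
    rcases hloc w hw with rfl | h1 | h1
    · exact Or.inr (Or.inr ⟨by linarith, by linarith⟩)
    · exact Or.inr (Or.inl (by linarith))
    · exact Or.inl (by linarith)
  have hmem : ∀ w ∈ S ∪ A ∪ O, w ∈ A ∨ (w ∉ A ∧ w ∈ S ∪ O) := by
    rintro w ((hw | hw) | hw)
    · exact Or.inr ⟨hSA w (Or.inl hw), Or.inl hw⟩
    · exact Or.inl hw
    · exact Or.inr ⟨hSA w (Or.inr hw), Or.inr hw⟩
  refine ⟨?_, ?_, ?_, ?_, ?_, ?_, ?_, ?_, ?_, ?_, ?_, ?_, ?_⟩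
  · intro v hv
    rcases hmem v hv with h1 | ⟨h1, h2⟩
    · rw [oA v h1, zA v h1]; exact hltA v h1
    · rw [oN v h1, zN v h1]; exact h.lt v h2
  · rintro v (hv | hv)
    · rw [pN v (hSA v (Or.inl hv))]
      rcases h.par_mem v hv with h1 | h1
      · exact Or.inl (Or.inl h1)
      · exact Or.inr h1
    · rw [pA v hv]
      rcases hpar v hv with h1 | h1
      · exact Or.inl (Or.inr h1)
      · rw [h1]; exact Or.inr ha
  · rintro v (hv | hv)
    · rw [pN v (hSA v (Or.inl hv))]
      exact h.adj v hv
    · rw [pA v hv]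
      exact h'.adj v hv
  · rintro v (hv | hv)
    · rw [pN v (hSA v (Or.inl hv)), oN v (hSA v (Or.inl hv)), oN _ (hSA _ (h.par_mem v hv))]
      exact h.par_o v hv
    · rw [pA v hv, oA v hv]
      rcases hpar v hv with h1 | h1
      · rw [oA _ h1]; exact h'.par_o v hv
      · rw [h1, oN a haA]
        linarith [hA v hv]
  · rintro v (hv | hv)
    · rw [pN v (hSA v (Or.inl hv)), zN v (hSA v (Or.inl hv)), zN _ (hSA _ (h.par_mem v hv))]
      exact h.par_z v hv
    · rw [pA v hv, zA v hv]
      rcases hpar v hv with h1 | h1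
      · rw [zA _ h1]; exact h'.par_z v hv
      · rw [h1, zN a haA]
        linarith [hA v hv]
  · rintro v (hv | hv)
    · obtain ⟨u, hu, h1, h2⟩ := h.root v hv
      refine ⟨u, hu, ?_⟩
      rw [oN v (hSA v (Or.inl hv)), oN u (hSA u (Or.inr hu)), zN v (hSA v (Or.inl hv)),
        zN u (hSA u (Or.inr hu))]
      exact ⟨h1, h2⟩
    · refine ⟨a, ha, ?_⟩
      have := hA v hv
      rw [oN a haA, oA v hv, zN a haA, zA v hv]
      exact ⟨by linarith, by linarith⟩
  · intro u hu w hw huw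
    rw [oN u (hSA u (Or.inr hu)), oN w (hSA w (Or.inr hw)), zN u (hSA u (Or.inr hu)),
      zN w (hSA w (Or.inr hw))]
    exact h.disj u hu w hw huw
  · rintro v (hv | hv) w (hw | hw) hvw
    · rw [oN v (hSA v (Or.inl hv)), oN w (hSA w (Or.inl hw)), zN v (hSA v (Or.inl hv)),
        zN w (hSA w (Or.inl hw))]
      exact h.laminar v hv w hw hvw
    · rw [oN v (hSA v (Or.inl hv)), oA w hw, zN v (hSA v (Or.inl hv)), zA w hw]
      have := hrel w hw v (Or.inl hv)
      tauto
    · rw [oN w (hSA w (Or.inl hw)), oA v hv, zN w (hSA w (Or.inl hw)), zA v hv]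
      have := hrel v hv w (Or.inl hw)
      tauto
    · rw [oA v hv, oA w hw, zA v hv, zA w hw]
      exact h'.laminar v hv w hw hvw
  · rintro v (hv | hv) w hw h1 h2
    · have hvA := hSA v (Or.inl hv)
      have hpA := hSA _ (h.par_mem v hv)
      rw [oN v hvA] at h1
      rw [zN v hvA] at h2
      rw [pN v hvA, oN _ hpA, zN _ hpA]
      rcases hmem w hw with h3 | ⟨h3, h4⟩
      · rw [oA w h3] at h1
        rw [zA w h3] at h2
        have := h.lt v (Or.inl hv)
        rcases hrel w h3 v (Or.inl hv) with h4 | h4 | h4 <;> linarith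
      · rw [oN w h3] at h1 ⊢
        rw [zN w h3] at h2 ⊢
        exact h.least v hv w h4 h1 h2
    · rw [oA v hv] at h1
      rw [zA v hv] at h2
      rw [pA v hv]
      rcases hmem w hw with h3 | ⟨h3, h4⟩
      · rw [oA w h3] at h1 ⊢
        rw [zA w h3] at h2 ⊢
        have h5 := h'.least v hv w (Or.inl h3) h1 h2
        rcases hpar v hv with h6 | h6
        · rwa [oA _ h6, zA _ h6]
        · rw [h6] at h5
          rcases h5 with h5 | h5
          · exact absurd (h5 ▸ h3) haA
          · linarith [hA w h3]
      · rw [oN w h3] at h1 ⊢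
        rw [zN w h3] at h2 ⊢
        have hv2 := hA v hv
        have hvl := hltA v hv
        have hw : w = a ∨ (o w < o a ∧ z a < z w) := by
          rcases h.owner_cases ha h4 with h5 | h5 | h5 | h5
          · exact Or.inl h5
          · linarith
          · linarith
          · linarith [hM w h5.1 h5.2.1 h5.2.2]
        have h7 : a = par' v ∨ (o' a < o' (par' v) ∧ z' (par' v) < z' a) :=
          h'.least v hv a (Or.inr haB) hv2.1 hv2.2
        rcases hpar v hv with h6 | h6
        · have := hA _ h6
          rw [oA _ h6, zA _ h6]
          rcases hw with rfl | hw
          · exact Or.inr ⟨by linarith, by linarith⟩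
          · exact Or.inr ⟨by linarith, by linarith⟩
        · rw [h6, oN a haA, zN a haA]
          exact hw
  · rintro v w (hvw | hvw)
    · rcases h.mem v w hvw with h1 | h1
      · exact Or.inl (Or.inl h1)
      · exact Or.inr h1
    · rcases hend v w hvw with h1 | h1 | h1
      · exact Or.inl (Or.inr h1)
      · rw [h1]; exact Or.inr ha
      · rw [h1.1]; exact Or.inr (hb h1.2.1 h1.2.2).1
  · rintro v w (hvw | hvw)
    · exact Or.inl (h.symm _ _ hvw)
    · exact Or.inr (h'.symm _ _ hvw)
  · have key : ∀ v w, v ∈ A → E' v w → ((v ∈ S ∪ A ∧ w = p2 v) ∨ (w ∈ S ∪ A ∧ v = p2 w) ∨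
        z2 v < o2 w ∨ z2 w < o2 v) := by
      intro v w hv hvw
      have h1 := h'.edge v w hvw
      have hv2 := hA v hv
      have hvl := hltA v hv
      rcases hend w v (h'.symm _ _ hvw) with hw | hw | hw
      · rw [oA v hv, oA w hw, zA v hv, zA w hw, pA v hv, pA w hw]
        rcases h1 with h1 | h1 | h1
        · exact Or.inl ⟨Or.inr hv, h1.2⟩
        · exact Or.inr (Or.inl ⟨Or.inr hw, h1.2⟩)
        · exact Or.inr (Or.inr h1)
      · subst hw
        rcases h1 with h1 | h1 | h1 | h1
        · exact Or.inl ⟨Or.inr hv, by rw [pA v hv]; exact h1.2⟩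
        · exact absurd h1.1 haA
        · linarith
        · linarith
      · obtain ⟨rfl, h2, h3⟩ := hw
        obtain ⟨h4, h5, h6⟩ := hb h2 h3
        refine Or.inr (Or.inr (Or.inl ?_))
        rw [zA v hv, oN w (hbA h2 h3)]
        linarith
    rintro v w (hvw | hvw)
    · have h1 := hSA v (h.mem _ _ hvw)
      have h2 := hSA w (h.mem _ _ (h.symm _ _ hvw))
      rw [oN v h1, oN w h2, zN v h1, zN w h2, pN v h1, pN w h2]
      rcases h.edge v w hvw with h1 | h1 | h1
      · exact Or.inl ⟨Or.inl h1.1, h1.2⟩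
      · exact Or.inr (Or.inl ⟨Or.inl h1.1, h1.2⟩)
      · exact Or.inr (Or.inr h1)
    · rcases hE' v w hvw with h1 | h1
      · exact key v w h1 hvw
      · have := key w v h1 (h'.symm _ _ hvw)
        tauto
  · have hend2 : ∀ v w, E' v w → (v ∈ A ∧ o2 v = o' v ∧ z2 v = z' v ∧ o' a < o' v ∧ o' v < z' v ∧
        z' v < z a) ∨ (v = a ∧ o2 v = o a ∧ z2 v = z a ∧ w ∈ A) ∨
        (v = b ∧ b ∈ B ∧ b ≠ a ∧ o2 v = o b ∧ z2 v = z b ∧ z a < o b ∧ o b < z b ∧ w ∈ A ∧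
          o' v = o b ∧ z' v = z b) := by
      intro v w hvw
      rcases hend v w hvw with h1 | rfl | ⟨rfl, h2, h3⟩
      · have := hA v h1
        exact Or.inl ⟨h1, oA v h1, zA v h1, this.1, hltA v h1, hz ▸ this.2⟩
      · exact Or.inr (Or.inl ⟨rfl, oN v haA, zN v haA, (hE' v w hvw).resolve_left haA⟩)
      · have hvA := hbA h2 h3
        obtain ⟨h4, h5, -, h6, h7, -⟩ := hb h2 h3
        exact Or.inr (Or.inr ⟨rfl, h2, h3, oN v hvA, zN v hvA, h5, h.lt v (Or.inr h4),
          (hE' v w hvw).resolve_left hvA, h6, h7⟩)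
    have hold : ∀ v w, E v w → o2 v = o v ∧ z2 v = z v ∧ o v < z v ∧
        (v = a ∨ z v < o' a ∨ z a < o v) := by
      intro v w hvw
      have h1 := h.mem v w hvw
      exact ⟨oN v (hSA v h1), zN v (hSA v h1), h.lt v h1, hloc v h1⟩
    rintro i j i' j' (h1 | h1) (h2 | h2) h3 h4 h5
    · rw [(hold i j h1).2.1, (hold i' j' h2).2.1] at h3
      rw [(hold i' j' h2).2.1, (hold j i (h.symm _ _ h1)).1] at h4
      rw [(hold j i (h.symm _ _ h1)).1, (hold j' i' (h.symm _ _ h2)).1] at h5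
      exact h.nc i j i' j' h1 h2 h3 h4 h5
    · obtain ⟨a1, a2, a3, a4⟩ := hold i j h1
      obtain ⟨b1, b2, b3, b4⟩ := hold j i (h.symm _ _ h1)
      have c1 := hend2 i' j' h2
      have d1 := hend2 j' i' (h'.symm _ _ h2)
      have hla := h.lt a (Or.inr ha)
      rw [a2] at h3
      rw [b1] at h4 h5
      rcases d1 with ⟨d0, d1, d2, d3, d4, d5⟩ | ⟨d0, d1, d2, d3⟩ | ⟨d0, dB, dn, d1, d2, d3, d4, d5, -⟩
      · rcases c1 with ⟨c0, c1, c2, c3, c4, c5⟩ | ⟨c0, c1, c2, c3⟩ |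
          ⟨c0, cB, cn, c1, c2, c3, c4, c5, -⟩
        · rcases b4 with rfl | b4 | b4 <;> linarith
        · linarith
        · linarith
      · rcases c1 with ⟨c0, c1, c2, c3, c4, c5⟩ | ⟨c0, c1, c2, c3'⟩ |
          ⟨c0, cB, cn, c1, c2, c3', c4, c5, -⟩ <;> linarith
      · rcases c1 with ⟨c0, c1, c2, c3, c4, c5⟩ | ⟨c0, c1, c2, c3⟩ |
          ⟨c0, cB, cn, c1, c2, c3, c4, c5', -⟩
        · obtain ⟨e1, e2, e3, -⟩ := hb dB dn
          have e4 : z a < o j := by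
            rcases b4 with rfl | b4 | b4
            · linarith
            · linarith
            · exact b4
          exact h.nc i j a b h1 e3 (by linarith) e4 (by linarith)
        · exact absurd d5 (by rw [c0]; exact haA)
        · exact absurd d5 (by rw [c0]; exact hbA cB cn)
    · obtain ⟨a1, a2, a3, a4⟩ := hold i' j' h2
      obtain ⟨b1, b2, b3, b4⟩ := hold j' i' (h.symm _ _ h2)
      have c1 := hend2 i j h1
      have d1 := hend2 j i (h'.symm _ _ h1)
      have hla := h.lt a (Or.inr ha)
      rw [a2] at h3 h4
      rw [b1] at h5
      rcases d1 with ⟨d0, d1, d2, d3, d4, d5⟩ | ⟨d0, d1, d2, d3⟩ | ⟨d0, dB, dn, d1, d2, d3, d4, d5, -⟩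
      · rcases c1 with ⟨c0, c1, c2, c3, c4, c5⟩ | ⟨c0, c1, c2, c3⟩ |
          ⟨c0, cB, cn, c1, c2, c3, c4, c5, -⟩
        · rcases a4 with rfl | a4 | a4 <;> linarith
        · linarith
        · linarith
      · rcases c1 with ⟨c0, c1, c2, c3, c4, c5⟩ | ⟨c0, c1, c2, c3'⟩ |
          ⟨c0, cB, cn, c1, c2, c3', c4, c5, -⟩ <;> linarith
      · rcases c1 with ⟨c0, c1, c2, c3, c4, c5⟩ | ⟨c0, c1, c2, c3⟩ |
          ⟨c0, cB, cn, c1, c2, c3, c4, c5', -⟩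
        · obtain ⟨e1, e2, e3, -, -, e4⟩ := hb dB dn
          by_cases hi : i' = a
          · rw [hi] at h2
            exact e4 j' h2 (by linarith)
          · have e5 : z a < z i' := by
              rcases a4 with a4 | a4 | a4
              · exact absurd a4 hi
              · linarith
              · linarith
            exact h.nc a b i' j' e3 h2 e5 (by linarith) (by linarith)
        · exact absurd d5 (by rw [c0]; exact haA)
        · exact absurd d5 (by rw [c0]; exact hbA cB cn)
    · have c1 := hend2 i j h1
      have c2 := hend2 j i (h'.symm _ _ h1)
      have c3 := hend2 i' j' h2
      have c4 := hend2 j' i' (h'.symm _ _ h2)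
      have hla := h.lt a (Or.inr ha)
      have ez : ∀ v w, E' v w → z2 v = z' v := by
        intro v w hvw
        rcases hend2 v w hvw with h6 | h6 | h6
        · exact h6.2.2.1
        · rw [h6.2.2.1, h6.1, hz]
        · rw [h6.2.2.2.2.1, h6.2.2.2.2.2.2.2.2.2]
      have eo : ∀ v w, E' v w → o' a < o2 v → o2 v = o' v := by
        intro v w hvw hlt
        rcases hend2 v w hvw with h6 | h6 | h6
        · exact h6.2.1
        · linarith
        · rw [h6.2.2.2.1, h6.2.2.2.2.2.2.2.2.1]
      have hi' : o' a < z2 i' := by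
        rcases c3 with c3 | c3 | c3 <;> linarith
      have ej := eo j i (h'.symm _ _ h1) (by linarith)
      have ej' := eo j' i' (h'.symm _ _ h2) (by linarith)
      rw [ez i j h1, ez i' j' h2] at h3
      rw [ej, ej'] at h5
      rw [ez i' j' h2, ej] at h4
      exact h'.nc i j i' j' h1 h2 h3 h4 h5

open Classical in
/-- Inserting a contour on `A` at the left end of the owner `a`, with a possible second owner `b`
to the left of `a`. -/
theorem insert_first (h : ForestContour G S O E par o z) {A B : Set V} {E' : V → V → Prop}
    {par' : V → V} {o' z' : V → ℝ} (h' : ForestContour G A B E' par' o' z') {a b : V}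
    (hAS : ∀ v ∈ A, v ∉ S ∪ O) (ha : a ∈ O) (haB : a ∈ B) (hB : ∀ u ∈ B, u = a ∨ u = b)
    (hE' : ∀ v w, E' v w → v ∈ A ∨ w ∈ A) (ho : o' a = o a) (hz : z' a < z a)
    (hM : ∀ v ∈ S, o a < o v → z v < z a → z' a < o v)
    (hA : ∀ v ∈ A, o' a < o' v ∧ z' v < z' a)
    (hb : b ∈ B → b ≠ a → b ∈ O ∧ z b < o a ∧ E a b ∧ o' b = o b ∧ z' b = z b ∧
      ∀ j, E a j → ¬ z j < z b) :
    ForestContour G (S ∪ A) O (fun v w => E v w ∨ E' v w)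
      (fun v => if v ∈ A then par' v else par v) (fun v => if v ∈ A then o' v else o v)
      (fun v => if v ∈ A then z' v else z v) := by
  have key := (h.reflect.insert_last h'.reflect hAS ha haB hB hE' (by simpa using ho)
    (by simpa using hz)
    (fun v hv h1 h2 => neg_lt_neg (hM v hv (neg_lt_neg_iff.1 h2) (neg_lt_neg_iff.1 h1)))
    (fun v hv => ⟨neg_lt_neg (hA v hv).2, neg_lt_neg (hA v hv).1⟩)
    (fun h1 h2 => by
      obtain ⟨e1, e2, e3, e4, e5, e6⟩ := hb h1 h2
      exact ⟨e1, neg_lt_neg e2, e3, by rw [e5], by rw [e4], fun j hj h3 =>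
        e6 j hj (neg_lt_neg_iff.1 h3)⟩)).reflect
  have e1 : ∀ f g : V → ℝ, (fun v => -(if v ∈ A then -f v else -g v)) =
      fun v => if v ∈ A then f v else g v := fun f g => by
    funext v
    split_ifs <;> simp
  rwa [e1, e1] at key

end ForestContour

theorem ForestContour.congr {V : Type} {G : SimpleGraph V} {S O : Set V} {E : V → V → Prop}
    {par par' : V → V} {o z o' z' : V → ℝ} (h : ForestContour G S O E par o z)
    (hp : ∀ v ∈ S, par' v = par v) (ho : ∀ v ∈ S ∪ O, o' v = o v) (hz : ∀ v ∈ S ∪ O, z' v = z v) :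
    ForestContour G S O E par' o' z' where
  lt v hv := by rw [ho v hv, hz v hv]; exact h.lt v hv
  par_mem v hv := by rw [hp v hv]; exact h.par_mem v hv
  adj v hv := by rw [hp v hv]; exact h.adj v hv
  par_o v hv := by
    rw [hp v hv, ho v (Or.inl hv), ho _ (h.par_mem v hv)]; exact h.par_o v hv
  par_z v hv := by
    rw [hp v hv, hz v (Or.inl hv), hz _ (h.par_mem v hv)]; exact h.par_z v hv
  root v hv := by
    obtain ⟨u, hu, h1⟩ := h.root v hv
    refine ⟨u, hu, ?_⟩
    rwa [ho v (Or.inl hv), hz v (Or.inl hv), ho u (Or.inr hu), hz u (Or.inr hu)]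
  disj u hu w hw := by
    rw [ho w (Or.inr hw), hz w (Or.inr hw), ho u (Or.inr hu), hz u (Or.inr hu)]
    exact h.disj u hu w hw
  laminar u hu w hw := by
    rw [ho w (Or.inl hw), hz w (Or.inl hw), ho u (Or.inl hu), hz u (Or.inl hu)]
    exact h.laminar u hu w hw
  least u hu w hw := by
    rw [hp u hu, ho _ (h.par_mem u hu), hz _ (h.par_mem u hu), ho w hw, hz w hw, ho u (Or.inl hu),
      hz u (Or.inl hu)]
    exact h.least u hu w hw
  mem := h.mem
  symm := h.symm
  edge v w hvw := by
    have h1 := h.mem _ _ hvw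
    have h2 := h.mem _ _ (h.symm _ _ hvw)
    rw [ho w h2, hz w h2, ho v h1, hz v h1]
    rcases h.edge v w hvw with h3 | h3 | h3
    · exact Or.inl ⟨h3.1, by rw [hp v h3.1]; exact h3.2⟩
    · exact Or.inr (Or.inl ⟨h3.1, by rw [hp w h3.1]; exact h3.2⟩)
    · exact Or.inr (Or.inr h3)
  nc i j i' j' h1 h2 := by
    rw [hz i (h.mem _ _ h1), ho j (h.mem _ _ (h.symm _ _ h1)), hz i' (h.mem _ _ h2),
      ho j' (h.mem _ _ (h.symm _ _ h2))]
    exact h.nc i j i' j' h1 h2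

/-- The edges of `G` in `D ∪ O` that meet `D`. -/
def piece {V : Type} (G : SimpleGraph V) (D O : Set V) (v w : V) : Prop :=
  G.Adj v w ∧ v ∈ D ∪ O ∧ w ∈ D ∪ O ∧ (v ∈ D ∨ w ∈ D)

theorem piece_symm {V : Type} {G : SimpleGraph V} {D O : Set V} {v w : V} (h : piece G D O v w) :
    piece G D O w v :=
  ⟨h.1.symm, h.2.2.1, h.2.1, h.2.2.2.symm⟩

/-- Every planar disc with interior vertices `D` hanging on `c` has a contour, in which the owners
at the two ends other than `c` stay empty. -/
def Fillable {V : Type} [Fintype V] (G : SimpleGraph V) (D O : Set V) : Prop :=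
  ∀ (c : V) (o z : V → ℝ) (K : V → V → ℝ), c ∈ O → PlanarOrder D O (piece G D O) o K →
    (∀ u ∈ O, o u < z u) → (∀ u ∈ O, ∀ w ∈ O, u ≠ w → z u < o w ∨ z w < o u) →
    (∀ v ∈ D, ∃ h ∈ D, G.Adj c h ∧ ReachIn G.Adj D v h) →
    ∃ (par : V → V) (o' z' : V → ℝ), (∀ u ∈ O, o' u = o u ∧ z' u = z u) ∧
      ForestContour G D O (piece G D O) par o' z' ∧
      ∀ u ∈ O, u ≠ c → ((∀ w ∈ O, w ≠ u → z u < o w) ∨ (∀ w ∈ O, w ≠ u → z w < o u)) →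
        ∀ v ∈ D, ¬ (o' u < o' v ∧ z' v < z' u)

/-- The component of `v` in `D`. -/
def compOf {V : Type} (E : V → V → Prop) (D : Set V) (v : V) : Set V := {w | ReachIn E D v w}

/-- The vertices of `O` with a neighbour in `X`. -/
def touch {V : Type} (E : V → V → Prop) (O X : Set V) : Set V := {u | u ∈ O ∧ ∃ y ∈ X, E u y}

/-- `X` has at least three neighbours in `O`. -/
def Spread {V : Type} (E : V → V → Prop) (O : Set V) (o : V → ℝ) (X : Set V) : Prop :=
  ∃ a ∈ touch E O X, ∃ b ∈ touch E O X, ∃ c ∈ touch E O X, o a < o b ∧ o b < o c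

/-- A planar disc with interior `D` whose boundary vertices own disjoint intervals. -/
structure PlanarDisc {V : Type} [Fintype V] (G : SimpleGraph V) (D O : Set V) (E : V → V → Prop)
    (o z : V → ℝ) (K : V → V → ℝ) : Prop where
  order : PlanarOrder D O E o K
  symm : ∀ v w, E v w → E w v
  disjoint : Disjoint D O
  adj : ∀ v w, E v w → G.Adj v w
  mem : ∀ v w, E v w → v ∈ D ∪ O
  of_adj : ∀ v ∈ D, ∀ w ∈ D ∪ O, G.Adj v w → E v w
  lt : ∀ u ∈ O, o u < z u
  sep : ∀ u ∈ O, ∀ w ∈ O, u ≠ w → z u < o w ∨ z w < o u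

namespace PlanarDisc

variable {V : Type} [Fintype V] {G : SimpleGraph V} {D O : Set V} {E : V → V → Prop}
  {o z : V → ℝ} {K : V → V → ℝ}

theorem irrefl (H : PlanarDisc G D O E o z K) (v : V) : ¬ E v v := fun h => (H.adj _ _ h).ne rfl

theorem not_mem (H : PlanarDisc G D O E o z K) {v : V} (hv : v ∈ D) : v ∉ O :=
  Set.disjoint_left.1 H.disjoint hv

theorem lt_of_lt (H : PlanarDisc G D O E o z K) {u w : V} (hu : u ∈ O) (hw : w ∈ O)
    (h : o u < o w) : z u < o w := by
  rcases H.sep u hu w hw (by rintro rfl; exact lt_irrefl _ h) with h1 | h1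
  · exact h1
  · linarith [H.lt w hw]

theorem eq_or_lt (H : PlanarDisc G D O E o z K) {u w : V} (hu : u ∈ O) (hw : w ∈ O) :
    u = w ∨ (o u < o w ∧ z u < o w) ∨ (o w < o u ∧ z w < o u) := by
  by_cases h : u = w
  · exact Or.inl h
  · have h1 := H.lt u hu
    have h2 := H.lt w hw
    rcases H.sep u hu w hw h with h3 | h3
    · exact Or.inr (Or.inl ⟨by linarith, h3⟩)
    · exact Or.inr (Or.inr ⟨by linarith, h3⟩)

theorem comp_subset {v : V} (hv : v ∈ D) : compOf E D v ⊆ D := by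
  intro w hw
  have hw : ReachIn E D v w := hw
  induction hw with
  | refl => exact hv
  | tail _ h _ => exact h.2.2

theorem self_mem_comp (v : V) : v ∈ compOf E D v := Relation.ReflTransGen.refl

theorem comp_eq (H : PlanarDisc G D O E o z K) {v w : V} (h : w ∈ compOf E D v) :
    compOf E D w = compOf E D v := by
  ext x
  exact ⟨fun h1 => Relation.ReflTransGen.trans h h1,
    fun h1 => Relation.ReflTransGen.trans (ReachIn.symm H.symm h) h1⟩

theorem comp_eq_or_disjoint (H : PlanarDisc G D O E o z K) (v w : V) :
    compOf E D v = compOf E D w ∨ Disjoint (compOf E D v) (compOf E D w) := by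
  by_cases h : ∃ x, x ∈ compOf E D v ∧ x ∈ compOf E D w
  · obtain ⟨x, h1, h2⟩ := h
    exact Or.inl ((H.comp_eq h1).symm.trans (H.comp_eq h2))
  · exact Or.inr (Set.disjoint_left.2 fun x h1 h2 => h ⟨x, h1, h2⟩)

theorem reach_comp (H : PlanarDisc G D O E o z K) {v x y : V} (hx : x ∈ compOf E D v)
    (hy : y ∈ compOf E D v) : ReachIn E (compOf E D v) x y := by
  have h : ReachIn E D x y := Relation.ReflTransGen.trans (ReachIn.symm H.symm hx) hy
  clear hy
  induction h with
  | refl => exact Relation.ReflTransGen.refl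
  | @tail c d h1 h2 ih =>
    have h3 : c ∈ compOf E D v := Relation.ReflTransGen.trans hx h1
    exact ih.tail ⟨h2.1, h3, Relation.ReflTransGen.tail h3 h2⟩

theorem link (H : PlanarDisc G D O E o z K) {v a b : V}
    (ha : a ∈ touch E O (compOf E D v)) (hb : b ∈ touch E O (compOf E D v)) :
    ReachIn E (compOf E D v ∪ {a, b}) a b := by
  obtain ⟨-, x, hx, hax⟩ := ha
  obtain ⟨-, y, hy, hby⟩ := hb
  refine Relation.ReflTransGen.head ⟨hax, by simp, Or.inl hx⟩ ?_
  refine Relation.ReflTransGen.tail ?_ ⟨H.symm _ _ hby, Or.inl hy, by simp⟩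
  exact (H.reach_comp hx hy).mono (fun _ _ h _ _ => h) Set.subset_union_left

theorem cross (H : PlanarDisc G D O E o z K) {X X' : Set V} (hX : X ⊆ D) (hX' : X' ⊆ D)
    (hd : Disjoint X X') {a a' b b' : V} (ha : a ∈ O) (ha' : a' ∈ O) (hb : b ∈ O) (hb' : b' ∈ O)
    (h1 : o a < o a') (h2 : o a' < o b) (h3 : o b < o b') (hab : ReachIn E (X ∪ {a, b}) a b)
    (hab' : ReachIn E (X' ∪ {a', b'}) a' b') : False := by
  refine H.order.no_cross H.symm H.disjoint H.irrefl ?_ ha ha' hb hb' h1 h2 h3 hab hab'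
  have n1 : a ≠ a' := by rintro rfl; linarith
  have n2 : a ≠ b' := by rintro rfl; linarith
  have n3 : b ≠ a' := by rintro rfl; linarith
  have n4 : b ≠ b' := by rintro rfl; linarith
  rw [Set.disjoint_left]
  rintro x (hx | rfl | rfl) (hx' | rfl | rfl)
  · exact Set.disjoint_left.1 hd hx hx'
  · exact H.not_mem (hX hx) ha'
  · exact H.not_mem (hX hx) hb'
  · exact H.not_mem (hX' hx') ha
  · exact n1 rfl
  · exact n2 rfl
  · exact H.not_mem (hX' hx') hb
  · exact n3 rfl
  · exact n4 rfl

/-- Two components cannot both reach around the same owner. -/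
theorem not_both_around (H : PlanarDisc G D O E o z K) {v w : V} (hv : v ∈ D) (hw : w ∈ D)
    (hd : Disjoint (compOf E D v) (compOf E D w)) {u x y x' y' : V}
    (hu : u ∈ touch E O (compOf E D v)) (hu' : u ∈ touch E O (compOf E D w))
    (hx : x ∈ touch E O (compOf E D v)) (hx' : x' ∈ touch E O (compOf E D w))
    (hy : y ∈ touch E O (compOf E D v)) (hy' : y' ∈ touch E O (compOf E D w))
    (hxu : o x < o u) (hxu' : o x' < o u) (huy : o u < o y) (huy' : o u < o y') : False := by
  have hX : compOf E D v ⊆ D := comp_subset hv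
  have hX' : compOf E D w ⊆ D := comp_subset hw
  rcases H.eq_or_lt hx.1 hx'.1 with rfl | h1 | h1
  · rcases H.eq_or_lt hy.1 hy'.1 with rfl | h2 | h2
    · obtain ⟨hxO, p1, m1, e1⟩ := hx
      obtain ⟨huO, p2, m2, e2⟩ := hu
      obtain ⟨hyO, p3, m3, e3⟩ := hy
      obtain ⟨-, q1, n1, f1⟩ := hx'
      obtain ⟨-, q2, n2, f2⟩ := hu'
      obtain ⟨-, q3, n3, f3⟩ := hy'
      exact H.order.no_double_tripod H.symm H.disjoint H.irrefl hX hX' hd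
        (fun x hx y hy => H.reach_comp hx hy) (fun x hx y hy => H.reach_comp hx hy) hxO huO hyO hxu
        huy m1 m2 m3 n1 n2 n3 e1 e2 e3 f1 f2 f3
    · exact H.cross hX hX' hd hx.1 hu.1 hy.1 hy'.1 hxu huy h2.1 (H.link hx hy) (H.link hu' hy')
    · exact H.cross hX' hX hd.symm hx.1 hu.1 hy'.1 hy.1 hxu huy' h2.1 (H.link hx' hy')
        (H.link hu hy)
  · exact H.cross hX hX' hd hx.1 hx'.1 hu.1 hy'.1 h1.1 hxu' huy' (H.link hx hu) (H.link hx' hy')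
  · exact H.cross hX' hX hd.symm hx'.1 hx.1 hu.1 hy.1 h1.1 hxu huy (H.link hx' hu') (H.link hx hy)

/-- The chords around the wide components: real edges that avoid the narrow components, and one
virtual edge for every narrow component. -/
def chords (E : V → V → Prop) (D O S : Set V) (v w : V) : Prop :=
  (E v w ∧ v ∈ S ∪ O ∧ w ∈ S ∪ O) ∨ ∃ x ∈ D, touch E O (compOf E D x) = {v, w} ∧ v ≠ w

/-- The edge `i j` runs from the owner `a` to the owner `b` through `X`. -/
def Runs (G : SimpleGraph V) (E : V → V → Prop) (D O : Set V) (o z : V → ℝ) (i j a b : V)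
    (X : Set V) : Prop :=
  a ∈ O ∧ b ∈ O ∧ (i = a ∨ (i ∈ X ∧ o a < o i ∧ z i < z a)) ∧
    (j = b ∨ (j ∈ X ∧ o b < o j ∧ z j < z b)) ∧
    ((X = ∅ ∧ ReachIn E (∅ ∪ {a, b}) a b) ∨
      ∃ x ∈ D, X = compOf E D x ∧ a ∈ touch E O X ∧ b ∈ touch E O X ∧
        ((Spread E O o X ∧ piece G X (touch E O X) i j) ∨
          (i = a ∧ j = b ∧ touch E O X = {a, b})))

end PlanarDisc

namespace PlanarDisc

variable {V : Type} [Fintype V] {G : SimpleGraph V} {D O : Set V} {E : V → V → Prop}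
  {o z : V → ℝ} {K : V → V → ℝ} {par : V → V}

theorem not_spread_of_pair {X : Set V} {a b : V} (h : touch E O X = {a, b}) :
    ¬ Spread E O o X := by
  rintro ⟨x, hx, y, hy, w, hw, h1, h2⟩
  rw [h] at hx hy hw
  rcases hx with rfl | rfl <;> rcases hy with rfl | rfl <;> rcases hw with rfl | rfl <;> linarith

/-- The wide components are filled by `par`, `o` and `z`, using only middle owners. -/
structure WideFill (G : SimpleGraph V) (D O : Set V) (E : V → V → Prop) (par : V → V)
    (o z : V → ℝ) : Prop where
  contour : ∀ v ∈ D, Spread E O o (compOf E D v) →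
    ForestContour G (compOf E D v) (touch E O (compOf E D v))
      (piece G (compOf E D v) (touch E O (compOf E D v))) par o z
  middle : ∀ v ∈ D, Spread E O o (compOf E D v) → ∀ x ∈ compOf E D v, ∀ u ∈ O, o u < o x →
    z x < z u → (∃ y ∈ touch E O (compOf E D v), o y < o u) ∧
      ∃ y ∈ touch E O (compOf E D v), o u < o y

theorem Runs.left {i j a b : V} {X : Set V} (h : Runs G E D O o z i j a b X) :
    i = a ∨ (∃ x ∈ D, X = compOf E D x ∧ Spread E O o X ∧ i ∈ X ∧ o a < o i ∧ z i < z a ∧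
      a ∈ touch E O X ∧ b ∈ touch E O X) := by
  obtain ⟨-, -, h1, -, h2⟩ := h
  rcases h1 with h1 | h1
  · exact Or.inl h1
  · rcases h2 with h2 | ⟨x, hx, h3, h4, h5, h6⟩
    · rw [h2.1] at h1
      exact absurd h1.1 (Set.notMem_empty _)
    · rcases h6 with h6 | h6
      · exact Or.inr ⟨x, hx, h3, h6.1, h1.1, h1.2.1, h1.2.2, h4, h5⟩
      · exact Or.inl h6.1

theorem Runs.right {i j a b : V} {X : Set V} (h : Runs G E D O o z i j a b X) :
    j = b ∨ (∃ x ∈ D, X = compOf E D x ∧ Spread E O o X ∧ j ∈ X ∧ o b < o j ∧ z j < z b ∧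
      a ∈ touch E O X ∧ b ∈ touch E O X) := by
  obtain ⟨-, -, -, h1, h2⟩ := h
  rcases h1 with h1 | h1
  · exact Or.inl h1
  · rcases h2 with h2 | ⟨x, hx, h3, h4, h5, h6⟩
    · rw [h2.1] at h1
      exact absurd h1.1 (Set.notMem_empty _)
    · rcases h6 with h6 | h6
      · exact Or.inr ⟨x, hx, h3, h6.1, h1.1, h1.2.1, h1.2.2, h4, h5⟩
      · exact Or.inl h6.2.1

theorem Runs.subset {i j a b : V} {X : Set V} (h : Runs G E D O o z i j a b X) : X ⊆ D := by
  rcases h.2.2.2.2 with h2 | ⟨x, hx, h3, -⟩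
  · rw [h2.1]; exact Set.empty_subset _
  · rw [h3]; exact comp_subset hx

theorem Runs.link (H : PlanarDisc G D O E o z K) {i j a b : V} {X : Set V}
    (h : Runs G E D O o z i j a b X) : ReachIn E (X ∪ {a, b}) a b := by
  rcases h.2.2.2.2 with h2 | ⟨x, hx, h3, h4, h5, -⟩
  · rw [h2.1]; exact h2.2
  · subst h3
    exact H.link h4 h5

theorem Runs.nc (H : PlanarDisc G D O E o z K) (W : WideFill G D O E par o z)
    {i j a b i' j' a' b' : V} {X X' : Set V} (h : Runs G E D O o z i j a b X)
    (h' : Runs G E D O o z i' j' a' b' X') (h1 : z i < z i') (h2 : z i' < o j)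
    (h3 : o j < o j') : False := by
  have bound : ∀ (i a b : V) (X : Set V), a ∈ O → (i = a ∨ (∃ x ∈ D, X = compOf E D x ∧
      Spread E O o X ∧ i ∈ X ∧ o a < o i ∧ z i < z a ∧ a ∈ touch E O X ∧ b ∈ touch E O X)) →
      o a ≤ o i ∧ z i ≤ z a ∧ o i < z i := by
    rintro i a b X ha (rfl | ⟨x, hx, rfl, h4, h5, h6, h7, -⟩)
    · exact ⟨le_rfl, le_rfl, H.lt _ ha⟩
    · exact ⟨h6.le, h7.le, (W.contour x hx h4).lt i (Or.inl h5)⟩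
  have haO := h.1
  have hbO := h.2.1
  have haO' := h'.1
  have hbO' := h'.2.1
  obtain ⟨a1, a2, a3⟩ := bound i a b X h.1 h.left
  obtain ⟨b1, b2, b3⟩ := bound j b b X h.2.1 (h.right.imp id
    fun ⟨x, e1, e2, e3, e4, e5, e6, e7, e8⟩ => ⟨x, e1, e2, e3, e4, e5, e6, e8, e8⟩)
  obtain ⟨c1, c2, c3⟩ := bound i' a' b' X' h'.1 h'.left
  obtain ⟨d1, d2, d3⟩ := bound j' b' b' X' h'.2.1 (h'.right.imp id
    fun ⟨x, e1, e2, e3, e4, e5, e6, e7, e8⟩ => ⟨x, e1, e2, e3, e4, e5, e6, e8, e8⟩)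
  have hd : Disjoint X X' ∨ ∃ x ∈ D, X = compOf E D x ∧ X' = X := by
    rcases h.2.2.2.2 with h4 | ⟨x, hx, h4, -⟩
    · rw [h4.1]; exact Or.inl (Set.empty_disjoint _)
    · rcases h'.2.2.2.2 with h5 | ⟨y, hy, h5, -⟩
      · rw [h5.1]; exact Or.inl (Set.disjoint_empty _)
      · rcases H.comp_eq_or_disjoint x y with h6 | h6
        · exact Or.inr ⟨x, hx, h4, by rw [h4, h5, h6]⟩
        · exact Or.inl (by rwa [h4, h5])
  rcases hd with hd | ⟨x, hx, rfl, rfl⟩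
  swap
  · have hself := self_mem_comp (E := E) (D := D) x
    rcases h.2.2.2.2 with h4 | ⟨y, -, -, m1, m2, h5⟩
    · rw [h4.1] at hself
      exact Set.notMem_empty _ hself
    rcases h'.2.2.2.2 with h4 | ⟨y', -, -, m1', m2', h6⟩
    · rw [h4.1] at hself
      exact Set.notMem_empty _ hself
    rcases h5 with h5 | ⟨rfl, rfl, h5⟩
    · rcases h6 with h6 | h6
      · exact (W.contour x hx h5.1).nc i j i' j' h5.2 h6.2 h1 h2 h3
      · exact not_spread_of_pair h6.2.2 h5.1
    · rcases h6 with h6 | ⟨rfl, rfl, h6⟩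
      · exact not_spread_of_pair h5 h6.1
      · rw [h5] at m1'
        rcases m1' with rfl | rfl
        · exact lt_irrefl _ h1
        · linarith
  have hXD := h.subset
  have hXD' := h'.subset
  have l := h.link H
  have l' := h'.link H
  rcases H.eq_or_lt haO haO' with rfl | haa | haa
  · rcases h.left with rfl | ⟨x, hx, rfl, hsp, hiX, hi1, hi2, hat, hbt⟩
    · linarith
    obtain ⟨⟨p, hp, hp1⟩, q, hq, hq1⟩ := W.middle x hx hsp i hiX a haO hi1 hi2
    rcases h'.left with rfl | ⟨x', hx', rfl, hsp', hiX', hi1', hi2', hat', hbt'⟩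
    · rcases H.eq_or_lt haO hbO with rfl | hab | hab
      · linarith
      · rcases H.eq_or_lt hbO hbO' with rfl | hbb | hbb
        · rcases h'.right with rfl | ⟨x', hx', rfl, hsp', hjX', hj1', hj2', hat', hbt'⟩
          · linarith
          obtain ⟨-, y, hy, hy1⟩ := W.middle x' hx' hsp' j' hjX' b hbO hj1' hj2'
          exact H.cross hXD hXD' hd hp.1 haO hbO hy.1 hp1 hab.1 hy1 (H.link hp hbt)
            (H.link hat' hy)
        · exact H.cross hXD hXD' hd hp.1 haO hbO hbO' hp1 hab.1 hbb.1 (H.link hp hbt) l'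
        · linarith
      · linarith
    · obtain ⟨⟨p', hp', hp1'⟩, q', hq', hq1'⟩ := W.middle x' hx' hsp' i' hiX' a haO hi1' hi2'
      exact H.not_both_around hx hx' hd hat hat' hp hp' hq hq' hp1 hp1' hq1 hq1'
  · rcases H.eq_or_lt haO' hbO with rfl | hab | hab
    · rcases h'.left with rfl | ⟨x', hx', rfl, hsp', hiX', hi1', hi2', hat', hbt'⟩
      · linarith
      rcases h.right with rfl | ⟨x, hx, rfl, hsp, hjX, hj1, hj2, hat, hbt⟩
      · linarith
      obtain ⟨⟨p, hp, hp1⟩, q, hq, hq1⟩ := W.middle x hx hsp j hjX _ hbO hj1 hj2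
      obtain ⟨⟨p', hp', hp1'⟩, q', hq', hq1'⟩ := W.middle x' hx' hsp' i' hiX' _ haO' hi1' hi2'
      exact H.not_both_around hx hx' hd hbt hat' hp hp' hq hq' hp1 hp1' hq1 hq1'
    · rcases H.eq_or_lt hbO hbO' with rfl | hbb | hbb
      · rcases h'.right with rfl | ⟨x', hx', rfl, hsp', hjX', hj1', hj2', hat', hbt'⟩
        · linarith
        obtain ⟨-, y, hy, hy1⟩ := W.middle x' hx' hsp' j' hjX' b hbO hj1' hj2'
        exact H.cross hXD hXD' hd haO haO' hbO hy.1 haa.1 hab.1 hy1 l (H.link hat' hy)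
      · exact H.cross hXD hXD' hd haO haO' hbO hbO' haa.1 hab.1 hbb.1 l l'
      · linarith
    · linarith
  · linarith

theorem exists_runs (H : PlanarDisc G D O E o z K) (W : WideFill G D O E par o z) {i j : V}
    (h : chords E D O {v | v ∈ D ∧ Spread E O o (compOf E D v)} i j) :
    ∃ a b X, Runs G E D O o z i j a b X := by
  have hin : ∀ i j, E i j → i ∈ D → Spread E O o (compOf E D i) →
      (j ∈ {v | v ∈ D ∧ Spread E O o (compOf E D v)} ∪ O) →
      ∃ a b X, Runs G E D O o z i j a b X := by
    intro i j hij hi hs hj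
    have C := W.contour i hi hs
    obtain ⟨a, ha, ha1⟩ := C.root i (self_mem_comp i)
    rcases hj with hj | hj
    · have hji : j ∈ compOf E D i := Relation.ReflTransGen.single ⟨hij, hi, hj.1⟩
      obtain ⟨b, hb, hb1⟩ := C.root j hji
      exact ⟨a, b, compOf E D i, ha.1, hb.1, Or.inr ⟨self_mem_comp i, ha1⟩, Or.inr ⟨hji, hb1⟩,
        Or.inr ⟨i, hi, rfl, ha, hb, Or.inl ⟨hs, H.adj _ _ hij, Or.inl (self_mem_comp i),
          Or.inl hji, Or.inl (self_mem_comp i)⟩⟩⟩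
    · have hb : j ∈ touch E O (compOf E D i) := ⟨hj, i, self_mem_comp i, H.symm _ _ hij⟩
      exact ⟨a, j, compOf E D i, ha.1, hj, Or.inr ⟨self_mem_comp i, ha1⟩, Or.inl rfl,
        Or.inr ⟨i, hi, rfl, ha, hb, Or.inl ⟨hs, H.adj _ _ hij, Or.inl (self_mem_comp i),
          Or.inr hb, Or.inl (self_mem_comp i)⟩⟩⟩
  have hsw : ∀ i j a b X, Runs G E D O o z i j a b X → Spread E O o X →
      Runs G E D O o z j i b a X := by
    rintro i j a b X ⟨h1, h2, h3, h4, h5⟩ hs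
    refine ⟨h2, h1, h4, h3, ?_⟩
    rcases h5 with h5 | ⟨x, hx, h6, h7, h8, h9⟩
    · refine Or.inl ⟨h5.1, ?_⟩
      rw [Set.pair_comm]
      exact ReachIn.symm H.symm h5.2
    · refine Or.inr ⟨x, hx, h6, h8, h7, ?_⟩
      rcases h9 with h9 | h9
      · exact Or.inl ⟨h9.1, piece_symm h9.2⟩
      · exact Or.inr ⟨h9.2.1, h9.1, by rw [Set.pair_comm]; exact h9.2.2⟩
  rcases h with ⟨h1, hi, hj⟩ | ⟨x, hx, h1, h2⟩
  · rcases hi with hi | hi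
    · exact hin i j h1 hi.1 hi.2 hj
    · rcases hj with hj | hj
      · obtain ⟨a, b, X, hr⟩ := hin j i (H.symm _ _ h1) hj.1 hj.2 (Or.inr hi)
        obtain ⟨m1, m2, m3, m4, m5⟩ := hr
        refine ⟨b, a, X, m2, m1, m4, m3, ?_⟩
        rcases m5 with h5 | ⟨x, hx, h6, h7, h8, h9⟩
        · refine Or.inl ⟨h5.1, ?_⟩
          rw [Set.pair_comm]
          exact ReachIn.symm H.symm h5.2
        · refine Or.inr ⟨x, hx, h6, h8, h7, ?_⟩
          rcases h9 with h9 | h9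
          · exact Or.inl ⟨h9.1, piece_symm h9.2⟩
          · exact Or.inr ⟨h9.2.1, h9.1, by rw [Set.pair_comm]; exact h9.2.2⟩
      · exact ⟨i, j, ∅, hi, hj, Or.inl rfl, Or.inl rfl, Or.inl ⟨rfl,
          Relation.ReflTransGen.single ⟨h1, by simp, by simp⟩⟩⟩
  · have hi : i ∈ touch E O (compOf E D x) := by rw [h1]; simp
    have hj : j ∈ touch E O (compOf E D x) := by rw [h1]; simp
    exact ⟨i, j, compOf E D x, hi.1, hj.1, Or.inl rfl, Or.inl rfl,
      Or.inr ⟨x, hx, rfl, hi, hj, Or.inr ⟨rfl, rfl, h1⟩⟩⟩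

theorem WideFill.forestContour (H : PlanarDisc G D O E o z K) (W : WideFill G D O E par o z) :
    ForestContour G {v | v ∈ D ∧ Spread E O o (compOf E D v)} O
      (chords E D O {v | v ∈ D ∧ Spread E O o (compOf E D v)}) par o z := by
  have hC : ∀ v, v ∈ D → Spread E O o (compOf E D v) → ForestContour G (compOf E D v)
    (touch E O (compOf E D v)) (piece G (compOf E D v) (touch E O (compOf E D v))) par o z :=
    W.contour
  have hS : ∀ v ∈ D, Spread E O o (compOf E D v) → ∀ w ∈ compOf E D v,
      w ∈ {v | v ∈ D ∧ Spread E O o (compOf E D v)} := by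
    intro v hv hs w hw
    exact ⟨comp_subset hv hw, by rw [H.comp_eq hw]; exact hs⟩
  -- the relative position of a vertex and a vertex or owner outside its component
  have hrel : ∀ v ∈ D, Spread E O o (compOf E D v) →
      ∀ w ∈ {v | v ∈ D ∧ Spread E O o (compOf E D v)} ∪ O, w ∈ compOf E D v ∨
        z v < o w ∨ z w < o v ∨ (w ∈ touch E O (compOf E D v) ∧ o w < o v ∧ z v < z w) := by
    intro v hv hs w hw
    obtain ⟨u, hu, hu1, hu2⟩ := (hC v hv hs).root v (self_mem_comp v)
    rcases hw with ⟨hw, hs'⟩ | hw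
    · rcases H.comp_eq_or_disjoint v w with h1 | h1
      · exact Or.inl (h1 ▸ self_mem_comp w)
      · obtain ⟨u', hu', hu1', hu2'⟩ := (hC w hw hs').root w (self_mem_comp w)
        rcases H.eq_or_lt hu.1 hu'.1 with rfl | h2 | h2
        · obtain ⟨⟨p, hp, hp1⟩, q, hq, hq1⟩ := W.middle v hv hs v (self_mem_comp v) u hu.1 hu1 hu2
          obtain ⟨⟨p', hp', hp1'⟩, q', hq', hq1'⟩ :=
            W.middle w hw hs' w (self_mem_comp w) u hu.1 hu1' hu2'
          exact (H.not_both_around hv hw h1 hu hu' hp hp' hq hq' hp1 hp1' hq1 hq1').elim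
        · exact Or.inr (Or.inl (by linarith))
        · exact Or.inr (Or.inr (Or.inl (by linarith)))
    · rcases H.eq_or_lt hu.1 hw with rfl | h2 | h2
      · exact Or.inr (Or.inr (Or.inr ⟨hu, hu1, hu2⟩))
      · exact Or.inr (Or.inl (by linarith))
      · exact Or.inr (Or.inr (Or.inl (by linarith)))
  have hlt : ∀ v ∈ {v | v ∈ D ∧ Spread E O o (compOf E D v)} ∪ O, o v < z v := by
    rintro v (hv | hv)
    · exact (hC v hv.1 hv.2).lt v (Or.inl (self_mem_comp v))
    · exact H.lt v hv
  refine ⟨hlt, ?_, ?_, ?_, ?_, ?_, H.sep, ?_, ?_, ?_, ?_, ?_, ?_⟩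
  · rintro v ⟨hv, hs⟩
    rcases (hC v hv hs).par_mem v (self_mem_comp v) with h1 | h1
    · exact Or.inl (hS v hv hs _ h1)
    · exact Or.inr h1.1
  · exact fun v ⟨hv, hs⟩ => (hC v hv hs).adj v (self_mem_comp v)
  · exact fun v ⟨hv, hs⟩ => (hC v hv hs).par_o v (self_mem_comp v)
  · exact fun v ⟨hv, hs⟩ => (hC v hv hs).par_z v (self_mem_comp v)
  · rintro v ⟨hv, hs⟩
    obtain ⟨u, hu, h1⟩ := (hC v hv hs).root v (self_mem_comp v)
    exact ⟨u, hu.1, h1⟩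
  · rintro v ⟨hv, hs⟩ w hw hvw
    rcases hrel v hv hs w (Or.inl hw) with h1 | h1 | h1 | h1
    · exact (hC v hv hs).laminar v (self_mem_comp v) w h1 hvw
    · exact Or.inl h1
    · exact Or.inr (Or.inl h1)
    · exact Or.inr (Or.inr (Or.inr h1.2))
  · rintro v ⟨hv, hs⟩ w hw h1 h2
    have := hlt v (Or.inl ⟨hv, hs⟩)
    rcases hrel v hv hs w hw with h3 | h3 | h3 | h3
    · exact (hC v hv hs).least v (self_mem_comp v) w (Or.inl h3) h1 h2
    · linarith
    · linarith [hlt w hw]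
    · exact (hC v hv hs).least v (self_mem_comp v) w (Or.inr h3.1) h1 h2
  · rintro v w (h1 | ⟨x, hx, h1, -⟩)
    · exact h1.2.1
    · have : v ∈ touch E O (compOf E D x) := by rw [h1]; simp
      exact Or.inr this.1
  · rintro v w (h1 | ⟨x, hx, h1, h2⟩)
    · exact Or.inl ⟨H.symm _ _ h1.1, h1.2.2, h1.2.1⟩
    · exact Or.inr ⟨x, hx, by rw [h1, Set.pair_comm], h2.symm⟩
  · have key : ∀ v w, E v w → v ∈ D → Spread E O o (compOf E D v) →
        (w ∈ {v | v ∈ D ∧ Spread E O o (compOf E D v)} ∪ O) →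
        (v ∈ {v | v ∈ D ∧ Spread E O o (compOf E D v)} ∧ w = par v) ∨
        (w ∈ {v | v ∈ D ∧ Spread E O o (compOf E D v)} ∧ v = par w) ∨ z v < o w ∨ z w < o v := by
      intro v w hvw hv hs hw
      have hp : piece G (compOf E D v) (touch E O (compOf E D v)) v w := by
        refine ⟨H.adj _ _ hvw, Or.inl (self_mem_comp v), ?_, Or.inl (self_mem_comp v)⟩
        rcases hw with hw | hw
        · exact Or.inl (Relation.ReflTransGen.single ⟨hvw, hv, hw.1⟩)
        · exact Or.inr ⟨hw, v, self_mem_comp v, H.symm _ _ hvw⟩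
      rcases (hC v hv hs).edge v w hp with h1 | h1 | h1
      · exact Or.inl ⟨⟨hv, hs⟩, h1.2⟩
      · exact Or.inr (Or.inl ⟨hS v hv hs w h1.1, h1.2⟩)
      · exact Or.inr (Or.inr h1)
    rintro v w (⟨h1, h2, h3⟩ | ⟨x, hx, h1, h2⟩)
    · rcases h2 with h2 | h2
      · exact key v w h1 h2.1 h2.2 h3
      · rcases h3 with h3 | h3
        · have := key w v (H.symm _ _ h1) h3.1 h3.2 (Or.inr h2)
          tauto
        · exact Or.inr (Or.inr (H.sep v h2 w h3 (H.adj _ _ h1).ne))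
    · have hv : v ∈ touch E O (compOf E D x) := by rw [h1]; simp
      have hw : w ∈ touch E O (compOf E D x) := by rw [h1]; simp
      exact Or.inr (Or.inr (H.sep v hv.1 w hw.1 h2))
  · intro i j i' j' h1 h2
    obtain ⟨a, b, X, hr⟩ := H.exists_runs W h1
    obtain ⟨a', b', X', hr'⟩ := H.exists_runs W h2
    exact hr.nc H W hr'

end PlanarDisc

namespace PlanarDisc

variable {V : Type} [Fintype V] {G : SimpleGraph V} {D O : Set V} {E : V → V → Prop}
  {o z : V → ℝ} {K : V → V → ℝ}

theorem congr (H : PlanarDisc G D O E o z K) {o' z' : V → ℝ} (ho : ∀ u ∈ O, o' u = o u)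
    (hz : ∀ u ∈ O, z' u = z u) : PlanarDisc G D O E o' z' K where
  order := H.order.restrict (fun v w h => ⟨h, H.mem _ _ h⟩) H.disjoint subset_rfl
    (fun u hu w hw => by rw [ho u hu, ho w hw])
  symm := H.symm
  disjoint := H.disjoint
  adj := H.adj
  mem := H.mem
  of_adj := H.of_adj
  lt u hu := by rw [ho u hu, hz u hu]; exact H.lt u hu
  sep u hu w hw h := by rw [ho u hu, hz u hu, ho w hw, hz w hw]; exact H.sep u hu w hw h

theorem of_piece (H : PlanarDisc G D O E o z K) {X T : Set V} (hX : X ⊆ D) (hT : T ⊆ O) {x y : V}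
    (h : piece G X T x y) : E x y := by
  obtain ⟨h1, h2, h3, h4 | h4⟩ := h
  · exact H.of_adj x (hX h4) y (h3.imp (fun h => hX h) (fun h => hT h)) h1
  · exact H.symm _ _ (H.of_adj y (hX h4) x (h2.imp (fun h => hX h) (fun h => hT h)) h1.symm)

/-- A component with its own boundary vertices has a contour. -/
theorem exists_contour_comp (H : PlanarDisc G D O E o z K) {v : V} (hv : v ∈ D)
    (hF : Fillable G (compOf E D v) (touch E O (compOf E D v))) {c : V}
    (hc : c ∈ touch E O (compOf E D v)) {o₁ z₁ : V → ℝ}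
    (hlt : ∀ u ∈ touch E O (compOf E D v), o₁ u < z₁ u)
    (hsep : ∀ u ∈ touch E O (compOf E D v), ∀ w ∈ touch E O (compOf E D v), u ≠ w →
      z₁ u < o₁ w ∨ z₁ w < o₁ u)
    (ho : ∀ u ∈ touch E O (compOf E D v), ∀ w ∈ touch E O (compOf E D v),
      o₁ u < o₁ w ↔ o u < o w) :
    ∃ (par : V → V) (o' z' : V → ℝ),
      (∀ u ∈ touch E O (compOf E D v), o' u = o₁ u ∧ z' u = z₁ u) ∧
      ForestContour G (compOf E D v) (touch E O (compOf E D v))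
        (piece G (compOf E D v) (touch E O (compOf E D v))) par o' z' ∧
      ∀ u ∈ touch E O (compOf E D v), u ≠ c →
        ((∀ w ∈ touch E O (compOf E D v), w ≠ u → z₁ u < o₁ w) ∨
          (∀ w ∈ touch E O (compOf E D v), w ≠ u → z₁ w < o₁ u)) →
        ∀ x ∈ compOf E D v, ¬ (o' u < o' x ∧ z' x < z' u) := by
  have hX : compOf E D v ⊆ D := comp_subset hv
  have hT : touch E O (compOf E D v) ⊆ O := fun u hu => hu.1
  refine hF c o₁ z₁ K hc ?_ hlt hsep ?_
  · exact H.order.restrict (fun x y h => ⟨H.of_piece hX hT h, h.2.1⟩) H.disjoint hT ho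
  · intro w hw
    obtain ⟨-, h, hh, hch⟩ := hc
    exact ⟨h, hh, H.adj _ _ hch, (H.reach_comp hw hh).mono (fun _ _ h _ _ => H.adj _ _ h) subset_rfl⟩

theorem spread_congr {o' : V → ℝ} {X : Set V} (ho : ∀ u ∈ O, o' u = o u) :
    Spread E O o' X ↔ Spread E O o X := by
  unfold Spread
  constructor
  · rintro ⟨a, ha, b, hb, c, hc, h1, h2⟩
    rw [ho a ha.1, ho b hb.1] at h1
    rw [ho b hb.1, ho c hc.1] at h2
    exact ⟨a, ha, b, hb, c, hc, h1, h2⟩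
  · rintro ⟨a, ha, b, hb, c, hc, h1, h2⟩
    rw [← ho a ha.1, ← ho b hb.1] at h1
    rw [← ho b hb.1, ← ho c hc.1] at h2
    exact ⟨a, ha, b, hb, c, hc, h1, h2⟩

theorem exists_wideFill (H : PlanarDisc G D O E o z K)
    (hF : ∀ v ∈ D, Fillable G (compOf E D v) (touch E O (compOf E D v))) :
    ∃ (par : V → V) (o' z' : V → ℝ), (∀ u ∈ O, o' u = o u ∧ z' u = z u) ∧
      WideFill G D O E par o' z' := by
  have key : ∀ X : Set V, ∃ (p : V → V) (q r : V → ℝ), ∀ v ∈ D, X = compOf E D v →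
      Spread E O o X → (∀ u ∈ touch E O X, q u = o u ∧ r u = z u) ∧
        ForestContour G X (touch E O X) (piece G X (touch E O X)) p q r ∧
        ∀ x ∈ X, ∀ u ∈ O, o u < q x → r x < z u →
          (∃ y ∈ touch E O X, o y < o u) ∧ ∃ y ∈ touch E O X, o u < o y := by
    intro X
    by_cases hX : ∃ v ∈ D, X = compOf E D v ∧ Spread E O o X
    · obtain ⟨v, hv, rfl, a, ha, b, hb, c, hc, hab, hbc⟩ := hX
      obtain ⟨p, q, r, h1, h2, h3⟩ := H.exists_contour_comp hv (hF v hv) hb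
        (fun u hu => H.lt u hu.1) (fun u hu w hw => H.sep u hu.1 w hw.1)
        (fun u hu w hw => Iff.rfl)
      refine ⟨p, q, r, fun _ _ _ _ => ⟨h1, h2, fun x hx u hu hux hxu => ?_⟩⟩
      obtain ⟨u', hu', h4, h5⟩ := h2.root x hx
      obtain rfl : u = u' := by
        by_contra hne
        have h6 := h2.lt x (Or.inl hx)
        have h7 := h1 u' hu'
        rcases H.sep u hu u' hu'.1 hne with h | h <;> linarith
      by_cases hub : u = b
      · subst hub
        exact ⟨⟨a, ha, hab⟩, c, hc, hbc⟩
      · constructor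
        · by_contra! hno
          refine h3 u hu' hub (Or.inl fun w hw hwu => ?_) x hx ⟨h4, h5⟩
          rcases H.eq_or_lt hu hw.1 with h | h | h
          · exact absurd h.symm hwu
          · exact h.2
          · linarith [hno w hw]
        · by_contra! hno
          refine h3 u hu' hub (Or.inr fun w hw hwu => ?_) x hx ⟨h4, h5⟩
          rcases H.eq_or_lt hu hw.1 with h | h | h
          · exact absurd h.symm hwu
          · linarith [hno w hw]
          · exact h.2
    · exact ⟨id, o, z, fun v hv h1 h2 => absurd ⟨v, hv, h1, h2⟩ hX⟩
  choose p q r hk using key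
  classical
  let o' : V → ℝ := fun w => if w ∈ D then q (compOf E D w) w else o w
  let z' : V → ℝ := fun w => if w ∈ D then r (compOf E D w) w else z w
  have eO : ∀ u ∈ O, o' u = o u ∧ z' u = z u := fun u hu => by
    have : u ∉ D := fun h => H.not_mem h hu
    simp [o', z', this]
  have eD : ∀ v ∈ D, ∀ w ∈ compOf E D v, o' w = q (compOf E D v) w ∧ z' w = r (compOf E D v) w := by
    intro v hv w hw
    simp [o', z', comp_subset hv hw, H.comp_eq hw]
  refine ⟨fun w => p (compOf E D w) w, o', z', eO, ⟨fun v hv hs => ?_, fun v hv hs x hx u hu => ?_⟩⟩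
  · obtain ⟨h1, h2, -⟩ := hk _ v hv rfl ((spread_congr fun u hu => (eO u hu).1).1 hs)
    refine h2.congr (fun w hw => by rw [H.comp_eq hw]) ?_ ?_
    · rintro w (hw | hw)
      · exact (eD v hv w hw).1
      · rw [(h1 w hw).1, (eO w hw.1).1]
    · rintro w (hw | hw)
      · exact (eD v hv w hw).2
      · rw [(h1 w hw).2, (eO w hw.1).2]
  · obtain ⟨h1, -, h3⟩ := hk _ v hv rfl ((spread_congr fun u hu => (eO u hu).1).1 hs)
    rw [(eO u hu).1, (eO u hu).2, (eD v hv x hx).1, (eD v hv x hx).2]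
    intro ha hb
    obtain ⟨⟨y, hy, hyu⟩, y', hy', huy⟩ := h3 x hx u hu ha hb
    exact ⟨⟨y, hy, by rwa [(eO y hy.1).1]⟩, y', hy', by rwa [(eO y' hy'.1).1]⟩

end PlanarDisc

theorem exists_lt_of_forall_lt (s : Finset ℝ) {t : ℝ} (h : ∀ x ∈ s, x < t) :
    ∃ m < t, ∀ x ∈ s, x < m := by
  classical
  induction s using Finset.induction_on with
  | empty => exact ⟨t - 1, by linarith, by simp⟩
  | insert a s _ ih =>
    obtain ⟨m, h1, h2⟩ := ih (fun x hx => h x (Finset.mem_insert_of_mem hx))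
    have h3 := h a (Finset.mem_insert_self a s)
    refine ⟨max m ((a + t) / 2), max_lt h1 (by linarith), fun x hx => ?_⟩
    rcases Finset.mem_insert.1 hx with rfl | hx
    · exact lt_max_of_lt_right (by linarith)
    · exact lt_max_of_lt_left (h2 x hx)

theorem exists_gt_of_forall_gt (s : Finset ℝ) {t : ℝ} (h : ∀ x ∈ s, t < x) :
    ∃ m > t, ∀ x ∈ s, m < x := by
  classical
  obtain ⟨m, h1, h2⟩ := exists_lt_of_forall_lt (s.image Neg.neg) (t := -t) (by
    simp only [Finset.mem_image, forall_exists_index, and_imp, forall_apply_eq_imp_iff₂]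
    exact fun x hx => neg_lt_neg (h x hx))
  refine ⟨-m, by linarith, fun x hx => ?_⟩
  have := h2 (-x) (Finset.mem_image_of_mem _ hx)
  linarith

namespace PlanarDisc

variable {V : Type} [Fintype V] {G : SimpleGraph V} {D O : Set V} {E : V → V → Prop}
  {o z : V → ℝ} {K : V → V → ℝ} {par : V → V} {S F : Set V}

theorem touch_eq_pair (H : PlanarDisc G D O E o z K) {X : Set V} (hne : (touch E O X).Nonempty)
    (hs : ¬ Spread E O o X) : ∃ a b, touch E O X = {a, b} ∧ (a = b ∨ o a < o b) := by
  obtain ⟨a, ha, hmin⟩ := Set.exists_min_image (touch E O X) o (Set.toFinite _) hne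
  obtain ⟨b, hb, hmax⟩ := Set.exists_max_image (touch E O X) o (Set.toFinite _) hne
  refine ⟨a, b, Set.Subset.antisymm (fun u hu => ?_) ?_, ?_⟩
  · rcases H.eq_or_lt ha.1 hu.1 with h | h | h
    · exact Or.inl h.symm
    · rcases H.eq_or_lt hu.1 hb.1 with h' | h' | h'
      · exact Or.inr h'
      · exact absurd ⟨a, ha, u, hu, b, hb, h.1, h'.1⟩ hs
      · linarith [hmax u hu]
    · linarith [hmin u hu]
  · rintro u (rfl | rfl)
    · exact ha
    · exact hb
  · rcases H.eq_or_lt ha.1 hb.1 with h | h | h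
    · exact Or.inl h
    · exact Or.inr h.1
    · linarith [hmin b hb]

theorem chords_symm (H : PlanarDisc G D O E o z K) {v w : V} (h : chords E D O S v w) :
    chords E D O S w v := by
  rcases h with h | ⟨x, hx, h1, h2⟩
  · exact Or.inl ⟨H.symm _ _ h.1, h.2.2, h.2.1⟩
  · exact Or.inr ⟨x, hx, by rw [h1, Set.pair_comm], h2.symm⟩

theorem chords_union (H : PlanarDisc G D O E o z K) (hSD : S ⊆ D) {v : V} (hv : v ∈ D)
    {x y : V} (h : chords E D O (S ∪ compOf E D v) x y) :
    chords E D O S x y ∨ piece G (compOf E D v) (touch E O (compOf E D v)) x y := by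
  have key : ∀ x y, E x y → x ∈ compOf E D v → y ∈ (S ∪ compOf E D v) ∪ O →
      piece G (compOf E D v) (touch E O (compOf E D v)) x y := by
    intro x y hxy hx hy
    refine ⟨H.adj _ _ hxy, Or.inl hx, ?_, Or.inl hx⟩
    rcases hy with (hy | hy) | hy
    · exact Or.inl (Relation.ReflTransGen.tail hx ⟨hxy, comp_subset hv hx, hSD hy⟩)
    · exact Or.inl hy
    · exact Or.inr ⟨hy, x, hx, H.symm _ _ hxy⟩
  rcases h with ⟨h1, h2, h3⟩ | h
  · by_cases hx : x ∈ compOf E D v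
    · exact Or.inr (key x y h1 hx h3)
    · by_cases hy : y ∈ compOf E D v
      · exact Or.inr (piece_symm (key y x (H.symm _ _ h1) hy h2))
      · exact Or.inl (Or.inl ⟨h1, h2.imp (fun h => h.resolve_right hx) id,
          h3.imp (fun h => h.resolve_right hy) id⟩)
  · exact Or.inl (Or.inr h)

open Classical in
theorem insert_finish (H : PlanarDisc G D O E o z K) (hSD : S ⊆ D) {v : V} (hv : v ∈ D)
    (hFO : F ⊆ O)
    (hFe : ∀ u ∈ F, ∀ x ∈ S, ¬ (o u < o x ∧ z x < z u)) {par' : V → V} {o' z' : V → ℝ}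
    (h : ForestContour G (S ∪ compOf E D v) O (fun x y => chords E D O S x y ∨
      piece G (compOf E D v) (touch E O (compOf E D v)) x y)
      (fun x => if x ∈ compOf E D v then par' x else par x)
      (fun x => if x ∈ compOf E D v then o' x else o x)
      (fun x => if x ∈ compOf E D v then z' x else z x)) {a : V} (ha : a ∈ O) (haF : a ∉ F)
    (hA : ∀ x ∈ compOf E D v, o a < o' x ∧ z' x < z a) :
    ∃ (par' : V → V) (o' z' : V → ℝ), (∀ u ∈ O, o' u = o u ∧ z' u = z u) ∧
      ForestContour G (S ∪ compOf E D v) O (chords E D O (S ∪ compOf E D v)) par' o' z' ∧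
      ∀ u ∈ F, ∀ x ∈ S ∪ compOf E D v, ¬ (o' u < o' x ∧ z' x < z' u) := by
  have hO : ∀ u ∈ O, u ∉ compOf E D v := fun u hu h => H.not_mem (comp_subset hv h) hu
  refine ⟨_, _, _, ?_, h.mono (fun x y => H.chords_union hSD hv)
    (fun x y => H.chords_symm), ?_⟩
  · intro u hu
    simp [hO u hu]
  · intro u hu x hx
    simp only [hO u (hFO hu), if_false]
    by_cases hxA : x ∈ compOf E D v
    · simp only [hxA, if_true]
      rintro ⟨h1, h2⟩
      have h3 := hA x hxA
      have h4 := h.lt x (Or.inl hx)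
      simp only [hxA, if_true] at h4
      rcases H.sep u (hFO hu) a ha (fun e => haF (e ▸ hu)) with h5 | h5 <;> linarith
    · simp only [hxA, if_false]
      exact hFe u hu x (hx.resolve_right hxA)

theorem insert_right (H : PlanarDisc G D O E o z K)
    (h : ForestContour G S O (chords E D O S) par o z) (hSD : S ⊆ D) {v : V} (hv : v ∈ D)
    (hvS : Disjoint (compOf E D v) S) (hFO : F ⊆ O)
    (hFe : ∀ u ∈ F, ∀ x ∈ S, ¬ (o u < o x ∧ z x < z u))
    (hI : Fillable G (compOf E D v) (touch E O (compOf E D v))) {a b : V}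
    (hT : touch E O (compOf E D v) = {a, b}) (hab : a = b ∨ o a < o b) (haF : a ∉ F)
    (hj : a ≠ b → ∀ j, chords E D O S a j → ¬ o b < o j) :
    ∃ (par' : V → V) (o' z' : V → ℝ), (∀ u ∈ O, o' u = o u ∧ z' u = z u) ∧
      ForestContour G (S ∪ compOf E D v) O (chords E D O (S ∪ compOf E D v)) par' o' z' ∧
      ∀ u ∈ F, ∀ x ∈ S ∪ compOf E D v, ¬ (o' u < o' x ∧ z' x < z' u) := by
  classical
  have haT : a ∈ touch E O (compOf E D v) := by rw [hT]; simp
  have hbT : b ∈ touch E O (compOf E D v) := by rw [hT]; simp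
  have hcase : ∀ u ∈ touch E O (compOf E D v), u = a ∨ u = b := fun u hu => by
    rw [hT] at hu; exact hu
  have haO := haT.1
  have hbO := hbT.1
  obtain ⟨M, hM1, hM2⟩ := exists_lt_of_forall_lt
    (insert (o a) (({x | x ∈ S ∧ z x < z a} : Set V).toFinset.image z)) (t := z a) (by
      simp only [Finset.mem_insert, Finset.mem_image, Set.mem_toFinset, Set.mem_ofPred_eq]
      rintro x (rfl | ⟨y, hy, rfl⟩)
      · exact H.lt a haO
      · exact hy.2)
  have hMa : o a < M := hM2 _ (by simp)
  have hMS : ∀ x ∈ S, z x < z a → z x < M := fun x hx hxa => hM2 _ (by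
    simp only [Finset.mem_insert, Finset.mem_image, Set.mem_toFinset, Set.mem_ofPred_eq]
    exact Or.inr ⟨x, ⟨hx, hxa⟩, rfl⟩)
  have hzab : a ≠ b → z a < o b := fun hne => H.lt_of_lt haO hbO (hab.resolve_left hne)
  obtain ⟨par', o', z', h1, h2, h3⟩ := H.exists_contour_comp hv hI haT
    (o₁ := fun w => if w = a then M else o w) (z₁ := z) (fun u hu => by
      by_cases hua : u = a
      · simpa [hua] using hM1
      · simpa [hua] using H.lt u hu.1)
    (fun u hu w hw huw => by
      have hle : ∀ w, o w ≤ if w = a then M else o w := fun w => by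
        by_cases hwa : w = a
        · simpa [hwa] using hMa.le
        · simp [hwa]
      exact (H.sep u hu.1 w hw.1 huw).imp (fun h => h.trans_le (hle w)) (fun h => h.trans_le (hle u)))
    (fun u hu w hw => by
      by_cases hua : u = a <;> by_cases hwa : w = a
      · simp [hua, hwa]
      · obtain rfl := (hcase w hw).resolve_left hwa
        have := hzab (Ne.symm hwa)
        have := hab.resolve_left (Ne.symm hwa)
        simp only [hua, hwa, if_true, if_false]
        constructor <;> intro <;> linarith
      · obtain rfl := (hcase u hu).resolve_left hua
        have := hzab (Ne.symm hua)
        have := hab.resolve_left (Ne.symm hua)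
        simp only [hua, hwa, if_true, if_false]
        constructor <;> intro <;> linarith
      · simp [hua, hwa])
  have ea := h1 a haT
  simp only [if_true] at ea
  have hA : ∀ x ∈ compOf E D v, o' a < o' x ∧ z' x < z' a := by
    intro x hx
    obtain ⟨u, hu, h4⟩ := h2.root x hx
    rcases hcase u hu with rfl | rfl
    · exact h4
    · by_cases hua : u = a
      · exact hua ▸ h4
      · refine absurd h4 (h3 u hu hua (Or.inr fun w hw hwu => ?_) x hx)
        obtain rfl := (hcase w hw).resolve_right hwu
        simpa [hua] using hzab (Ne.symm hua)
  have key := h.insert_last h2 (a := a) (b := b) (fun x hx hx' => by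
      rcases hx' with hx' | hx'
      · exact Set.disjoint_left.1 hvS hx hx'
      · exact H.not_mem (comp_subset hv hx) hx') haO haT hcase (fun x y hxy => hxy.2.2.2) ea.2
    (by rw [ea.1]; exact hMa) (fun x hx _ hxa => by rw [ea.1]; exact hMS x hx hxa) hA
    (fun _ hne => by
      have eb := h1 b hbT
      simp only [hne, if_false] at eb
      exact ⟨hbO, hzab hne.symm, Or.inr ⟨v, hv, hT, hne.symm⟩, eb.1, eb.2, hj hne.symm⟩)
  exact H.insert_finish hSD hv hFO hFe key haO haF
    (fun x hx => ⟨hMa.trans (by rw [← ea.1]; exact (hA x hx).1), by rw [← ea.2]; exact (hA x hx).2⟩)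

theorem insert_left (H : PlanarDisc G D O E o z K)
    (h : ForestContour G S O (chords E D O S) par o z) (hSD : S ⊆ D) {v : V} (hv : v ∈ D)
    (hvS : Disjoint (compOf E D v) S) (hFO : F ⊆ O)
    (hFe : ∀ u ∈ F, ∀ x ∈ S, ¬ (o u < o x ∧ z x < z u))
    (hI : Fillable G (compOf E D v) (touch E O (compOf E D v))) {a b : V}
    (hT : touch E O (compOf E D v) = {a, b}) (hab : o b < o a) (haF : a ∉ F)
    (hj : ∀ j, chords E D O S a j → ¬ z j < z b) :
    ∃ (par' : V → V) (o' z' : V → ℝ), (∀ u ∈ O, o' u = o u ∧ z' u = z u) ∧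
      ForestContour G (S ∪ compOf E D v) O (chords E D O (S ∪ compOf E D v)) par' o' z' ∧
      ∀ u ∈ F, ∀ x ∈ S ∪ compOf E D v, ¬ (o' u < o' x ∧ z' x < z' u) := by
  classical
  have haT : a ∈ touch E O (compOf E D v) := by rw [hT]; simp
  have hbT : b ∈ touch E O (compOf E D v) := by rw [hT]; simp
  have hcase : ∀ u ∈ touch E O (compOf E D v), u = a ∨ u = b := fun u hu => by
    rw [hT] at hu; exact hu
  have haO := haT.1
  have hbO := hbT.1
  have hba : b ≠ a := by rintro rfl; exact lt_irrefl _ hab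
  obtain ⟨M, hM1, hM2⟩ := exists_gt_of_forall_gt
    (insert (z a) (({x | x ∈ S ∧ o a < o x} : Set V).toFinset.image o)) (t := o a) (by
      simp only [Finset.mem_insert, Finset.mem_image, Set.mem_toFinset, Set.mem_ofPred_eq]
      rintro x (rfl | ⟨y, hy, rfl⟩)
      · exact H.lt a haO
      · exact hy.2)
  have hMa : M < z a := hM2 _ (by simp)
  have hMS : ∀ x ∈ S, o a < o x → M < o x := fun x hx hxa => hM2 _ (by
    simp only [Finset.mem_insert, Finset.mem_image, Set.mem_toFinset, Set.mem_ofPred_eq]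
    exact Or.inr ⟨x, ⟨hx, hxa⟩, rfl⟩)
  have hzab : z b < o a := H.lt_of_lt hbO haO hab
  obtain ⟨par', o', z', h1, h2, h3⟩ := H.exists_contour_comp hv hI haT
    (o₁ := o) (z₁ := fun w => if w = a then M else z w) (fun u hu => by
      by_cases hua : u = a
      · simpa [hua] using hM1
      · simpa [hua] using H.lt u hu.1)
    (fun u hu w hw huw => by
      have hle : ∀ w, (if w = a then M else z w) ≤ z w := fun w => by
        by_cases hwa : w = a
        · simpa [hwa] using hMa.le
        · simp [hwa]
      exact (H.sep u hu.1 w hw.1 huw).imp (fun h => (hle u).trans_lt h) (fun h => (hle w).trans_lt h))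
    (fun u hu w hw => Iff.rfl)
  have ea := h1 a haT
  simp only [if_true] at ea
  have hA : ∀ x ∈ compOf E D v, o' a < o' x ∧ z' x < z' a := by
    intro x hx
    obtain ⟨u, hu, h4⟩ := h2.root x hx
    rcases hcase u hu with rfl | rfl
    · exact h4
    · refine absurd h4 (h3 u hu hba (Or.inl fun w hw hwu => ?_) x hx)
      obtain rfl := (hcase w hw).resolve_right hwu
      simpa [hba] using hzab
  have key := h.insert_first h2 (a := a) (b := b) (fun x hx hx' => by
      rcases hx' with hx' | hx'
      · exact Set.disjoint_left.1 hvS hx hx'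
      · exact H.not_mem (comp_subset hv hx) hx') haO haT hcase (fun x y hxy => hxy.2.2.2) ea.1
    (by rw [ea.2]; exact hMa) (fun x hx hxa _ => by rw [ea.2]; exact hMS x hx hxa) hA
    (fun _ _ => by
      have eb := h1 b hbT
      simp only [hba, if_false] at eb
      exact ⟨hbO, hzab, Or.inr ⟨v, hv, hT, hba.symm⟩, eb.1, eb.2, hj⟩)
  exact H.insert_finish hSD hv hFO hFe key haO haF
    (fun x hx => ⟨by rw [← ea.1]; exact (hA x hx).1,
      lt_trans (by rw [← ea.2]; exact (hA x hx).2) hMa⟩)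

theorem insert_comp (H : PlanarDisc G D O E o z K)
    (h : ForestContour G S O (chords E D O S) par o z) (hSD : S ⊆ D) {v : V} (hv : v ∈ D)
    (hvS : Disjoint (compOf E D v) S) (hFO : F ⊆ O)
    (hFend : ∀ u ∈ F, (∀ w ∈ O, w ≠ u → z u < o w) ∨ (∀ w ∈ O, w ≠ u → z w < o u))
    (hFe : ∀ u ∈ F, ∀ x ∈ S, ¬ (o u < o x ∧ z x < z u))
    (hI : Fillable G (compOf E D v) (touch E O (compOf E D v)))
    (hne : ¬ touch E O (compOf E D v) ⊆ F) (hs : ¬ Spread E O o (compOf E D v)) :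
    ∃ (par' : V → V) (o' z' : V → ℝ), (∀ u ∈ O, o' u = o u ∧ z' u = z u) ∧
      ForestContour G (S ∪ compOf E D v) O (chords E D O (S ∪ compOf E D v)) par' o' z' ∧
      ∀ u ∈ F, ∀ x ∈ S ∪ compOf E D v, ¬ (o' u < o' x ∧ z' x < z' u) := by
  obtain ⟨a, b, hT, hab⟩ := H.touch_eq_pair (Set.nonempty_of_not_subset hne |>.mono
    Set.sdiff_subset) hs
  have haO : a ∈ O := (show a ∈ touch E O (compOf E D v) by rw [hT]; simp).1
  have hbO : b ∈ O := (show b ∈ touch E O (compOf E D v) by rw [hT]; simp).1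
  have hor : a ∉ F ∨ b ∉ F := by
    by_contra! hF
    refine hne (hT ▸ ?_)
    rintro u (rfl | rfl)
    · exact hF.1
    · exact hF.2
  rcases hab with rfl | hab
  · exact H.insert_right h hSD hv hvS hFO hFe hI hT (Or.inl rfl) (by simpa using hor)
      (fun hne => absurd rfl hne)
  have hne' : a ≠ b := by rintro rfl; exact lt_irrefl _ hab
  have hzab := H.lt_of_lt haO hbO hab
  have hT' : touch E O (compOf E D v) = {b, a} := by rw [hT, Set.pair_comm]
  by_cases haF : a ∈ F
  · refine H.insert_left h hSD hv hvS hFO hFe hI hT' hab (hor.resolve_left (not_not.2 haF))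
      (fun j hj hja => ?_)
    have hfirst : ∀ w ∈ O, w ≠ a → z a < o w := by
      refine (hFend a haF).resolve_right (fun hl => ?_)
      have := hl b hbO hne'.symm
      linarith [H.lt a haO, H.lt b hbO]
    have hjS := h.mem _ _ (H.chords_symm hj)
    rcases hjS with hjS | hjO
    · obtain ⟨u, hu, h1, h2⟩ := h.root j hjS
      by_cases hua : u = a
      · subst hua
        exact hFe u haF j hjS ⟨h1, h2⟩
      · linarith [hfirst u hu hua, h.lt j (Or.inl hjS)]
    · have hja' : j ≠ a := by rintro rfl; exact lt_irrefl _ hja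
      linarith [hfirst j hjO hja', H.lt j hjO]
  by_cases hbF : b ∈ F
  · refine H.insert_right h hSD hv hvS hFO hFe hI hT (Or.inr hab) haF (fun _ j hj hbj => ?_)
    have hlast : ∀ w ∈ O, w ≠ b → z w < o b := by
      refine (hFend b hbF).resolve_left (fun hl => ?_)
      have := hl a haO hne'
      linarith [H.lt a haO, H.lt b hbO]
    have hjS := h.mem _ _ (H.chords_symm hj)
    rcases hjS with hjS | hjO
    · obtain ⟨u, hu, h1, h2⟩ := h.root j hjS
      by_cases hua : u = b
      · subst hua
        exact hFe u hbF j hjS ⟨h1, h2⟩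
      · linarith [hlast u hu hua, h.lt j (Or.inl hjS)]
    · have hja' : j ≠ b := by rintro rfl; exact lt_irrefl _ hbj
      linarith [hlast j hjO hja', H.lt j hjO]
  by_cases hj : ∃ j, chords E D O S a j ∧ o b < o j
  · obtain ⟨j, hj1, hj2⟩ := hj
    exact H.insert_left h hSD hv hvS hFO hFe hI hT' hab hbF (fun i hi hia =>
      h.nc i b a j (H.chords_symm hi) hj1 hia hzab hj2)
  · push Not at hj
    exact H.insert_right h hSD hv hvS hFO hFe hI hT (Or.inr hab) haF
      (fun _ j h1 h2 => absurd h2 (not_lt.2 (hj j h1)))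

end PlanarDisc

namespace PlanarDisc

variable {V : Type} [Fintype V] {G : SimpleGraph V} {D O : Set V} {E : V → V → Prop}
  {o z : V → ℝ} {K : V → V → ℝ} {par : V → V} {F : Set V}

theorem WideFill.fill (H : PlanarDisc G D O E o z K) (W : WideFill G D O E par o z) (hFO : F ⊆ O)
    (hFend : ∀ u ∈ F, (∀ w ∈ O, w ≠ u → z u < o w) ∨ (∀ w ∈ O, w ≠ u → z w < o u))
    (hne : ∀ v ∈ D, ¬ touch E O (compOf E D v) ⊆ F)
    (hF : ∀ v ∈ D, Fillable G (compOf E D v) (touch E O (compOf E D v))) :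
    ∃ (par : V → V) (o' z' : V → ℝ), (∀ u ∈ O, o' u = o u ∧ z' u = z u) ∧
      ForestContour G D O E par o' z' ∧ ∀ u ∈ F, ∀ x ∈ D, ¬ (o' u < o' x ∧ z' x < z' u) := by
  classical
  have main : ∀ A : Finset V, ∃ (par : V → V) (o' z' : V → ℝ), (∀ u ∈ O, o' u = o u ∧ z' u = z u) ∧
      ForestContour G {w | w ∈ D ∧ (Spread E O o (compOf E D w) ∨ ∃ v ∈ A, w ∈ compOf E D v)} O
        (chords E D O {w | w ∈ D ∧ (Spread E O o (compOf E D w) ∨ ∃ v ∈ A, w ∈ compOf E D v)})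
        par o' z' ∧
      ∀ u ∈ F, ∀ x ∈ {w | w ∈ D ∧ (Spread E O o (compOf E D w) ∨ ∃ v ∈ A, w ∈ compOf E D v)},
        ¬ (o' u < o' x ∧ z' x < z' u) := by
    intro A
    induction A using Finset.induction_on with
    | empty =>
      refine ⟨par, o, z, fun u _ => ⟨rfl, rfl⟩, ?_, fun u hu x hx hux => ?_⟩
      · simpa using WideFill.forestContour H W
      · obtain ⟨⟨y, hy, h1⟩, y', hy', h2⟩ := W.middle x hx.1 (by simpa using hx.2) x
          (self_mem_comp x) u (hFO hu) hux.1 hux.2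
        have h3 := H.lt u (hFO hu)
        have h4 := H.lt y hy.1
        have h5 := H.lt y' hy'.1
        rcases hFend u hu with h | h
        · have := h y hy.1 (by rintro rfl; exact lt_irrefl _ h1)
          linarith
        · have := h y' hy'.1 (by rintro rfl; exact lt_irrefl _ h2)
          linarith
    | insert v A _ ih =>
      obtain ⟨p, o', z', h1, h2, h3⟩ := ih
      set S := {w | w ∈ D ∧ (Spread E O o (compOf E D w) ∨ ∃ v ∈ A, w ∈ compOf E D v)} with hS
      by_cases hv : v ∈ D ∧ v ∉ S
      · have hns : ¬ Spread E O o (compOf E D v) := fun h => hv.2 ⟨hv.1, Or.inl h⟩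
        have hdis : Disjoint (compOf E D v) S := by
          rw [Set.disjoint_left]
          rintro x hx ⟨hxD, hxs | ⟨y, hy, hxy⟩⟩
          · exact hns (H.comp_eq hx ▸ hxs)
          · refine hv.2 ⟨hv.1, Or.inr ⟨y, hy, ?_⟩⟩
            rw [← H.comp_eq hxy, H.comp_eq hx]
            exact self_mem_comp v
        have H' := H.congr (fun u hu => (h1 u hu).1) (fun u hu => (h1 u hu).2)
        obtain ⟨q, o'', z'', g1, g2, g3⟩ := H'.insert_comp h2 (fun x hx => hx.1) hv.1 hdis hFO
          (fun u hu => by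
            rw [(h1 u (hFO hu)).1, (h1 u (hFO hu)).2]
            refine (hFend u hu).imp (fun h w hw hwu => ?_) (fun h w hw hwu => ?_)
            · rw [(h1 w hw).1]; exact h w hw hwu
            · rw [(h1 w hw).2]; exact h w hw hwu) h3 (hF v hv.1) (hne v hv.1)
          (fun h => hns ((spread_congr fun u hu => (h1 u hu).1).1 h))
        have e : {w | w ∈ D ∧ (Spread E O o (compOf E D w) ∨ ∃ y ∈ insert v A, w ∈ compOf E D y)} =
            S ∪ compOf E D v := by
          ext w
          simp only [hS, Finset.mem_insert, exists_eq_or_imp, Set.mem_ofPred_eq, Set.mem_union]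
          have : w ∈ compOf E D v → w ∈ D := fun h => comp_subset hv.1 h
          constructor
          · rintro ⟨h4, h5 | h5 | h5⟩
            · exact Or.inl ⟨h4, Or.inl h5⟩
            · exact Or.inr h5
            · exact Or.inl ⟨h4, Or.inr h5⟩
          · rintro (⟨h4, h5 | h5⟩ | h5)
            · exact ⟨h4, Or.inl h5⟩
            · exact ⟨h4, Or.inr (Or.inr h5)⟩
            · exact ⟨this h5, Or.inr (Or.inl h5)⟩
        rw [e]
        exact ⟨q, o'', z'', fun u hu => ⟨(g1 u hu).1.trans (h1 u hu).1,
          (g1 u hu).2.trans (h1 u hu).2⟩, g2, g3⟩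
      · have e : {w | w ∈ D ∧ (Spread E O o (compOf E D w) ∨ ∃ y ∈ insert v A, w ∈ compOf E D y)} =
            S := by
          ext w
          simp only [hS, Finset.mem_insert, exists_eq_or_imp, Set.mem_ofPred_eq]
          refine ⟨?_, fun h => ⟨h.1, h.2.imp id Or.inr⟩⟩
          rintro ⟨hw, h | h | h⟩
          · exact ⟨hw, Or.inl h⟩
          · by_cases hvD : v ∈ D
            · obtain ⟨-, h5 | ⟨y, hy, hvy⟩⟩ := not_not.1 (fun h6 => hv ⟨hvD, h6⟩)
              · exact ⟨hw, Or.inl (by rwa [H.comp_eq h])⟩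
              · exact ⟨hw, Or.inr ⟨y, hy, H.comp_eq hvy ▸ h⟩⟩
            · have h' : ReachIn E D w v := ReachIn.symm H.symm h
              rcases Relation.ReflTransGen.cases_tail h' with h4 | ⟨c, -, h4⟩
              · exact absurd (h4 ▸ hw) hvD
              · exact absurd h4.2.2 hvD
          · exact ⟨hw, Or.inr h⟩
        rw [e]
        exact ⟨p, o', z', h1, h2, h3⟩
  obtain ⟨p, o', z', h1, h2, h3⟩ := main Finset.univ
  have e : {w | w ∈ D ∧ (Spread E O o (compOf E D w) ∨
      ∃ v ∈ (Finset.univ : Finset V), w ∈ compOf E D v)} = D := by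
    ext w
    exact ⟨fun h => h.1, fun h => ⟨h, Or.inr ⟨w, Finset.mem_univ w, self_mem_comp w⟩⟩⟩
  rw [e] at h2 h3
  exact ⟨p, o', z', h1, h2.mono (fun v w h => Or.inl ⟨h, H.mem _ _ h, H.mem _ _ (H.symm _ _ h)⟩)
    H.symm, h3⟩

/-- A planar disc all of whose components have contours has a contour, which avoids the owners in `F`
at the two ends. -/
theorem fill (H : PlanarDisc G D O E o z K) (hFO : F ⊆ O)
    (hFend : ∀ u ∈ F, (∀ w ∈ O, w ≠ u → z u < o w) ∨ (∀ w ∈ O, w ≠ u → z w < o u))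
    (hne : ∀ v ∈ D, ¬ touch E O (compOf E D v) ⊆ F)
    (hF : ∀ v ∈ D, Fillable G (compOf E D v) (touch E O (compOf E D v))) :
    ∃ (par : V → V) (o' z' : V → ℝ), (∀ u ∈ O, o' u = o u ∧ z' u = z u) ∧
      ForestContour G D O E par o' z' ∧ ∀ u ∈ F, ∀ x ∈ D, ¬ (o' u < o' x ∧ z' x < z' u) := by
  obtain ⟨p, o₁, z₁, h1, W⟩ := H.exists_wideFill hF
  obtain ⟨q, o₂, z₂, g1, g2⟩ := WideFill.fill (H.congr (fun u hu => (h1 u hu).1)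
    (fun u hu => (h1 u hu).2)) W hFO (fun u hu => by
      rw [(h1 u (hFO hu)).1, (h1 u (hFO hu)).2]
      refine (hFend u hu).imp (fun h w hw hwu => ?_) (fun h w hw hwu => ?_)
      · rw [(h1 w hw).1]; exact h w hw hwu
      · rw [(h1 w hw).2]; exact h w hw hwu) hne hF
  exact ⟨q, o₂, z₂, fun u hu => ⟨(g1 u hu).1.trans (h1 u hu).1, (g1 u hu).2.trans (h1 u hu).2⟩, g2⟩

end PlanarDisc

theorem exists_subintervals {V : Type} [Fintype V] (T : Set V) (k : V → ℝ) {a b : ℝ} (hab : a < b) :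
    ∃ p q : V → ℝ, (∀ h ∈ T, a < p h ∧ p h < q h ∧ q h < b) ∧
      ∀ h ∈ T, ∀ h' ∈ T, k h < k h' → q h < p h' := by
  classical
  let rk : V → ℕ := fun h => (Finset.univ.filter (fun x => k x < k h)).card
  have hlt : ∀ h, rk h + 1 ≤ Fintype.card V := fun h =>
    Finset.card_lt_univ_of_notMem (x := h) (by simp)
  have hmono : ∀ h h', k h < k h' → rk h + 1 ≤ rk h' := fun h h' hh => by
    refine Finset.card_lt_card (Finset.ssubset_iff.2 ⟨h, by simp, ?_⟩)
    intro x hx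
    rcases Finset.mem_insert.1 hx with rfl | hx
    · simpa using hh
    · simp only [Finset.mem_filter, Finset.mem_univ, true_and] at hx ⊢
      exact hx.trans hh
  obtain ⟨d, hd, hdb⟩ : ∃ d : ℝ, 0 < d ∧ a + d * (3 * Fintype.card V) + d < b := by
    have hc : (0 : ℝ) < 3 * Fintype.card V + 2 := by positivity
    refine ⟨(b - a) / (3 * Fintype.card V + 2), div_pos (by linarith) hc, ?_⟩
    have : (b - a) / (3 * Fintype.card V + 2) * (3 * Fintype.card V + 2) = b - a :=
      div_mul_cancel₀ _ hc.ne'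
    have h2 : 0 < (b - a) / (3 * Fintype.card V + 2) := div_pos (by linarith) hc
    linarith
  refine ⟨fun h => a + d * (3 * rk h + 1), fun h => a + d * (3 * rk h + 2), fun h _ => ?_,
    fun h _ h' _ hh => ?_⟩
  · have h1 : (rk h : ℝ) + 1 ≤ Fintype.card V := by exact_mod_cast hlt h
    have h2 : (0 : ℝ) ≤ rk h := Nat.cast_nonneg _
    refine ⟨?_, ?_, ?_⟩ <;> nlinarith
  · have h1 : (rk h : ℝ) + 1 ≤ rk h' := by exact_mod_cast hmono h h' hh
    nlinarith

open PlanarDisc in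
theorem fillable {V : Type} [Fintype V] (G : SimpleGraph V) (D O : Set V) (hDO : Disjoint D O) :
    Fillable G D O := by
  classical
  induction hn : D.ncard using Nat.strong_induction_on generalizing D O with
  | _ n ih =>
  intro c o z K hc hP hlt hsep hreach
  have hcD : c ∉ D := fun h => Set.disjoint_left.1 hDO h hc
  have hnO : ∀ {v}, v ∈ D → v ∉ O := fun h => Set.disjoint_left.1 hDO h
  set Hs : Set V := {h | piece G D O c h} with hHs
  have hHD : ∀ h ∈ Hs, h ∈ D := fun h hh => hh.2.2.2.resolve_left hcD
  obtain ⟨p, q, hpq, hpq'⟩ := exists_subintervals Hs (K c) (hlt c hc)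
  set o₁ : V → ℝ := fun u => if u ∈ Hs then p u else o u with ho₁
  set z₁ : V → ℝ := fun u => if u ∈ Hs then q u else z u with hz₁
  have e1 : ∀ h ∈ Hs, o₁ h = p h ∧ z₁ h = q h := fun h hh => by simp [ho₁, hz₁, hh]
  have e2 : ∀ u ∈ O, o₁ u = o u ∧ z₁ u = z u := fun u hu => by
    have : u ∉ Hs := fun h => hnO (hHD u h) hu
    simp [ho₁, hz₁, this]
  have hHc : ∀ h ∈ Hs, o c < o₁ h ∧ o₁ h < z₁ h ∧ z₁ h < z c := fun h hh => by
    rw [(e1 h hh).1, (e1 h hh).2]; exact hpq h hh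
  have hHH : ∀ h ∈ Hs, ∀ h' ∈ Hs, K c h < K c h' → z₁ h < o₁ h' := fun h hh h' hh' hk => by
    rw [(e1 h hh).2, (e1 h' hh').1]; exact hpq' h hh h' hh' hk
  have hOlt : ∀ u ∈ O, ∀ w ∈ O, o u < o w → z u < o w := fun u hu w hw h => by
    rcases hsep u hu w hw (by rintro rfl; exact lt_irrefl _ h) with h1 | h1
    · exact h1
    · linarith [hlt w hw]
  obtain ⟨K', hP'⟩ := hP.step (fun _ _ => piece_symm) hDO (fun x h => h.1.ne rfl) hc
    (fun y hy => hHD y hy) (o₁ := o₁)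
    (fun u hu _ w hw _ => by rw [(e2 u hu).1, (e2 w hw).1])
    (fun u hu huc h hh => by
      rw [(e2 u hu).1]
      have h1 := hHc h hh
      have h2 := hlt u hu
      constructor
      · intro h3
        rcases hsep u hu c hc huc with h | h
        · linarith
        · linarith
      · intro h3
        linarith)
    (fun u hu huc h hh => by
      rw [(e2 u hu).1]
      have h1 := hHc h hh
      have h2 := hlt u hu
      constructor
      · intro h3
        linarith
      · intro h3
        linarith [hOlt c hc u hu h3])
    (fun h h' hh hh' => by
      have h1 := hHc h hh
      have h2 := hHc h' hh'
      constructor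
      · intro h3
        by_contra h4
        rcases (not_lt.1 h4).lt_or_eq with h5 | h5
        · linarith [hHH h' hh' h hh h5]
        · rw [hP.inj c h' h hh' hh h5] at h3
          exact lt_irrefl _ h3
      · intro h3
        linarith [hHH h hh h' hh' h3])
  set D₁ : Set V := {v | v ∈ D ∧ ¬ piece G D O c v} with hD₁
  set O₁ : Set V := {u | u ∈ O ∧ u ≠ c} ∪ {h | piece G D O c h} with hO₁
  set E₁ : V → V → Prop := fun v w => piece G D O v w ∧ v ≠ c ∧ w ≠ c with hE₁
  have hsplit : ∀ v, v ∈ D ∪ O → v ≠ c → v ∈ D₁ ∪ O₁ := by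
    rintro v (hv | hv) hvc
    · by_cases h : piece G D O c v
      · exact Or.inr (Or.inr h)
      · exact Or.inl ⟨hv, h⟩
    · exact Or.inr (Or.inl ⟨hv, hvc⟩)
  have hback : ∀ v ∈ D₁ ∪ O₁, v ∈ D ∪ O ∧ v ≠ c := by
    rintro v (hv | hv | hv)
    · exact ⟨Or.inl hv.1, fun h => hcD (h ▸ hv.1)⟩
    · exact ⟨Or.inr hv.1, hv.2⟩
    · exact ⟨Or.inl (hHD v hv), fun h => hcD (h ▸ hHD v hv)⟩
  have H : PlanarDisc G D₁ O₁ E₁ o₁ z₁ K' := by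
    refine ⟨hP', fun v w h => ⟨piece_symm h.1, h.2.2, h.2.1⟩, ?_, fun v w h => h.1.1,
      fun v w h => hsplit v h.1.2.1 h.2.1, fun v hv w hw hvw => ?_, ?_, ?_⟩
    · rw [Set.disjoint_left]
      rintro v hv (hv' | hv')
      · exact hnO hv.1 hv'.1
      · exact hv.2 hv'
    · exact ⟨⟨hvw, Or.inl hv.1, (hback w hw).1, Or.inl hv.1⟩, fun h => hcD (h ▸ hv.1),
        (hback w hw).2⟩
    · rintro u (hu | hu)
      · rw [(e2 u hu.1).1, (e2 u hu.1).2]; exact hlt u hu.1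
      · exact (hHc u hu).2.1
    · have hmix : ∀ u ∈ O, u ≠ c → ∀ h ∈ Hs, z₁ u < o₁ h ∨ z₁ h < o₁ u := by
        intro u hu huc h hh
        have h1 := hHc h hh
        rw [(e2 u hu).1, (e2 u hu).2]
        rcases hsep u hu c hc huc with h | h
        · left; linarith
        · right; linarith
      rintro u (hu | hu) w (hw | hw) huw
      · rw [(e2 u hu.1).1, (e2 u hu.1).2, (e2 w hw.1).1, (e2 w hw.1).2]
        exact hsep u hu.1 w hw.1 huw
      · exact hmix u hu.1 hu.2 w hw
      · exact (hmix w hw.1 hw.2 u hu).symm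
      · rcases lt_trichotomy (K c u) (K c w) with h | h | h
        · exact Or.inl (hHH u hu w hw h)
        · exact absurd (hP.inj c u w hu hw h) huw
        · exact Or.inr (hHH w hw u hu h)
  have htouch : ∀ v ∈ D₁, ∃ h ∈ Hs, h ∈ touch E₁ O₁ (compOf E₁ D₁ v) := by
    intro v hv
    obtain ⟨h, hh, hch, hvh⟩ := hreach v hv.1
    have key : h ∈ compOf E₁ D₁ v ∨ ∃ h' ∈ Hs, h' ∈ touch E₁ O₁ (compOf E₁ D₁ v) := by
      clear hh hch
      induction hvh with
      | refl => exact Or.inl (self_mem_comp v)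
      | @tail x y _ hxy ih' =>
        rcases ih' with hx | hx
        · have hyc : y ≠ c := fun h => hcD (h ▸ hxy.2.2)
          have hxD := comp_subset hv hx
          have hE := H.of_adj x hxD y (hsplit y (Or.inl hxy.2.2) hyc) hxy.1
          by_cases hy : y ∈ Hs
          · exact Or.inr ⟨y, hy, Or.inr hy, x, hx, H.symm _ _ hE⟩
          · exact Or.inl (Relation.ReflTransGen.tail hx ⟨hE, hxD, hxy.2.2, hy⟩)
        · exact Or.inr hx
    rcases key with h1 | h1
    · exact absurd ⟨hch, Or.inr hc, Or.inl hh, Or.inr hh⟩ (comp_subset hv h1).2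
    · exact h1
  obtain ⟨par, o', z', g1, g2, g3⟩ := H.fill (F := {u | u ∈ O ∧ u ≠ c ∧
      ((∀ w ∈ O, w ≠ u → z u < o w) ∨ (∀ w ∈ O, w ≠ u → z w < o u))})
    (fun u hu => Or.inl ⟨hu.1, hu.2.1⟩)
    (fun u hu => by
      rw [(e2 u hu.1).1, (e2 u hu.1).2]
      refine hu.2.2.imp (fun h w hw hwu => ?_) (fun h w hw hwu => ?_)
      · rcases hw with hw | hw
        · rw [(e2 w hw.1).1]; exact h w hw.1 hwu
        · linarith [hHc w hw, h c hc hu.2.1.symm]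
      · rcases hw with hw | hw
        · rw [(e2 w hw.1).2]; exact h w hw.1 hwu
        · linarith [hHc w hw, h c hc hu.2.1.symm])
    (fun v hv hsub => by
      obtain ⟨h, hh, hh'⟩ := htouch v hv
      exact hnO (hHD h hh) (hsub hh').1)
    (fun v hv => by
      obtain ⟨h, hh, -⟩ := htouch v hv
      refine ih _ ?_ _ _ (H.disjoint.mono (comp_subset hv) (fun u hu => hu.1)) rfl
      rw [← hn]
      refine Set.ncard_lt_ncard ?_ (Set.toFinite _)
      refine ⟨fun x hx => (comp_subset hv hx).1, fun hsub => ?_⟩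
      exact (comp_subset hv (hsub (hHD h hh))).2 hh)
  have hHc' : ∀ h ∈ Hs, o c < o' h ∧ z' h < z c := fun h hh => by
    rw [(g1 h (Or.inr hh)).1, (g1 h (Or.inr hh)).2]
    exact ⟨(hHc h hh).1, (hHc h hh).2.2⟩
  have hO' : ∀ u ∈ O, u ≠ c → o' u = o u ∧ z' u = z u := fun u hu huc => by
    rw [(g1 u (Or.inl ⟨hu, huc⟩)).1, (g1 u (Or.inl ⟨hu, huc⟩)).2]; exact e2 u hu
  set o₂ : V → ℝ := fun w => if w = c then o c else o' w with ho₂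
  set z₂ : V → ℝ := fun w => if w = c then z c else z' w with hz₂
  set par₂ : V → V := fun w => if w ∈ Hs then c else par w with hpar₂
  have ec : o₂ c = o c ∧ z₂ c = z c := by simp [ho₂, hz₂]
  have en : ∀ w, w ≠ c → o₂ w = o' w ∧ z₂ w = z' w := fun w hw => by simp [ho₂, hz₂, hw]
  have eO : ∀ u ∈ O, o₂ u = o u ∧ z₂ u = z u := fun u hu => by
    by_cases huc : u = c
    · rw [huc]; exact ec
    · rw [(en u huc).1, (en u huc).2]; exact hO' u hu huc
  have hDc : ∀ v ∈ D, v ≠ c := fun v hv h => hcD (h ▸ hv)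
  have ep : ∀ v ∈ Hs, par₂ v = c := fun v hv => by simp [hpar₂, hv]
  have ep' : ∀ v ∈ D₁, par₂ v = par v := fun v hv => by
    have : v ∉ Hs := hv.2
    simp [hpar₂, this]
  have hDcase : ∀ v ∈ D, v ∈ Hs ∨ v ∈ D₁ := fun v hv => by
    by_cases h : v ∈ Hs
    · exact Or.inl h
    · exact Or.inr ⟨hv, h⟩
  have hlt' : ∀ v ∈ D ∪ O, v ≠ c → o' v < z' v := fun v hv hvc => g2.lt v (hsplit v hv hvc)
  have hpc : ∀ v ∈ D₁, par v ≠ c := fun v hv => (hback _ (g2.par_mem v hv)).2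
  -- a vertex inside `c` is not inside another owner
  have hexcl : ∀ u ∈ O, u ≠ c → ∀ v ∈ D, o c < o' v → z' v < z c → o u < o' v → z' v < z u →
      False := by
    intro u hu huc v hv h1 h2 h3 h4
    have := hlt' v (Or.inl hv) (hDc v hv)
    rcases hsep u hu c hc huc with h | h <;> linarith
  refine ⟨par₂, o₂, z₂, eO, ?_, ?_⟩
  · constructor
    · intro v hv
      by_cases hvc : v = c
      · rw [hvc, ec.1, ec.2]; exact hlt c hc
      · rw [(en v hvc).1, (en v hvc).2]; exact hlt' v hv hvc
    · intro v hv
      rcases hDcase v hv with h | h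
      · rw [ep v h]; exact Or.inr hc
      · rw [ep' v h]; exact (hback _ (g2.par_mem v h)).1
    · intro v hv
      rcases hDcase v hv with h | h
      · rw [ep v h]; exact h.1
      · rw [ep' v h]; exact g2.adj v h
    · intro v hv
      rw [(en v (hDc v hv)).1]
      rcases hDcase v hv with h | h
      · rw [ep v h, ec.1]; exact (hHc' v h).1
      · rw [ep' v h, (en _ (hpc v h)).1]; exact g2.par_o v h
    · intro v hv
      rw [(en v (hDc v hv)).2]
      rcases hDcase v hv with h | h
      · rw [ep v h, ec.2]; exact (hHc' v h).2
      · rw [ep' v h, (en _ (hpc v h)).2]; exact g2.par_z v h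
    · intro v hv
      rw [(en v (hDc v hv)).1, (en v (hDc v hv)).2]
      rcases hDcase v hv with h | h
      · exact ⟨c, hc, by rw [ec.1, ec.2]; exact hHc' v h⟩
      · obtain ⟨u, hu | hu, h1⟩ := g2.root v h
        · exact ⟨u, hu.1, by rw [(en u hu.2).1, (en u hu.2).2]; exact h1⟩
        · have h2 := hHc' u hu
          exact ⟨c, hc, by rw [ec.1, ec.2]; exact ⟨h2.1.trans h1.1, h1.2.trans h2.2⟩⟩
    · intro u hu w hw huw
      rw [(eO u hu).1, (eO u hu).2, (eO w hw).1, (eO w hw).2]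
      exact hsep u hu w hw huw
    · intro v hv w hw hvw
      rw [(en v (hDc v hv)).1, (en v (hDc v hv)).2, (en w (hDc w hw)).1, (en w (hDc w hw)).2]
      rcases hDcase v hv with h | h <;> rcases hDcase w hw with h' | h'
      · rcases g2.disj v (Or.inr h) w (Or.inr h') hvw with h1 | h1 <;> tauto
      · rcases g2.owner_cases (a := v) (Or.inr h) (w := w) (Or.inl h') with h1 | h1 | h1 | h1
        · exact absurd h1.symm hvw
        · tauto
        · tauto
        · tauto
      · rcases g2.owner_cases (a := w) (Or.inr h') (w := v) (Or.inl h) with h1 | h1 | h1 | h1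
        · exact absurd h1 hvw
        · tauto
        · tauto
        · tauto
      · exact g2.laminar v h w h' hvw
    · intro v hv w hw h1 h2
      rw [(en v (hDc v hv)).1] at h1
      rw [(en v (hDc v hv)).2] at h2
      rcases hDcase v hv with h | h
      · left
        rw [ep v h]
        by_contra hwc
        rw [(en w hwc).1] at h1
        rw [(en w hwc).2] at h2
        have h3 := hlt' v (Or.inl hv) (hDc v hv)
        rcases g2.owner_cases (a := v) (Or.inr h) (hsplit w hw hwc) with h4 | h4 | h4 | h4
        · rw [h4] at h1; exact lt_irrefl _ h1
        · linarith
        · linarith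
        · linarith [h4.2.1]
      · rw [ep' v h, (en _ (hpc v h)).1, (en _ (hpc v h)).2]
        by_cases hwc : w = c
        · right
          rw [hwc, ec.1] at h1
          rw [hwc, ec.2] at h2
          rw [hwc, ec.1, ec.2]
          have h3 := g2.par_o v h
          have h4 := g2.par_z v h
          rcases g2.par_mem v h with h5 | h5 | h5
          · obtain ⟨u, hu | hu, h6, h7⟩ := g2.root _ h5
            · rw [(hO' u hu.1 hu.2).1] at h6
              rw [(hO' u hu.1 hu.2).2] at h7
              exact (hexcl u hu.1 hu.2 v hv h1 h2 (by linarith) (by linarith)).elim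
            · have h8 := hHc' u hu
              exact ⟨by linarith, by linarith⟩
          · rw [(hO' _ h5.1 h5.2).1] at h3
            rw [(hO' _ h5.1 h5.2).2] at h4
            exact (hexcl _ h5.1 h5.2 v hv h1 h2 h3 h4).elim
          · exact hHc' _ h5
        · rw [(en w hwc).1] at h1 ⊢
          rw [(en w hwc).2] at h2 ⊢
          exact g2.least v h w (hsplit w hw hwc) h1 h2
    · exact fun v w h => h.2.1
    · exact fun v w h => piece_symm h
    · intro v w hvw
      by_cases hvc : v = c
      · have hw : w ∈ Hs := by rw [hvc] at hvw; exact hvw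
        exact Or.inr (Or.inl ⟨hHD w hw, by rw [ep w hw, hvc]⟩)
      by_cases hwc : w = c
      · have hv : v ∈ Hs := by rw [hwc] at hvw; exact piece_symm hvw
        exact Or.inl ⟨hHD v hv, by rw [ep v hv, hwc]⟩
      rw [(en v hvc).1, (en v hvc).2, (en w hwc).1, (en w hwc).2]
      rcases g2.edge v w ⟨hvw, hvc, hwc⟩ with h | h | h
      · exact Or.inl ⟨h.1.1, by rw [ep' v h.1]; exact h.2⟩
      · exact Or.inr (Or.inl ⟨h.1.1, by rw [ep' w h.1]; exact h.2⟩)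
      · exact Or.inr (Or.inr h)
    · intro i j i' j' hij hij' h1 h2 h3
      have hin : ∀ {j}, piece G D O c j → o c < o₂ j ∧ o₂ j < z₂ j ∧ z₂ j < z c := by
        intro j hj
        have hjD := hHD j hj
        rw [(en j (hDc j hjD)).1, (en j (hDc j hjD)).2]
        exact ⟨(hHc' j hj).1, hlt' j (Or.inl hjD) (hDc j hjD), (hHc' j hj).2⟩
      have hc2 := hlt c hc
      by_cases hi : i = c
      · rw [hi] at hij h1
        have := hin hij
        rw [ec.2] at h1
        linarith
      by_cases hj : j = c
      · rw [hj] at hij h2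
        have := hin (piece_symm hij)
        rw [ec.1] at h2
        linarith
      by_cases hi' : i' = c
      · rw [hi'] at hij' h2
        have := hin hij'
        rw [ec.2] at h2
        linarith
      by_cases hj' : j' = c
      · rw [hj'] at hij' h3
        have := hin (piece_symm hij')
        rw [ec.1] at h3
        linarith
      rw [(en i hi).2, (en i' hi').2] at h1
      rw [(en i' hi').2, (en j hj).1] at h2
      rw [(en j hj).1, (en j' hj').1] at h3
      exact g2.nc i j i' j' ⟨hij, hi, hj⟩ ⟨hij', hi', hj'⟩ h1 h2 h3
  · intro u hu huc hend v hv
    rw [(eO u hu).1, (eO u hu).2, (en v (hDc v hv)).1, (en v (hDc v hv)).2]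
    rcases hDcase v hv with h | h
    · exact fun h1 => hexcl u hu huc v hv (hHc' v h).1 (hHc' v h).2 h1.1 h1.2
    · have := g3 u ⟨hu, huc, hend⟩ v h
      rwa [(hO' u hu huc).1, (hO' u hu huc).2] at this

theorem neg_iff_neg_of_ne_zero {D : ℝ → ℝ} (hD : Continuous D) {a b : ℝ}
    (h : ∀ t ∈ Set.uIcc a b, D t ≠ 0) : D a < 0 ↔ D b < 0 := by
  have key := intermediate_value_uIcc (hD.continuousOn (s := Set.uIcc a b))
  by_contra hne
  have h0 : (0 : ℝ) ∈ Set.uIcc (D a) (D b) := by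
    rw [Set.mem_uIcc]
    by_cases h1 : D a < 0 <;> by_cases h2 : D b < 0
    · exact absurd (iff_of_true h1 h2) hne
    · exact Or.inl ⟨h1.le, not_lt.1 h2⟩
    · exact Or.inr ⟨h2.le, not_lt.1 h1⟩
    · exact absurd (iff_of_false h1 h2) hne
  obtain ⟨t, ht, ht0⟩ := key h0
  exact h t ht ht0

/-- The slope of the segment from `p` to `q`. -/
noncomputable def edgeSlope {V : Type} (X Y : V → ℝ) (p q : V) : ℝ := (Y q - Y p) / (X q - X p)

/-- The height at abscissa `t` of the line through `p` and `q`. -/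
noncomputable def edgeHeight {V : Type} (X Y : V → ℝ) (p q : V) (t : ℝ) : ℝ :=
  Y p + edgeSlope X Y p q * (t - X p)

section

variable {V : Type} {X Y : V → ℝ}

theorem edgeSlope_comm (p q : V) : edgeSlope X Y p q = edgeSlope X Y q p := by
  unfold edgeSlope
  rw [← neg_sub (Y p) (Y q), ← neg_sub (X p) (X q), neg_div_neg_eq]

theorem edgeHeight_left (p q : V) : edgeHeight X Y p q (X p) = Y p := by simp [edgeHeight]

theorem edgeHeight_eq {p q : V} (h : X p < X q) (t : ℝ) :
    edgeHeight X Y p q t = Y q + edgeSlope X Y p q * (t - X q) := by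
  have : X q - X p ≠ 0 := by linarith
  unfold edgeHeight edgeSlope
  field_simp
  ring

theorem edgeHeight_right {p q : V} (h : X p < X q) : edgeHeight X Y p q (X q) = Y q := by
  rw [edgeHeight_eq h]; simp

/-- The segment from `p` to `q` passes strictly below `v`. -/
def PassBelow (X Y : V → ℝ) (v p q : V) : Prop :=
  X p < X v ∧ X v < X q ∧ edgeHeight X Y p q (X v) < Y v

/-- The vertex `w` lies strictly below the segment from `v` to `x`. -/
def LiesBelow (X Y : V → ℝ) (v x w : V) : Prop :=
  X v < X w ∧ X w < X x ∧ Y w < edgeHeight X Y v x (X w)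

open Classical in
/-- Two segments that do not cross: the parity of the edge `p q` below the edge `v x` is the same at
both ends. -/
theorem crossing_parity (hX : Function.Injective X) {v x p q : V} (hvx : X v < X x) (hpq : X p < X q)
    (hv : X p < X v → X v < X q → edgeHeight X Y p q (X v) ≠ Y v)
    (hx : X p < X x → X x < X q → edgeHeight X Y p q (X x) ≠ Y x)
    (hp : X v < X p → X p < X x → edgeHeight X Y v x (X p) ≠ Y p)
    (hq : X v < X q → X q < X x → edgeHeight X Y v x (X q) ≠ Y q)
    (hne : ¬ (p = v ∧ q = x) → ∀ t, X p < t → X v < t → t < X q → t < X x →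
      edgeHeight X Y p q t ≠ edgeHeight X Y v x t) :
    (if PassBelow X Y v p q then (1 : ZMod 2) else 0) +
      (if p = v ∧ edgeSlope X Y p q ≤ edgeSlope X Y v x then 1 else 0) +
      (if LiesBelow X Y v x p then 1 else 0) =
    (if PassBelow X Y x p q then 1 else 0) +
      (if q = x ∧ edgeSlope X Y v x ≤ edgeSlope X Y p q then 1 else 0) +
      (if LiesBelow X Y v x q then 1 else 0) := by
  by_cases he : p = v ∧ q = x
  · obtain ⟨rfl, rfl⟩ := he
    simp [PassBelow, LiesBelow]
  replace hne := hne he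
  set D : ℝ → ℝ := fun t => edgeHeight X Y p q t - edgeHeight X Y v x t with hD
  have hDc : Continuous D := by
    unfold D edgeHeight
    fun_prop
  have hD0 : ∀ t, X p < t → X v < t → t < X q → t < X x → D t ≠ 0 := fun t h1 h2 h3 h4 =>
    sub_ne_zero.2 (hne t h1 h2 h3 h4)
  set m : ℝ := (max (X p) (X v) + min (X q) (X x)) / 2 with hm
  have hmm : X v < X q → X p < X x → X p < m ∧ X v < m ∧ m < X q ∧ m < X x := by
    intro h1 h2
    have h3 : max (X p) (X v) < min (X q) (X x) := max_lt (lt_min hpq h2) (lt_min h1 hvx)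
    have h4 : max (X p) (X v) < m := by rw [hm]; linarith
    have h5 : m < min (X q) (X x) := by rw [hm]; linarith
    exact ⟨(le_max_left _ _).trans_lt h4, (le_max_right _ _).trans_lt h4,
      h5.trans_le (min_le_left _ _), h5.trans_le (min_le_right _ _)⟩
  trans (if X v < X q ∧ X p < X x ∧ D m < 0 then (1 : ZMod 2) else 0)
  · rcases lt_trichotomy (X p) (X v) with h | h | h
    · have h1 : ¬ (p = v ∧ edgeSlope X Y p q ≤ edgeSlope X Y v x) := by
        rintro ⟨rfl, -⟩; exact lt_irrefl _ h
      have h2 : ¬ LiesBelow X Y v x p := fun h2 => lt_asymm h h2.1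
      rw [if_neg h1, if_neg h2, add_zero, add_zero]
      refine if_congr ?_ rfl rfl
      have h3 : X v < X q → ((edgeHeight X Y p q (X v) < Y v) ↔ D m < 0) := by
        intro h3
        obtain ⟨m1, m2, m3, m4⟩ := hmm h3 (h.trans hvx)
        rw [← neg_iff_neg_of_ne_zero hDc (a := X v) (b := m), hD]
        · simp only [edgeHeight_left, sub_neg]
        · intro t ht
          rw [Set.uIcc_of_le m2.le] at ht
          rcases ht.1.eq_or_lt with rfl | h5
          · simp only [hD, edgeHeight_left]
            exact sub_ne_zero.2 (hv h h3)
          · exact hD0 t (h.trans h5) h5 (ht.2.trans_lt m3) (ht.2.trans_lt m4)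
      unfold PassBelow
      constructor
      · exact fun h4 => ⟨h4.2.1, h.trans hvx, (h3 h4.2.1).1 h4.2.2⟩
      · exact fun h4 => ⟨h, h4.1, (h3 h4.1).2 h4.2.2⟩
    · obtain rfl := hX h
      have h1 : ¬ PassBelow X Y p p q := fun h1 => lt_irrefl _ h1.1
      have h2 : ¬ LiesBelow X Y p x p := fun h2 => lt_irrefl _ h2.1
      rw [if_neg h1, if_neg h2, add_zero, zero_add]
      refine if_congr ?_ rfl rfl
      obtain ⟨m1, m2, m3, m4⟩ := hmm hpq hvx
      have h3 := hD0 m m1 m2 m3 m4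
      have h4 : D m = (edgeSlope X Y p q - edgeSlope X Y p x) * (m - X p) := by
        simp only [hD, edgeHeight]; ring
      constructor
      · rintro ⟨-, h5⟩
        refine ⟨hpq, hvx, lt_of_le_of_ne ?_ h3⟩
        rw [h4]
        exact mul_nonpos_of_nonpos_of_nonneg (by linarith) (by linarith)
      · rintro ⟨-, -, h5⟩
        refine ⟨rfl, ?_⟩
        by_contra h6
        rw [h4] at h5
        have := mul_pos (show 0 < edgeSlope X Y p q - edgeSlope X Y p x by linarith)
          (show 0 < m - X p by linarith)
        linarith
    · have h1 : ¬ (p = v ∧ edgeSlope X Y p q ≤ edgeSlope X Y v x) := by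
        rintro ⟨rfl, -⟩; exact lt_irrefl _ h
      have h2 : ¬ PassBelow X Y v p q := fun h2 => lt_asymm h h2.1
      rw [if_neg h1, if_neg h2, add_zero, zero_add]
      refine if_congr ?_ rfl rfl
      have h3 : X p < X x → ((Y p < edgeHeight X Y v x (X p)) ↔ D m < 0) := by
        intro h3
        obtain ⟨m1, m2, m3, m4⟩ := hmm (h.trans hpq) h3
        rw [← neg_iff_neg_of_ne_zero hDc (a := X p) (b := m), hD]
        · simp only [edgeHeight_left, sub_neg]
        · intro t ht
          rw [Set.uIcc_of_le m1.le] at ht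
          rcases ht.1.eq_or_lt with rfl | h5
          · simp only [hD, edgeHeight_left]
            exact sub_ne_zero.2 (hp h h3).symm
          · exact hD0 t h5 (h.trans h5) (ht.2.trans_lt m3) (ht.2.trans_lt m4)
      unfold LiesBelow
      constructor
      · exact fun h4 => ⟨h.trans hpq, h4.2.1, (h3 h4.2.1).1 h4.2.2⟩
      · exact fun h4 => ⟨h, h4.2.1, (h3 h4.2.1).2 h4.2.2⟩
  · symm
    rcases lt_trichotomy (X x) (X q) with h | h | h
    · have h1 : ¬ (q = x ∧ edgeSlope X Y v x ≤ edgeSlope X Y p q) := by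
        rintro ⟨rfl, -⟩; exact lt_irrefl _ h
      have h2 : ¬ LiesBelow X Y v x q := fun h2 => lt_asymm h h2.2.1
      rw [if_neg h1, if_neg h2, add_zero, add_zero]
      refine if_congr ?_ rfl rfl
      have h3 : X p < X x → ((edgeHeight X Y p q (X x) < Y x) ↔ D m < 0) := by
        intro h3
        obtain ⟨m1, m2, m3, m4⟩ := hmm (hvx.trans h) h3
        rw [← neg_iff_neg_of_ne_zero hDc (a := X x) (b := m), hD]
        · simp only [edgeHeight_right hvx, sub_neg]
        · intro t ht
          rw [Set.uIcc_of_ge m4.le] at ht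
          rcases ht.2.eq_or_lt with rfl | h5
          · simp only [hD, edgeHeight_right hvx]
            exact sub_ne_zero.2 (hx h3 h)
          · exact hD0 t (m1.trans_le ht.1) (m2.trans_le ht.1) (h5.trans h) h5
      unfold PassBelow
      constructor
      · exact fun h4 => ⟨hvx.trans h, h4.1, (h3 h4.1).1 h4.2.2⟩
      · exact fun h4 => ⟨h4.2.1, h, (h3 h4.2.1).2 h4.2.2⟩
    · obtain rfl := hX h
      have h1 : ¬ PassBelow X Y x p x := fun h1 => lt_irrefl _ h1.2.1
      have h2 : ¬ LiesBelow X Y v x x := fun h2 => lt_irrefl _ h2.2.1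
      rw [if_neg h1, if_neg h2, add_zero, zero_add]
      refine if_congr ?_ rfl rfl
      obtain ⟨m1, m2, m3, m4⟩ := hmm hvx hpq
      have h3 := hD0 m m1 m2 m3 m4
      have h4 : D m = (edgeSlope X Y p x - edgeSlope X Y v x) * (m - X x) := by
        simp only [hD, edgeHeight_eq hpq, edgeHeight_eq hvx]; ring
      constructor
      · rintro ⟨-, h5⟩
        refine ⟨hvx, hpq, lt_of_le_of_ne ?_ h3⟩
        rw [h4]
        exact mul_nonpos_of_nonneg_of_nonpos (by linarith) (by linarith)
      · rintro ⟨-, -, h5⟩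
        refine ⟨rfl, ?_⟩
        by_contra h6
        rw [h4] at h5
        have := mul_pos_of_neg_of_neg (show edgeSlope X Y p x - edgeSlope X Y v x < 0 by linarith)
          (show m - X x < 0 by linarith)
        linarith
    · have h1 : ¬ (q = x ∧ edgeSlope X Y v x ≤ edgeSlope X Y p q) := by
        rintro ⟨rfl, -⟩; exact lt_irrefl _ h
      have h2 : ¬ PassBelow X Y x p q := fun h2 => lt_asymm h h2.2.1
      rw [if_neg h1, if_neg h2, add_zero, zero_add]
      refine if_congr ?_ rfl rfl
      have h3 : X v < X q → ((Y q < edgeHeight X Y v x (X q)) ↔ D m < 0) := by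
        intro h3
        obtain ⟨m1, m2, m3, m4⟩ := hmm h3 (hpq.trans h)
        rw [← neg_iff_neg_of_ne_zero hDc (a := X q) (b := m), hD]
        · simp only [edgeHeight_right hpq, sub_neg]
        · intro t ht
          rw [Set.uIcc_of_ge m3.le] at ht
          rcases ht.2.eq_or_lt with rfl | h5
          · simp only [hD, edgeHeight_right hpq]
            exact sub_ne_zero.2 (hq h3 h).symm
          · exact hD0 t (m1.trans_le ht.1) (m2.trans_le ht.1) h5 (h5.trans h)
      unfold LiesBelow
      constructor
      · exact fun h4 => ⟨h4.1, hpq.trans h, (h3 h4.1).1 h4.2.2⟩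
      · exact fun h4 => ⟨h4.1, h, (h3 h4.1).2 h4.2.2⟩

end

/-- The direction from `v` to `y` as an angle, counted counterclockwise from the downward
direction. -/
noncomputable def edgeAngle {V : Type} (X Y : V → ℝ) (v y : V) : ℝ :=
  if X v < X y then Real.arctan (edgeSlope X Y v y) else Real.pi + Real.arctan (edgeSlope X Y v y)

section

variable {V : Type} {X Y : V → ℝ}

theorem edgeAngle_le_of_lt {v x : V} (h : X v < X x) (y : V) :
    edgeAngle X Y v y ≤ edgeAngle X Y v x ↔ X v < X y ∧ edgeSlope X Y v y ≤ edgeSlope X Y v x := by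
  unfold edgeAngle
  rw [if_pos h]
  by_cases hy : X v < X y
  · simp [hy, Real.arctan_strictMono.le_iff_le]
  · simp only [hy, if_false, false_and, iff_false, not_le]
    linarith [Real.arctan_lt_pi_div_two (edgeSlope X Y v x),
      Real.neg_pi_div_two_lt_arctan (edgeSlope X Y v y)]

theorem edgeAngle_lt_of_not_lt {v x : V} (h : ¬ X v < X x) (y : V) :
    edgeAngle X Y v y < edgeAngle X Y v x ↔
      ¬ (¬ X v < X y ∧ edgeSlope X Y v x ≤ edgeSlope X Y v y) := by
  unfold edgeAngle
  rw [if_neg h]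
  by_cases hy : X v < X y
  · simp only [hy, if_true, not_true, false_and, not_false_iff, iff_true]
    linarith [Real.arctan_lt_pi_div_two (edgeSlope X Y v y),
      Real.neg_pi_div_two_lt_arctan (edgeSlope X Y v x)]
  · simp [hy, Real.arctan_strictMono.lt_iff_lt]

theorem edgeSlope_eq_of_edgeAngle_eq {v x y : V} (h : edgeAngle X Y v x = edgeAngle X Y v y) :
    (X v < X x ↔ X v < X y) ∧ edgeSlope X Y v x = edgeSlope X Y v y := by
  unfold edgeAngle at h
  have h1 := Real.arctan_lt_pi_div_two (edgeSlope X Y v x)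
  have h2 := Real.arctan_lt_pi_div_two (edgeSlope X Y v y)
  have h3 := Real.neg_pi_div_two_lt_arctan (edgeSlope X Y v x)
  have h4 := Real.neg_pi_div_two_lt_arctan (edgeSlope X Y v y)
  by_cases hx : X v < X x <;> by_cases hy : X v < X y <;> simp only [hx, hy, if_true, if_false] at h
  · exact ⟨iff_of_true hx hy, Real.arctan_injective h⟩
  · linarith
  · linarith
  · exact ⟨iff_of_false hx hy, Real.arctan_injective (add_left_cancel h)⟩

variable [Fintype V]

open Classical in
/-- The number of edges of the chain `P` below `v`. -/
noncomputable def chainBelow (X Y : V → ℝ) (P : V → V → ZMod 2) (v : V) : ZMod 2 :=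
  ∑ p, ∑ q, if PassBelow X Y v p q then P p q else 0

/-- Abscissae and ordinates of a planar straight-line drawing without vertical edges. -/
structure PlanarCoords (G : SimpleGraph V) (X Y : V → ℝ) : Prop where
  inj : Function.Injective X
  vertex : ∀ p q v, G.Adj p q → X p < X v → X v < X q → edgeHeight X Y p q (X v) ≠ Y v
  edge : ∀ p q v x, G.Adj p q → G.Adj v x → X p < X q → X v < X x → ¬ (p = v ∧ q = x) →
    ∀ t, X p < t → X v < t → t < X q → t < X x → edgeHeight X Y p q t ≠ edgeHeight X Y v x t

namespace PlanarCoords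

variable {G : SimpleGraph V} {P : V → V → ZMod 2}

theorem edgeAngle_inj (h : PlanarCoords G X Y) {v x y : V} (hx : G.Adj v x) (hy : G.Adj v y)
    (he : edgeAngle X Y v x = edgeAngle X Y v y) : x = y := by
  obtain ⟨h1, h2⟩ := edgeSlope_eq_of_edgeAngle_eq he
  by_contra hne
  by_cases hvx : X v < X x
  · have hvy := h1.1 hvx
    obtain ⟨t, ht1, ht2⟩ := exists_between (lt_min hvx hvy)
    refine h.edge v x v y hx hy hvx hvy (fun h => hne h.2) t ht1 ht1
      (ht2.trans_le (min_le_left _ _)) (ht2.trans_le (min_le_right _ _)) ?_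
    simp only [edgeHeight, h2]
  · have hvy : ¬ X v < X y := fun h => hvx (h1.2 h)
    have hxv : X x < X v := lt_of_le_of_ne (not_lt.1 hvx) (fun e => hx.ne (h.inj e).symm)
    have hyv : X y < X v := lt_of_le_of_ne (not_lt.1 hvy) (fun e => hy.ne (h.inj e).symm)
    obtain ⟨t, ht1, ht2⟩ := exists_between (max_lt hxv hyv)
    refine h.edge x v y v hx.symm hy.symm hxv hyv (fun h => hne h.1) t
      ((le_max_left _ _).trans_lt ht1) ((le_max_right _ _).trans_lt ht1) ht2 ht2 ?_
    rw [edgeHeight_eq hxv, edgeHeight_eq hyv, edgeSlope_comm x v, edgeSlope_comm y v, h2]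

open Classical in
theorem chainBelow_add (h : PlanarCoords G X Y) (h1 : ∀ v w, P v w = P w v)
    (h2 : ∀ v w, P v w ≠ 0 → G.Adj v w) (h3 : ∀ v, ∑ y, P v y = 0) {v x : V} (hvx : G.Adj v x)
    (hlt : X v < X x) :
    chainBelow X Y P v +
        (∑ y, if X v < X y ∧ edgeSlope X Y v y ≤ edgeSlope X Y v x then P v y else 0) =
      chainBelow X Y P x +
        ∑ y, if ¬ X x < X y ∧ edgeSlope X Y v x ≤ edgeSlope X Y x y then P x y else 0 := by
  set w : V → V → ZMod 2 := fun p q => if X p < X q then P p q else 0 with hw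
  have hdiag : ∀ p, P p p = 0 := fun p => by
    by_contra hp
    exact (h2 p p hp).ne rfl
  have hwP : ∀ p q, w p q + w q p = P p q := by
    intro p q
    rcases lt_trichotomy (X p) (X q) with h4 | h4 | h4
    · simp [hw, h4, h4.not_gt]
    · obtain rfl := h.inj h4
      simp [hw, hdiag]
    · simp [hw, h4, h4.not_gt, h1 q p]
  have hcb : ∀ v, chainBelow X Y P v = ∑ p, ∑ q, w p q * if PassBelow X Y v p q then 1 else 0 := by
    intro v
    refine Finset.sum_congr rfl (fun p _ => Finset.sum_congr rfl (fun q _ => ?_))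
    by_cases hb : PassBelow X Y v p q
    · simp [hb, hw, hb.1.trans hb.2.1]
    · simp [hb]
  have hs2 : (∑ y, if X v < X y ∧ edgeSlope X Y v y ≤ edgeSlope X Y v x then P v y else 0) =
      ∑ p, ∑ q, w p q * if p = v ∧ edgeSlope X Y p q ≤ edgeSlope X Y v x then 1 else 0 := by
    symm
    rw [Finset.sum_eq_single v]
    · refine Finset.sum_congr rfl (fun q _ => ?_)
      by_cases e1 : X v < X q <;> by_cases e2 : edgeSlope X Y v q ≤ edgeSlope X Y v x <;>
        simp [hw, e1, e2]
    · intro p _ hp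
      exact Finset.sum_eq_zero (fun q _ => by simp [hp])
    · simp
  have hs5 : (∑ y, if ¬ X x < X y ∧ edgeSlope X Y v x ≤ edgeSlope X Y x y then P x y else 0) =
      ∑ p, ∑ q, w p q * if q = x ∧ edgeSlope X Y v x ≤ edgeSlope X Y p q then 1 else 0 := by
    symm
    rw [Finset.sum_comm, Finset.sum_eq_single x]
    · refine Finset.sum_congr rfl (fun p _ => ?_)
      rw [edgeSlope_comm x p]
      rcases lt_trichotomy (X p) (X x) with e1 | e1 | e1
      · by_cases e2 : edgeSlope X Y v x ≤ edgeSlope X Y p x <;>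
          simp [hw, e1, e1.not_gt, e2, h1 x p]
      · obtain rfl := h.inj e1
        simp [hw, hdiag]
      · simp [hw, e1, e1.not_gt]
    · intro p _ hp
      exact Finset.sum_eq_zero (fun q _ => by simp [hp])
    · simp
  have hB : (∑ p, ∑ q, w p q * if LiesBelow X Y v x p then (1 : ZMod 2) else 0) +
      (∑ p, ∑ q, w p q * if LiesBelow X Y v x q then (1 : ZMod 2) else 0) = 0 := by
    rw [Finset.sum_comm (f := fun p q => w p q * if LiesBelow X Y v x q then (1 : ZMod 2) else 0),
      ← Finset.sum_add_distrib]
    refine Finset.sum_eq_zero (fun p _ => ?_)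
    rw [← Finset.sum_add_distrib]
    simp_rw [← add_mul, hwP]
    rw [← Finset.sum_mul, h3, zero_mul]
  have main : (∑ p, ∑ q, w p q * ((if PassBelow X Y v p q then (1 : ZMod 2) else 0) +
      (if p = v ∧ edgeSlope X Y p q ≤ edgeSlope X Y v x then 1 else 0) +
      (if LiesBelow X Y v x p then 1 else 0))) =
    ∑ p, ∑ q, w p q * ((if PassBelow X Y x p q then (1 : ZMod 2) else 0) +
      (if q = x ∧ edgeSlope X Y v x ≤ edgeSlope X Y p q then 1 else 0) +
      (if LiesBelow X Y v x q then 1 else 0)) := by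
    refine Finset.sum_congr rfl (fun p _ => Finset.sum_congr rfl (fun q _ => ?_))
    by_cases hpq : X p < X q
    · by_cases hP : P p q = 0
      · simp [hw, hP]
      · have ha := h2 p q hP
        rw [crossing_parity h.inj hlt hpq (h.vertex p q v ha) (h.vertex p q x ha)
          (h.vertex v x p hvx) (h.vertex v x q hvx) (h.edge p q v x ha hvx hpq hlt)]
    · simp [hw, hpq]
  simp only [mul_add, Finset.sum_add_distrib] at main
  rw [hcb v, hcb x, hs2, hs5]
  have h0 := CharTwo.add_self_eq_zero
    (∑ p, ∑ q, w p q * if LiesBelow X Y v x q then (1 : ZMod 2) else 0)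
  linear_combination main - hB + h0

open Classical in
theorem sum_le_eq (h : PlanarCoords G X Y)
    (h2 : ∀ v w, P v w ≠ 0 → G.Adj v w) {v x : V} (hvx : G.Adj v x) :
    (∑ y, if edgeAngle X Y v y ≤ edgeAngle X Y v x then P v y else 0) =
      (∑ y, if edgeAngle X Y v y < edgeAngle X Y v x then P v y else 0) + P v x := by
  have : P v x = ∑ y, if y = x then P v y else 0 := by simp
  rw [this, ← Finset.sum_add_distrib]
  refine Finset.sum_congr rfl (fun y _ => ?_)
  by_cases hP : P v y = 0
  · simp [hP]
  by_cases hy : y = x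
  · simp [hy]
  · have hne : edgeAngle X Y v y ≠ edgeAngle X Y v x := fun e =>
      hy (h.edgeAngle_inj (h2 v y hP) hvx e)
    simp [hy, le_iff_lt_or_eq, hne]

open Classical in
theorem color_of_lt (h : PlanarCoords G X Y) (h1 : ∀ v w, P v w = P w v)
    (h2 : ∀ v w, P v w ≠ 0 → G.Adj v w) (h3 : ∀ v, ∑ y, P v y = 0) {v x : V} (hvx : G.Adj v x)
    (hlt : X v < X x) :
    chainBelow X Y P v + (∑ y, if edgeAngle X Y v y ≤ edgeAngle X Y v x then P v y else 0) =
      chainBelow X Y P x + ∑ y, if edgeAngle X Y x y < edgeAngle X Y x v then P x y else 0 := by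
  have key := h.chainBelow_add h1 h2 h3 hvx hlt
  have e1 : (∑ y, if edgeAngle X Y v y ≤ edgeAngle X Y v x then P v y else 0) =
      ∑ y, if X v < X y ∧ edgeSlope X Y v y ≤ edgeSlope X Y v x then P v y else 0 :=
    Finset.sum_congr rfl (fun y _ => if_congr (edgeAngle_le_of_lt hlt y) rfl rfl)
  have e2 : (∑ y, if edgeAngle X Y x y < edgeAngle X Y x v then P x y else 0) +
      (∑ y, if ¬ X x < X y ∧ edgeSlope X Y v x ≤ edgeSlope X Y x y then P x y else 0) = 0 := by
    refine Eq.trans ?_ (h3 x)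
    rw [← Finset.sum_add_distrib]
    refine Finset.sum_congr rfl (fun y _ => ?_)
    rw [if_congr (edgeAngle_lt_of_not_lt hlt.not_gt y) rfl rfl, edgeSlope_comm v x]
    by_cases e : ¬ X x < X y ∧ edgeSlope X Y x v ≤ edgeSlope X Y x y
    · rw [if_neg (not_not.2 e), if_pos e, zero_add]
    · rw [if_pos e, if_neg e, add_zero]
  rw [e1, key]
  have h0 := CharTwo.add_self_eq_zero
    (∑ y, if ¬ X x < X y ∧ edgeSlope X Y v x ≤ edgeSlope X Y x y then P x y else 0)
  linear_combination h0 - e2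

open Classical in
theorem color (h : PlanarCoords G X Y) (h1 : ∀ v w, P v w = P w v)
    (h2 : ∀ v w, P v w ≠ 0 → G.Adj v w) (h3 : ∀ v, ∑ y, P v y = 0) {v x : V} (hvx : G.Adj v x) :
    chainBelow X Y P v + (∑ y, if edgeAngle X Y v y ≤ edgeAngle X Y v x then P v y else 0) =
      chainBelow X Y P x + ∑ y, if edgeAngle X Y x y < edgeAngle X Y x v then P x y else 0 := by
  rcases lt_trichotomy (X v) (X x) with hlt | heq | hlt
  · exact h.color_of_lt h1 h2 h3 hvx hlt
  · exact absurd (h.inj heq) hvx.ne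
  · have key := h.color_of_lt h1 h2 h3 hvx.symm hlt
    rw [h.sum_le_eq h2 hvx.symm] at key
    rw [h.sum_le_eq h2 hvx, h1 v x]
    have h0 := CharTwo.add_self_eq_zero (P x v)
    linear_combination h0 - key

theorem planarOrder (h : PlanarCoords G X Y) (r : V) (o : V → ℝ) :
    PlanarOrder {v | v ≠ r} {r} (piece G {v | v ≠ r} {r}) o (edgeAngle X Y) := by
  classical
  refine ⟨fun v x y hx hy he => h.edgeAngle_inj hx.1 hy.1 he, fun P h1 h2 h3 => ?_⟩
  have h2' : ∀ v w, P v w ≠ 0 → G.Adj v w := fun v w hvw => (h2 v w hvw).1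
  have htot : ∑ v, ∑ y, P v y = 0 := by
    rw [← Finset.sum_product']
    refine Finset.sum_involution (fun e _ => (e.2, e.1)) ?_ ?_ (fun _ _ => Finset.mem_univ _)
      (fun _ _ => rfl)
    · rintro ⟨a, b⟩ _
      simp only [h1 b a]
      exact CharTwo.add_self_eq_zero _
    · rintro ⟨a, b⟩ _ hne heq
      exact (h2' a b hne).ne (Prod.mk.inj heq).2
  have h3' : ∀ v, ∑ y, P v y = 0 := by
    intro v
    by_cases hv : v = r
    · rw [Finset.sum_eq_single r (fun u _ hu => h3 u hu) (by simp)] at htot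
      rw [hv]; exact htot
    · exact h3 v hv
  refine ⟨fun v => chainBelow X Y P v + chainBelow X Y P r, ?_, fun v x hvx => ?_⟩
  · rintro u rfl
    beta_reduce
    rw [CharTwo.add_self_eq_zero]
    symm
    refine Finset.sum_eq_zero (fun w _ => ?_)
    rw [h3' w, ite_self]
  · have key := h.color h1 h2' h3' hvx.1
    linear_combination key

end PlanarCoords

end

theorem exists_shear_injective {V : Type} [Finite V] {f : V → ℝ × ℝ} (hf : Function.Injective f) :
    ∃ t : ℝ, Function.Injective fun v => (f v).1 + t * (f v).2 := by
  have hfin : (⋃ p : V × V, {t : ℝ | p.1 ≠ p.2 ∧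
      (f p.1).1 + t * (f p.1).2 = (f p.2).1 + t * (f p.2).2}).Finite := by
    refine Set.finite_iUnion (fun p => Set.Subsingleton.finite ?_)
    rintro s ⟨hne, hs⟩ t ⟨-, ht⟩
    by_contra hst
    have hy : (s - t) * ((f p.1).2 - (f p.2).2) = 0 := by linear_combination hs - ht
    have hy' : (f p.1).2 = (f p.2).2 :=
      sub_eq_zero.1 ((mul_eq_zero.1 hy).resolve_left (sub_ne_zero.2 hst))
    refine hne (hf (Prod.ext ?_ hy'))
    rw [hy'] at hs
    linarith
  obtain ⟨t, ht⟩ := hfin.exists_notMem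
  refine ⟨t, fun u v huv => ?_⟩
  by_contra hne
  exact ht (Set.mem_iUnion.2 ⟨(u, v), hne, huv⟩)

theorem mem_openSegment_of_shear {V : Type} {f : V → ℝ × ℝ} {t T : ℝ} {X Y : V → ℝ}
    (hX : ∀ v, X v = (f v).1 + t * (f v).2) (hY : ∀ v, Y v = (f v).2) {p q : V} (h1 : X p < T)
    (h2 : T < X q) :
    (T - t * edgeHeight X Y p q T, edgeHeight X Y p q T) ∈ openSegment ℝ (f p) (f q) := by
  have h0 : 0 < X q - X p := by linarith
  have hh : edgeHeight X Y p q T = Y p + (T - X p) / (X q - X p) * (Y q - Y p) := by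
    unfold edgeHeight edgeSlope
    ring
  have hT : T = X p + (T - X p) / (X q - X p) * (X q - X p) := by
    rw [div_mul_cancel₀ _ h0.ne']
    ring
  refine ⟨1 - (T - X p) / (X q - X p), (T - X p) / (X q - X p), ?_,
    div_pos (by linarith) h0, by ring, ?_⟩
  · rw [sub_pos, div_lt_one h0]
    linarith
  · rw [hh]
    refine Prod.ext ?_ ?_
    · simp only [Prod.fst_add, Prod.smul_fst, smul_eq_mul]
      have e1 := hX p
      have e2 := hX q
      rw [← hY] at e1 e2
      generalize (T - X p) / (X q - X p) = s at hT
      rw [hT, e1, e2]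
      ring
    · simp only [Prod.snd_add, Prod.smul_snd, smul_eq_mul, hY]
      ring

theorem IsPlanarDrawing.exists_planarCoords {V : Type} [Fintype V] {G : SimpleGraph V}
    {f : V → ℝ × ℝ} (h : IsPlanarDrawing G f) : ∃ X Y : V → ℝ, PlanarCoords G X Y := by
  obtain ⟨t, ht⟩ := exists_shear_injective h.1
  obtain ⟨X, hX⟩ : ∃ X : V → ℝ, ∀ v, X v = (f v).1 + t * (f v).2 := ⟨_, fun _ => rfl⟩
  obtain ⟨Y, hY⟩ : ∃ Y : V → ℝ, ∀ v, Y v = (f v).2 := ⟨_, fun _ => rfl⟩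
  refine ⟨X, Y, fun u v huv => ht ?_, fun p q v hpq h1 h2 he => ?_,
    fun p q v x hpq hvx hlt hlt' hne T h1 h2 h3 h4 he => ?_⟩
  · rwa [hX, hX] at huv
  · refine h.2.2 p q v hpq (fun e => h1.ne (by rw [e])) (fun e => h2.ne (by rw [e])) ?_
    have := mem_openSegment_of_shear hX hY h1 h2
    rw [he] at this
    convert this using 1
    refine Prod.ext ?_ (hY v).symm
    simp only [hX, hY]
    ring
  · have hs : s(p, q) ≠ s(v, x) := by
      intro e
      rcases Sym2.eq_iff.1 e with e1 | ⟨rfl, rfl⟩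
      · exact hne e1
      · exact lt_asymm hlt hlt'
    have m1 := openSegment_subset_segment _ _ _ (mem_openSegment_of_shear hX hY h1 h3)
    have m2 := openSegment_subset_segment _ _ _ (mem_openSegment_of_shear hX hY h2 h4)
    rw [← he] at m2
    obtain ⟨u, hu, -, hu2⟩ := h.2.1 p q v x hpq hvx hs _ m1 m2
    have hT : T = X u := by
      rw [hX, ← hu2]
      ring
    rcases hu with rfl | rfl
    · exact h1.ne hT.symm
    · exact h3.ne hT

theorem SimpleGraph.Connected.exists_adj_reachIn {V : Type} {G : SimpleGraph V} (h : G.Connected)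
    {r v : V} (hv : v ≠ r) : ∃ u ∈ {w | w ≠ r}, G.Adj r u ∧ ReachIn G.Adj {w | w ≠ r} v u := by
  obtain ⟨p⟩ := h.preconnected v r
  induction p with
  | nil => exact absurd rfl hv
  | @cons a b r hab p ih =>
    by_cases hb : b = r
    · subst hb
      exact ⟨a, hv, hab.symm, Relation.ReflTransGen.refl⟩
    · obtain ⟨u, hu, h1, h2⟩ := ih hb
      exact ⟨u, hu, h1, Relation.ReflTransGen.head ⟨hab, hv, hb⟩ h2⟩

theorem ForestContour.rootedContour {V : Type} {G : SimpleGraph V} {r : V} {par : V → V}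
    {o z : V → ℝ}
    (h : ForestContour G {v | v ≠ r} {r} (piece G {v | v ≠ r} {r}) par o z) :
    RootedContour G r par o z := by
  have hmem : ∀ v, v ∈ {v | v ≠ r} ∪ {r} := fun v => (em (v = r)).symm
  have hpiece : ∀ v w, G.Adj v w → piece G {v | v ≠ r} {r} v w := fun v w hvw =>
    ⟨hvw, hmem v, hmem w, by
      by_cases hv : v = r
      · exact Or.inr (fun hw => hvw.ne (hv.trans hw.symm))
      · exact Or.inl hv⟩
  have hroot : ∀ v, v ≠ r → o r < o v ∧ z v < z r := by
    intro v hv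
    obtain ⟨u, rfl, hu⟩ := h.root v hv
    exact hu
  exact {
    lt := fun v => h.lt v (hmem v)
    adj := h.adj
    par_o := h.par_o
    par_z := h.par_z
    laminar := by
      intro v w hvw
      by_cases hv : v = r
      · subst hv
        exact Or.inr (Or.inr (Or.inl (hroot w hvw.symm)))
      · by_cases hw : w = r
        · subst hw
          exact Or.inr (Or.inr (Or.inr (hroot v hv)))
        · exact h.laminar v hv w hw hvw
    least := fun v w hv => h.least v hv w (hmem w)
    edge := fun v w hvw => h.edge v w (hpiece v w hvw)
    nc := fun i j i' j' h1 h2 => h.nc i j i' j' (hpiece i j h1) (hpiece i' j' h2)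
    root := hroot }

/-- There is a constant `C > 0` such that every connected planar
graph on `n ≥ 1` vertices admits a monotone grid drawing on the grid
`[0, C·n] × [0, C·n²]`. -/
theorem monotone_grid_drawing_of_connected_planar :
    ∃ C : ℝ, 0 < C ∧
      ∀ (V : Type) (_ : Fintype V) (G : SimpleGraph V),
        1 ≤ Fintype.card V →
        G.Connected →
        (∃ f : V → ℝ × ℝ, IsPlanarDrawing G f) →
        ∃ g : V → ℤ × ℤ,
          IsMonotoneDrawing G (gridMap g) ∧
          ∀ v : V,
            0 ≤ (g v).1 ∧ ((g v).1 : ℝ) ≤ C * (Fintype.card V : ℝ) ∧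
            0 ≤ (g v).2 ∧ ((g v).2 : ℝ) ≤ C * (Fintype.card V : ℝ) ^ 2 := by
  refine ⟨1, one_pos, fun V _ G hn hG ⟨f, hf⟩ => ?_⟩
  obtain ⟨r⟩ := hG.nonempty
  obtain ⟨X, Y, hXY⟩ := hf.exists_planarCoords
  have hD : Disjoint {v : V | v ≠ r} {r} := Set.disjoint_singleton_right.2 (fun h => h rfl)
  obtain ⟨par, o, z, -, h, -⟩ := fillable G {v | v ≠ r} {r} hD r (fun _ => 0) (fun _ => 1)
    (edgeAngle X Y) rfl (hXY.planarOrder r _) (fun _ _ => one_pos)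
    (fun u hu w hw huw => absurd (hu.trans hw.symm) huw) (fun v hv => hG.exists_adj_reachIn hv)
  simpa only [one_mul] using h.rootedContour.exists_monotone_grid_drawing
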